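/- Let λ > 1 be a real constant. There exists a smooth simple closed curve γ(u) = (r(u), x(u)), u ∈ ℝ periodic with period 1 and injective on [0,1), with r(u) > 0 and (r'(u))² + (x'(u))² > 0 for all u, which satisfies the geodesic equation (x'r'' − x''r')/((x')² + (r')²) = ((λ−1)/r − r/2)·x' + (1/2)·x·r' of the half-plane metric g = r^{2(λ−1)} e^{−(r²+x²)/2}(dr²+dx²), and whose length with respect to g, namely ∫₀¹ r(u)^{λ−1} e^{−(r(u)²+x(u)²)/4} √((r'(u))² + (x'(u))²) du, is strictly less than 2∫₀^∞ u^{λ−1} e^{−u²/4} du (the length of the double cover of the half-line x = 0). -/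

import Mathlib

open Real MeasureTheory

namespace Angenent

section

open Set in
theorem floor_eq_of_forall_ne_int {f : ℝ → ℝ} {a b : ℝ} (hab : a ≤ b)
    (hf : ContinuousOn f (Icc a b)) (hne : ∀ t ∈ Icc a b, ∀ k : ℤ, f t ≠ k) :
    ⌊f a⌋ = ⌊f b⌋ := by
  have key : ∀ k : ℤ, (k : ℝ) ∈ uIcc (f a) (f b) → False := by
    intro k hk
    have := intermediate_value_uIcc (a := a) (b := b) (f := f) (by rwa [uIcc_of_le hab])
    obtain ⟨t, ht, hkt⟩ := this hk
    rw [uIcc_of_le hab] at ht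
    exact hne t ht k hkt
  by_contra hcon
  rcases lt_or_gt_of_ne hcon with h | h
  · refine key ⌊f b⌋ ?_
    have h1 : f a < ⌊f b⌋ := Int.floor_lt.mp h
    exact mem_uIcc.mpr (Or.inl ⟨h1.le, Int.floor_le _⟩)
  · refine key ⌊f a⌋ ?_
    have h1 : f b < ⌊f a⌋ := Int.floor_lt.mp h
    exact mem_uIcc.mpr (Or.inr ⟨h1.le, Int.floor_le _⟩)

/-- Sheet number of a logarithm, the sheets being separated by the positive real ray. -/
noncomputable def sheetPos (L : ℂ) : ℤ := ⌊L.im / (2 * π)⌋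

/-- Sheet number of a logarithm, the sheets being separated by the negative real ray. -/
noncomputable def sheetNeg (L : ℂ) : ℤ := ⌊(L.im + π) / (2 * π)⌋

open Set in
theorem sheetPos_eq_of_avoids {L : ℝ → ℂ} {a b : ℝ} (hab : a ≤ b)
    (hL : ContinuousOn L (Icc a b))
    (hne : ∀ t ∈ Icc a b, (Complex.exp (L t)).im = 0 → (Complex.exp (L t)).re < 0) :
    sheetPos (L a) = sheetPos (L b) := by
  refine floor_eq_of_forall_ne_int (f := fun t => (L t).im / (2 * π)) hab
    ((Complex.continuous_im.comp_continuousOn hL).div_const _) ?_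
  intro t ht k hk
  have h1 : (L t).im = k * (2 * π) := by
    field_simp at hk; linarith
  have h2 : (Complex.exp (L t)).im = 0 := by
    rw [Complex.exp_im, h1]
    have := Real.sin_int_mul_pi (2 * k)
    push_cast at this
    rw [show (k : ℝ) * (2 * π) = 2 * k * π by ring, this, mul_zero]
  have h3 := hne t ht h2
  rw [Complex.exp_re, h1, Real.cos_int_mul_two_pi, mul_one] at h3
  exact absurd h3 (not_lt.mpr (Real.exp_pos _).le)

open Set in
theorem sheetNeg_eq_of_avoids {L : ℝ → ℂ} {a b : ℝ} (hab : a ≤ b)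
    (hL : ContinuousOn L (Icc a b))
    (hne : ∀ t ∈ Icc a b, (Complex.exp (L t)).im = 0 → 0 < (Complex.exp (L t)).re) :
    sheetNeg (L a) = sheetNeg (L b) := by
  refine floor_eq_of_forall_ne_int (f := fun t => ((L t).im + π) / (2 * π)) hab
    (((Complex.continuous_im.comp_continuousOn hL).add continuousOn_const).div_const _) ?_
  intro t ht k hk
  have h1 : (L t).im = k * (2 * π) - π := by
    field_simp at hk; linarith
  have h2 : (Complex.exp (L t)).im = 0 := by
    rw [Complex.exp_im, h1]
    have := Real.sin_int_mul_pi (2 * k - 1)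
    push_cast at this
    rw [show (k : ℝ) * (2 * π) - π = (2 * k - 1) * π by ring, this, mul_zero]
  have h3 := hne t ht h2
  rw [Complex.exp_re, h1, Real.cos_sub_pi, Real.cos_int_mul_two_pi] at h3
  have := Real.exp_pos (L t).re
  linarith

theorem sheetPos_eq_sheetNeg_sub {L : ℂ} (h : (Complex.exp L).im ≠ 0) :
    sheetPos L = sheetNeg L - if (Complex.exp L).im < 0 then 1 else 0 := by
  have hpi := Real.pi_pos
  unfold sheetPos sheetNeg
  set k := ⌊(L.im + π) / (2 * π)⌋ with hk
  have h1 : (k : ℝ) ≤ (L.im + π) / (2 * π) := Int.floor_le _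
  have h2 : (L.im + π) / (2 * π) < k + 1 := Int.lt_floor_add_one _
  rw [le_div_iff₀ (by positivity)] at h1
  rw [div_lt_iff₀ (by positivity)] at h2
  have hs : Real.sin L.im = Real.sin (L.im - k * (2 * π)) :=
    (Real.sin_sub_int_mul_two_pi _ _).symm
  have hex := Real.exp_pos L.re
  rw [Complex.exp_im] at h ⊢
  split_ifs with hneg
  · have hsin : Real.sin (L.im - k * (2 * π)) < 0 := by
      rw [← hs]; by_contra hc; push Not at hc; nlinarith [mul_nonneg hex.le hc]
    have : L.im - k * (2 * π) < 0 := by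
      by_contra hc
      push Not at hc
      have := Real.sin_nonneg_of_nonneg_of_le_pi hc (by linarith)
      linarith
    rw [Int.floor_eq_iff]
    push_cast
    constructor
    · rw [le_div_iff₀ (by positivity)]; nlinarith
    · rw [div_lt_iff₀ (by positivity)]; nlinarith
  · have hsin : 0 < Real.sin (L.im - k * (2 * π)) := by
      rw [← hs]; by_contra hc; push Not at hc hneg
      apply h
      have : Real.sin L.im = 0 := by
        rcases hc.lt_or_eq with h3 | h3
        · nlinarith [mul_pos hex (neg_pos.mpr h3)]
        · exact h3
      rw [this, mul_zero]
    have : 0 ≤ L.im - k * (2 * π) := by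
      by_contra hc
      push Not at hc
      have := Real.sin_nonpos_of_nonpos_of_neg_pi_le hc.le (by linarith)
      linarith
    rw [sub_zero, Int.floor_eq_iff]
    constructor
    · rw [le_div_iff₀ (by positivity)]; nlinarith
    · rw [div_lt_iff₀ (by positivity)]; nlinarith

theorem exists_continuous_log (z : ℝ × ℝ → ℂ) (hz : Continuous z) (h0 : ∀ p, z p ≠ 0) :
    ∃ L : ℝ × ℝ → ℂ, Continuous L ∧ ∀ p, Complex.exp (L p) = z p := by
  let f : C(ℝ × ℝ, {z : ℂ // z ≠ 0}) := ⟨fun p => ⟨z p, h0 p⟩, by fun_prop⟩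
  obtain ⟨F, ⟨-, hF⟩, -⟩ := Complex.isCoveringMap_exp.existsUnique_continuousMap_lifts f (0, 0)
    (Complex.log (z (0, 0))) (Subtype.ext (Complex.exp_log (h0 _)))
  refine ⟨F, F.continuous, fun p => ?_⟩
  have := congrFun hF p
  exact congrArg Subtype.val this

/-- A continuous logarithm of the chords of an injective plane curve. -/
theorem exists_chord_log (Γ : ℝ → ℂ) (hc : Continuous Γ) (hi : Function.Injective Γ) :
    ∃ L : ℝ → ℝ → ℂ, ContinuousOn (fun p : ℝ × ℝ => L p.1 p.2) {p | p.1 < p.2} ∧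
      ∀ s t, s < t → Complex.exp (L s t) = Γ t - Γ s := by
  obtain ⟨F, hF, hF2⟩ := exists_continuous_log (fun p => Γ (p.1 + Real.exp p.2) - Γ p.1)
    (by fun_prop) (fun p h => by
      have := hi (sub_eq_zero.mp h)
      have := Real.exp_pos p.2
      linarith)
  refine ⟨fun s t => F (s, Real.log (t - s)), ?_, fun s t hst => ?_⟩
  · refine hF.comp_continuousOn (continuousOn_fst.prodMk (ContinuousOn.log (by fun_prop) ?_))
    intro p hp
    have : p.1 < p.2 := hp
    exact (sub_pos.mpr this).ne'
  · rw [hF2]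
    simp only
    rw [Real.exp_log (sub_pos.mpr hst)]
    ring_nf

end

section

/-- The edges of the polygonal curve `Γ` (with vertices at `0, …, n`) that cross height `c`. -/
noncomputable def crossSet (Γ : ℝ → ℂ) (n : ℕ) (c : ℝ) : Finset ℕ :=
  (Finset.range n).filter
    (fun k => ((Γ k).im - c) * ((Γ ((k : ℝ) + 1)).im - c) < 0)

/-- The sign with which an edge crosses height `c`. -/
noncomputable def crossSign (Γ : ℝ → ℂ) (c : ℝ) (k : ℕ) : ℤ :=
  (if (Γ k).im < c then 1 else 0) - (if (Γ ((k : ℝ) + 1)).im < c then 1 else 0)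

/-- The abscissa at which the line through an edge crosses height `c`. -/
noncomputable def crossAbs (Γ : ℝ → ℂ) (c : ℝ) (k : ℕ) : ℝ :=
  (Γ k).re + (c - (Γ k).im) / ((Γ ((k : ℝ) + 1)).im - (Γ k).im) *
    ((Γ ((k : ℝ) + 1)).re - (Γ k).re)

structure PolygonalArc (Γ : ℝ → ℂ) (n : ℕ) : Prop where
  cont : Continuous Γ
  inj : Function.Injective Γ
  affine : ∀ k : ℕ, k < n → ∀ t : ℝ, (k : ℝ) ≤ t → t ≤ k + 1 →
    Γ t = Γ k + ((t - k : ℝ) : ℂ) * (Γ ((k : ℝ) + 1) - Γ k)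
  bot : ∀ t : ℝ, 0 < t → t ≤ n → (Γ 0).im < (Γ t).im
  top : ∀ t : ℝ, 0 ≤ t → t < n → (Γ t).im < (Γ n).im

variable {Γ : ℝ → ℂ} {n : ℕ} {c : ℝ}

theorem PolygonalArc.im_affine (h : PolygonalArc Γ n) {k : ℕ} (hk : k < n) {t : ℝ}
    (h1 : (k : ℝ) ≤ t) (h2 : t ≤ k + 1) :
    (Γ t).im = (Γ k).im + (t - k) * ((Γ ((k : ℝ) + 1)).im - (Γ k).im) := by
  rw [h.affine k hk t h1 h2, Complex.add_im, Complex.im_ofReal_mul, Complex.sub_im]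

theorem PolygonalArc.re_affine (h : PolygonalArc Γ n) {k : ℕ} (hk : k < n) {t : ℝ}
    (h1 : (k : ℝ) ≤ t) (h2 : t ≤ k + 1) :
    (Γ t).re = (Γ k).re + (t - k) * ((Γ ((k : ℝ) + 1)).re - (Γ k).re) := by
  rw [h.affine k hk t h1 h2, Complex.add_re, Complex.re_ofReal_mul, Complex.sub_re]

theorem PolygonalArc.crossing_of_im_eq (h : PolygonalArc Γ n) {k : ℕ} (hk : k < n) {t : ℝ}
    (h1 : (k : ℝ) ≤ t) (h2 : t ≤ k + 1) (hk0 : (Γ k).im ≠ c) (hk1 : (Γ ((k : ℝ) + 1)).im ≠ c)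
    (ht : (Γ t).im = c) : k ∈ crossSet Γ n c ∧ (Γ t).re = crossAbs Γ c k := by
  have him := h.im_affine hk h1 h2
  rw [ht] at him
  have hmem : ((Γ k).im - c) * ((Γ ((k : ℝ) + 1)).im - c) < 0 := by
    have e : (Γ ((k : ℝ) + 1)).im - c = (k + 1 - t) * ((Γ ((k : ℝ) + 1)).im - (Γ k).im) := by
      rw [him]; ring
    have e' : (Γ k).im - c = - ((t - k) * ((Γ ((k : ℝ) + 1)).im - (Γ k).im)) := by
      rw [him]; ring
    have hne : (Γ k).im - c ≠ 0 := sub_ne_zero.mpr hk0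
    have hne' : (Γ ((k : ℝ) + 1)).im - c ≠ 0 := sub_ne_zero.mpr hk1
    have hle : ((Γ k).im - c) * ((Γ ((k : ℝ) + 1)).im - c) ≤ 0 := by
      rw [e, e']
      have : 0 ≤ (t - k) * (k + 1 - t) := mul_nonneg (by linarith) (by linarith)
      nlinarith [mul_nonneg this (sq_nonneg ((Γ ((k : ℝ) + 1)).im - (Γ k).im))]
    exact lt_of_le_of_ne hle (mul_ne_zero hne hne')
  refine ⟨by simp [crossSet, hk, hmem], ?_⟩
  have hd : (Γ ((k : ℝ) + 1)).im - (Γ k).im ≠ 0 := by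
    intro h0
    rw [h0] at him
    apply hk0; linarith
  rw [h.re_affine hk h1 h2, crossAbs, eq_comm]
  congr 2
  field_simp
  linarith

/-- The parameter at which an edge crosses height `c`. -/
theorem PolygonalArc.exists_crossing (h : PolygonalArc Γ n) {k : ℕ} (hk : k ∈ crossSet Γ n c) :
    ∃ t : ℝ, (k : ℝ) < t ∧ t < k + 1 ∧ (Γ t).im = c ∧ (Γ t).re = crossAbs Γ c k := by
  obtain ⟨hk, hm⟩ := Finset.mem_filter.mp hk
  have hkn := Finset.mem_range.mp hk
  set a := (Γ k).im with ha
  set b := (Γ ((k : ℝ) + 1)).im with hb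
  have hd : b - a ≠ 0 := by
    intro h0
    have : b = a := by linarith
    rw [this] at hm
    nlinarith [mul_self_nonneg (a - c)]
  have hu : 0 < (c - a) / (b - a) ∧ (c - a) / (b - a) < 1 := by
    rcases mul_neg_iff.mp hm with ⟨h1, h2⟩ | ⟨h1, h2⟩
    · constructor
      · exact div_pos_of_neg_of_neg (by linarith) (by linarith)
      · rw [div_lt_one_of_neg (by linarith)]; linarith
    · constructor
      · exact div_pos (by linarith) (by linarith)
      · rw [div_lt_one (by linarith)]; linarith
  have hl : (k : ℝ) ≤ k + (c - a) / (b - a) := by linarith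
  have hr : k + (c - a) / (b - a) ≤ (k : ℝ) + 1 := by linarith
  refine ⟨k + (c - a) / (b - a), by linarith, by linarith, ?_, ?_⟩
  · rw [h.im_affine hkn hl hr, ← ha, ← hb]
    field_simp
    ring
  · rw [h.re_affine hkn hl hr, crossAbs, ← ha, ← hb]
    ring

end

section

variable {Γ : ℝ → ℂ} {n : ℕ} {c : ℝ}

theorem PolygonalArc.crossAbs_injOn (h : PolygonalArc Γ n) :
    Set.InjOn (crossAbs Γ c) (crossSet Γ n c) := by
  intro i hi j hj hij
  obtain ⟨t, ht1, ht2, ht3, ht4⟩ := h.exists_crossing (Finset.mem_coe.mp hi)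
  obtain ⟨s, hs1, hs2, hs3, hs4⟩ := h.exists_crossing (Finset.mem_coe.mp hj)
  have hts : t = s := h.inj (Complex.ext (by rw [ht4, hs4, hij]) (by rw [ht3, hs3]))
  subst hts
  have h1 : (i : ℝ) < j + 1 := by linarith
  have h2 : (j : ℝ) < i + 1 := by linarith
  have h1' : i < j + 1 := by exact_mod_cast h1
  have h2' : j < i + 1 := by exact_mod_cast h2
  omega

open Classical in
/-- The signed number of crossings to the right of a given one is `0` or `1`,
according to the sign of the latter. -/
theorem PolygonalArc.sum_crossSign_right (h : PolygonalArc Γ n)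
    (hc : ∀ k : ℕ, k ≤ n → (Γ k).im ≠ c) {i : ℕ} (hi : i ∈ crossSet Γ n c) :
    ∑ k ∈ (crossSet Γ n c).filter (fun k => crossAbs Γ c i < crossAbs Γ c k), crossSign Γ c k
      = if crossSign Γ c i < 0 then 1 else 0 := by
  have hc' : ∀ k : ℕ, k < n → (Γ ((k : ℝ) + 1)).im ≠ c := by
    intro k hk
    have := hc (k + 1) hk
    push_cast at this
    exact this
  have hin : i < n := Finset.mem_range.mp (Finset.mem_filter.mp hi).1
  have hinR : (i : ℝ) + 1 ≤ n := by exact_mod_cast hin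
  obtain ⟨p, hp1, hp2, hp3, hp4⟩ := h.exists_crossing hi
  obtain ⟨L, hL, hLe⟩ := exists_chord_log Γ h.cont h.inj
  have hcr : ∀ s a b : ℝ, s < a → ContinuousOn (fun t => L s t) (Set.Icc a b) := by
    intro s a b hsa
    exact hL.comp (f := fun t : ℝ => (s, t)) (by fun_prop)
      (fun t ht => lt_of_lt_of_le hsa ht.1)
  have hcl : ∀ t a b : ℝ, b < t → ContinuousOn (fun s => L s t) (Set.Icc a b) := by
    intro t a b hbt
    exact hL.comp (f := fun s : ℝ => (s, t)) (by fun_prop)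
      (fun s hs => lt_of_le_of_lt hs.2 hbt)
  set H : ℕ → ℤ := fun k => if k ∈ crossSet Γ n c ∧ crossAbs Γ c i < crossAbs Γ c k
    then crossSign Γ c k else 0 with hH
  have hsame : ∀ k < n, k ∉ crossSet Γ n c → ((Γ k).im < c ↔ (Γ ((k : ℝ) + 1)).im < c) := by
    intro k hk hnot
    have h0 := hc k hk.le
    have h1 := hc' k hk
    have : ¬ ((Γ k).im - c) * ((Γ ((k : ℝ) + 1)).im - c) < 0 := by
      intro hlt; apply hnot; simp [crossSet, hk, hlt]
    push Not at this
    constructor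
    · intro hlt
      by_contra hge
      push Not at hge
      have : c < (Γ ((k : ℝ) + 1)).im := lt_of_le_of_ne hge (Ne.symm h1)
      nlinarith
    · intro hlt
      by_contra hge
      push Not at hge
      have : c < (Γ k).im := lt_of_le_of_ne hge (Ne.symm h0)
      nlinarith
  have hflip : ∀ a : ℝ, a ≠ c → (if c < a then (1:ℤ) else 0) = 1 - if a < c then 1 else 0 := by
    intro a ha
    rcases lt_or_gt_of_ne ha with h1 | h1
    · simp [h1, not_lt.mpr h1.le]
    · simp [h1, not_lt.mpr h1.le]
  -- crossings before the given one
  have hA : ∀ k : ℕ, k < i → H k = sheetNeg (L ((k : ℝ) + 1) p) - sheetNeg (L k p) := by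
    intro k hk
    have hkn : k < n := hk.trans hin
    have hkR : (k : ℝ) + 1 ≤ i := by exact_mod_cast hk
    have hk1 : (k : ℝ) + 1 < p := by linarith
    have e0 := hLe k p (by linarith)
    have e1 := hLe ((k : ℝ) + 1) p hk1
    have cont := hcl p k (k + 1) hk1
    have edge : ∀ s ∈ Set.Icc (k : ℝ) (k + 1), (Complex.exp (L s p)).im = 0 →
        k ∈ crossSet Γ n c ∧ (Complex.exp (L s p)).re = crossAbs Γ c i - crossAbs Γ c k := by
      intro s hs him
      rw [hLe s p (by linarith [hs.2]), Complex.sub_im, hp3] at him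
      obtain ⟨g1, g2⟩ := h.crossing_of_im_eq hkn hs.1 hs.2 (hc k hkn.le) (hc' k hkn)
        (by linarith)
      exact ⟨g1, by rw [hLe s p (by linarith [hs.2]), Complex.sub_re, hp4, g2]⟩
    have hne : ∀ s ∈ Set.Icc (k : ℝ) (k + 1), (Complex.exp (L s p)).im = 0 →
        crossAbs Γ c i - crossAbs Γ c k ≠ 0 := by
      intro s hs him h0
      rw [← (edge s hs him).2] at h0
      exact Complex.exp_ne_zero (L s p) (Complex.ext h0 him)
    have s0 := sheetPos_eq_sheetNeg_sub (L := L k p) (by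
      rw [e0, Complex.sub_im, hp3]; exact sub_ne_zero.mpr (hc k hkn.le).symm)
    have s1 := sheetPos_eq_sheetNeg_sub (L := L ((k : ℝ) + 1) p) (by
      rw [e1, Complex.sub_im, hp3]; exact sub_ne_zero.mpr (hc' k hkn).symm)
    rw [e0, Complex.sub_im, hp3] at s0
    rw [e1, Complex.sub_im, hp3] at s1
    simp only [sub_neg, hflip _ (hc k hkn.le)] at s0
    simp only [sub_neg, hflip _ (hc' k hkn)] at s1
    by_cases hr : k ∈ crossSet Γ n c ∧ crossAbs Γ c i < crossAbs Γ c k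
    · have := sheetPos_eq_of_avoids (by linarith) cont (fun s hs him => by
        rw [(edge s hs him).2]; linarith [hr.2])
      simp only [hH, if_pos hr, crossSign]
      linarith
    · simp only [hH, if_neg hr]
      have := sheetNeg_eq_of_avoids (by linarith) cont (fun s hs him => by
        have g := edge s hs him
        have g2 := hne s hs him
        rw [g.2]
        by_contra hcon
        push Not at hcon
        exact hr ⟨g.1, by linarith [lt_of_le_of_ne hcon g2]⟩)
      linarith
  have hB : ∀ k : ℕ, i < k → k < n → H k = sheetPos (L p ((k : ℝ) + 1)) - sheetPos (L p k) := by
    intro k hk hkn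
    have hkR : (i : ℝ) + 1 ≤ k := by exact_mod_cast hk
    have hk1 : p < k := by linarith
    have e0 := hLe p k hk1
    have e1 := hLe p ((k : ℝ) + 1) (by linarith)
    have cont := hcr p k (k + 1) hk1
    have edge : ∀ s ∈ Set.Icc (k : ℝ) (k + 1), (Complex.exp (L p s)).im = 0 →
        k ∈ crossSet Γ n c ∧ (Complex.exp (L p s)).re = crossAbs Γ c k - crossAbs Γ c i := by
      intro s hs him
      rw [hLe p s (by linarith [hs.1]), Complex.sub_im, hp3] at him
      obtain ⟨g1, g2⟩ := h.crossing_of_im_eq hkn hs.1 hs.2 (hc k hkn.le) (hc' k hkn)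
        (by linarith)
      exact ⟨g1, by rw [hLe p s (by linarith [hs.1]), Complex.sub_re, hp4, g2]⟩
    have hne : ∀ s ∈ Set.Icc (k : ℝ) (k + 1), (Complex.exp (L p s)).im = 0 →
        crossAbs Γ c k - crossAbs Γ c i ≠ 0 := by
      intro s hs him h0
      rw [← (edge s hs him).2] at h0
      exact Complex.exp_ne_zero (L p s) (Complex.ext h0 him)
    have s0 := sheetPos_eq_sheetNeg_sub (L := L p k) (by
      rw [e0, Complex.sub_im, hp3]; exact sub_ne_zero.mpr (hc k hkn.le))
    have s1 := sheetPos_eq_sheetNeg_sub (L := L p ((k : ℝ) + 1)) (by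
      rw [e1, Complex.sub_im, hp3]; exact sub_ne_zero.mpr (hc' k hkn))
    rw [e0, Complex.sub_im, hp3] at s0
    rw [e1, Complex.sub_im, hp3] at s1
    simp only [sub_neg] at s0 s1
    by_cases hr : k ∈ crossSet Γ n c ∧ crossAbs Γ c i < crossAbs Γ c k
    · have := sheetNeg_eq_of_avoids (by linarith) cont (fun s hs him => by
        rw [(edge s hs him).2]; linarith [hr.2])
      simp only [hH, if_pos hr, crossSign]
      linarith
    · simp only [hH, if_neg hr]
      exact (sub_eq_zero.mpr (sheetPos_eq_of_avoids (by linarith) cont (fun s hs him => by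
        have g := edge s hs him
        have g2 := hne s hs him
        rw [g.2]
        by_contra hcon
        push Not at hcon
        exact hr ⟨g.1, by linarith [lt_of_le_of_ne hcon g2.symm]⟩)).symm).symm
  have hsumA : ∀ m : ℕ, m ≤ i → ∑ k ∈ Finset.range m, H k
      = sheetNeg (L m p) - sheetNeg (L (0 : ℕ) p) := by
    intro m
    induction m with
    | zero => intro _; simp
    | succ m ih =>
      intro hm
      rw [Finset.sum_range_succ, ih (by omega), hA m (by omega)]
      push_cast; ring
  have hsumB : ∀ m : ℕ, i + 1 ≤ m → m ≤ n → ∑ k ∈ Finset.Ico (i + 1) m, H k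
      = sheetPos (L p m) - sheetPos (L p ((i : ℝ) + 1)) := by
    intro m hm
    induction m, hm using Nat.le_induction with
    | base => intro _; simp
    | succ m hm ih =>
      intro hmn
      rw [Finset.sum_Ico_succ_top (by omega), ih (by omega), hB m (by omega) (by omega)]
      push_cast; ring
  have hHi : H i = 0 := by simp [hH]
  have htot : ∑ k ∈ Finset.range n, H k
      = (sheetNeg (L i p) - sheetNeg (L (0 : ℕ) p))
        + (sheetPos (L p n) - sheetPos (L p ((i : ℝ) + 1))) := by
    rw [← hsumA i le_rfl, ← hsumB n (by omega) le_rfl, ← Finset.sum_range_add_sum_Ico H hin,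
      Finset.sum_range_succ, hHi, add_zero]
  have hlhs : ∑ k ∈ (crossSet Γ n c).filter (fun k => crossAbs Γ c i < crossAbs Γ c k),
      crossSign Γ c k = ∑ k ∈ Finset.range n, H k := by
    rw [hH, ← Finset.sum_filter]
    refine Finset.sum_congr ?_ (fun _ _ => rfl)
    ext k
    simp only [Finset.mem_filter, Finset.mem_range]
    constructor
    · intro hk
      exact ⟨Finset.mem_range.mp (Finset.mem_filter.mp hk.1).1, hk⟩
    · exact fun hk => hk.2
  rw [hlhs, htot]
  have hp0 : 0 < p := by
    have : (0 : ℝ) ≤ i := Nat.cast_nonneg i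
    linarith
  have hpn : p < n := by linarith
  -- the arc stays above its initial point and below its final point
  have q1 : sheetPos (L p n) = sheetPos (L 0 n) := by
    refine (sheetPos_eq_of_avoids (L := fun s => L s n) hp0.le (hcl n 0 p hpn) ?_).symm
    intro s hs him
    rw [hLe s n (by linarith [hs.2]), Complex.sub_im] at him
    have := h.top s hs.1 (by linarith [hs.2])
    linarith
  have q2 : sheetPos (L 0 p) = sheetPos (L 0 n) := by
    refine sheetPos_eq_of_avoids (L := fun t => L 0 t) hpn.le (hcr 0 p n hp0) ?_
    intro s hs him
    rw [hLe 0 s (by linarith [hs.1]), Complex.sub_im] at him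
    have := h.bot s (by linarith [hs.1]) hs.2
    linarith
  have q3 : sheetPos (L 0 p) = sheetNeg (L 0 p) := by
    have hb := h.bot p hp0 hpn.le
    rw [sheetPos_eq_sheetNeg_sub, hLe 0 p hp0, Complex.sub_im, if_neg (by linarith), sub_zero]
    rw [hLe 0 p hp0, Complex.sub_im]
    exact (sub_pos.mpr hb).ne'
  have hi0 := hc i hin.le
  have hdi : (Γ ((i : ℝ) + 1)).im - (Γ i).im ≠ 0 := by
    intro h0
    have := h.im_affine hin hp1.le hp2.le
    rw [h0, hp3] at this
    exact hi0 (by linarith)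
  have q4 : sheetPos (L i p) = sheetPos (L i ((i : ℝ) + 1)) := by
    refine sheetPos_eq_of_avoids (L := fun t => L i t) hp2.le (hcr i p _ hp1) ?_
    intro s hs him
    have hs1 : (i : ℝ) < s := by linarith [hs.1]
    rw [hLe i s hs1, Complex.sub_im, h.im_affine hin hs1.le hs.2] at him
    have : (s - i) * ((Γ ((i : ℝ) + 1)).im - (Γ i).im) = 0 := by linarith
    rcases mul_eq_zero.mp this with h0 | h0
    · linarith
    · exact absurd h0 hdi
  have q5 : sheetPos (L i ((i : ℝ) + 1)) = sheetPos (L p ((i : ℝ) + 1)) := by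
    refine sheetPos_eq_of_avoids (L := fun s => L s ((i : ℝ) + 1)) hp1.le (hcl _ i p hp2) ?_
    intro s hs him
    have hs1 : s < (i : ℝ) + 1 := by linarith [hs.2]
    rw [hLe s _ hs1, Complex.sub_im, h.im_affine hin hs.1 hs1.le] at him
    have : ((i : ℝ) + 1 - s) * ((Γ ((i : ℝ) + 1)).im - (Γ i).im) = 0 := by linarith
    rcases mul_eq_zero.mp this with h0 | h0
    · linarith
    · exact absurd h0 hdi
  have q6 := sheetPos_eq_sheetNeg_sub (L := L i p) (by
    rw [hLe i p hp1, Complex.sub_im, hp3]; exact sub_ne_zero.mpr hi0.symm)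
  rw [hLe i p hp1, Complex.sub_im, hp3] at q6
  have hsg : (crossSign Γ c i < 0) ↔ c - (Γ i).im < 0 := by
    obtain ⟨-, hm⟩ := Finset.mem_filter.mp hi
    unfold crossSign
    rcases mul_neg_iff.mp hm with ⟨h1, h2⟩ | ⟨h1, h2⟩
    · have h1' : ¬ (Γ i).im < c := by linarith
      have h2' : (Γ ((i : ℝ) + 1)).im < c := by linarith
      simp only [h1', h2', if_true, if_false]
      constructor
      · intro _; linarith
      · intro _; norm_num
    · have h1' : (Γ i).im < c := by linarith
      have h2' : ¬ (Γ ((i : ℝ) + 1)).im < c := by linarith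
      simp only [h1', h2', if_true, if_false]
      constructor
      · intro h0; norm_num at h0
      · intro _; linarith
  simp only [hsg]
  have q0 : ((0 : ℕ) : ℝ) = 0 := Nat.cast_zero
  rw [q0]
  linarith

/-- Alternating sums: if the signs alternate along decreasing values, starting with `+`,
the signed sum of nonnegative values is nonnegative. -/
theorem sum_alternating_nonneg {K : Finset ℕ} {s : ℕ → ℤ} {X : ℕ → ℝ}
    (hX : Set.InjOn X K) (hpos : ∀ k ∈ K, 0 ≤ X k) (hs : ∀ k ∈ K, s k = 1 ∨ s k = -1)
    (hsum : ∀ i ∈ K, ∑ k ∈ K.filter (fun k => X i < X k), s k = if s i < 0 then 1 else 0) :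
    0 ≤ ∑ k ∈ K, (s k : ℝ) * X k := by
  induction hn : K.card using Nat.strong_induction_on generalizing K with
  | _ m ih =>
  rcases K.eq_empty_or_nonempty with rfl | hne
  · simp
  obtain ⟨i, hi, hmax⟩ := K.exists_max_image X hne
  have hsi : s i = 1 := by
    have h1 := hsum i hi
    rw [Finset.filter_eq_empty_iff.mpr (fun k hk => not_lt.mpr (hmax k hk)),
      Finset.sum_empty] at h1
    rcases hs i hi with h2 | h2
    · exact h2
    · rw [h2] at h1; norm_num at h1
  rw [← Finset.add_sum_erase K _ hi, hsi]
  set K1 := K.erase i with hK1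
  have hlt1 : ∀ k ∈ K1, X k < X i := fun k hk =>
    lt_of_le_of_ne (hmax k (Finset.mem_of_mem_erase hk))
      (fun h => Finset.ne_of_mem_erase hk (hX (Finset.mem_of_mem_erase hk) hi h))
  rcases K1.eq_empty_or_nonempty with he | hne1
  · rw [he]; simpa using hpos i hi
  obtain ⟨j, hj, hjmax⟩ := K1.exists_max_image X hne1
  have hjK : j ∈ K := Finset.mem_of_mem_erase hj
  have hlt2 : ∀ k ∈ K1.erase j, X k < X j := fun k hk =>
    lt_of_le_of_ne (hjmax k (Finset.mem_of_mem_erase hk))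
      (fun h => Finset.ne_of_mem_erase hk
        (hX (Finset.mem_of_mem_erase (Finset.mem_of_mem_erase hk)) hjK h))
  have hsj : s j = -1 := by
    have h1 := hsum j hjK
    have : K.filter (fun k => X j < X k) = {i} := by
      ext k
      simp only [Finset.mem_filter, Finset.mem_singleton]
      constructor
      · rintro ⟨hk, hlt⟩
        by_contra hki
        exact absurd (hjmax k (Finset.mem_erase.mpr ⟨hki, hk⟩)) (not_le.mpr hlt)
      · rintro rfl
        exact ⟨hi, hlt1 j hj⟩
    rw [this, Finset.sum_singleton, hsi] at h1
    rcases hs j hjK with h2 | h2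
    · rw [h2] at h1; norm_num at h1
    · exact h2
  rw [← Finset.add_sum_erase K1 _ hj, hsj]
  set K2 := K1.erase j with hK2
  have hsub : ∀ k ∈ K2, k ∈ K := fun k hk => Finset.mem_of_mem_erase (Finset.mem_of_mem_erase hk)
  have hrec := ih K2.card (by
      rw [← hn]
      exact lt_of_le_of_lt (Finset.card_le_card (Finset.erase_subset _ _))
        (Finset.card_erase_lt_of_mem hi)) (K := K2)
    (hX.mono (fun k hk => hsub k hk)) (fun k hk => hpos k (hsub k hk))
    (fun k hk => hs k (hsub k hk)) (by
      intro l hl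
      rw [← hsum l (hsub l hl)]
      have e : K.filter (fun k => X l < X k)
          = insert i (insert j (K2.filter (fun k => X l < X k))) := by
        ext k
        simp only [Finset.mem_filter, Finset.mem_insert]
        constructor
        · rintro ⟨hk, hlt⟩
          by_cases h1 : k = i
          · exact Or.inl h1
          by_cases h2 : k = j
          · exact Or.inr (Or.inl h2)
          exact Or.inr (Or.inr ⟨Finset.mem_erase.mpr ⟨h2, Finset.mem_erase.mpr ⟨h1, hk⟩⟩, hlt⟩)
        · rintro (rfl | rfl | ⟨hk, hlt⟩)
          · exact ⟨hi, hlt1 l (Finset.mem_of_mem_erase hl)⟩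
          · exact ⟨hjK, hlt2 l hl⟩
          · exact ⟨hsub k hk, hlt⟩
      rw [e, Finset.sum_insert, Finset.sum_insert, hsi, hsj]
      · ring
      · simp [hK2]
      · simp [hK2, hK1, (Finset.ne_of_mem_erase hj).symm])
    rfl
  have := hlt1 j hj
  push_cast
  linarith

theorem PolygonalArc.sum_crossAbs_nonneg (h : PolygonalArc Γ n)
    (hc : ∀ k : ℕ, k ≤ n → (Γ k).im ≠ c) (hre : ∀ t : ℝ, 0 ≤ t → t ≤ n → 0 ≤ (Γ t).re) :
    0 ≤ ∑ k ∈ crossSet Γ n c, (crossSign Γ c k : ℝ) * crossAbs Γ c k := by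
  refine sum_alternating_nonneg h.crossAbs_injOn ?_ ?_ ?_
  · intro k hk
    obtain ⟨t, ht1, ht2, -, ht4⟩ := h.exists_crossing hk
    have hkn : (k : ℝ) + 1 ≤ n := by
      exact_mod_cast Finset.mem_range.mp (Finset.mem_filter.mp hk).1
    rw [← ht4]
    exact hre t (le_trans (Nat.cast_nonneg k) ht1.le) (by linarith)
  · intro k hk
    obtain ⟨-, hm⟩ := Finset.mem_filter.mp hk
    unfold crossSign
    rcases mul_neg_iff.mp hm with ⟨h1, h2⟩ | ⟨h1, h2⟩
    · right
      rw [if_neg (by linarith), if_pos (by linarith)]; norm_num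
    · left
      rw [if_pos (by linarith), if_neg (by linarith)]; norm_num
  · intro i hi
    convert h.sum_crossSign_right hc hi

end

section

variable {Γ : ℝ → ℂ} {n : ℕ} {c : ℝ}

theorem crossSign_mul_crossAbs_eq (Γ : ℝ → ℂ) (k : ℕ) :
    (fun c => (crossSign Γ c k : ℝ) * crossAbs Γ c k) = fun c =>
      (Set.Ioc (Γ k).im (Γ ((k : ℝ) + 1)).im).indicator (fun c => crossAbs Γ c k) c -
      (Set.Ioc (Γ ((k : ℝ) + 1)).im (Γ k).im).indicator (fun c => crossAbs Γ c k) c := by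
  funext c
  unfold crossSign
  by_cases h1 : (Γ k).im < c <;> by_cases h2 : (Γ ((k : ℝ) + 1)).im < c
  · simp [h1, h2]
  · simp [h1, h2, not_lt.mp h2]
  · simp [h1, h2, not_lt.mp h1]
  · simp [h1, h2]

theorem continuous_crossAbs (Γ : ℝ → ℂ) (k : ℕ) : Continuous (fun c => crossAbs Γ c k) := by
  unfold crossAbs; fun_prop

theorem integrable_crossSign_mul_crossAbs (Γ : ℝ → ℂ) (k : ℕ) :
    Integrable (fun c => (crossSign Γ c k : ℝ) * crossAbs Γ c k) := by
  rw [crossSign_mul_crossAbs_eq]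
  refine Integrable.sub ?_ ?_
  · rw [integrable_indicator_iff measurableSet_Ioc]
    exact (continuous_crossAbs Γ k).integrableOn_Ioc
  · rw [integrable_indicator_iff measurableSet_Ioc]
    exact (continuous_crossAbs Γ k).integrableOn_Ioc

theorem integral_affine_interp (a b p q : ℝ) :
    ∫ c in a..b, (p + (c - a) / (b - a) * (q - p)) = (p + q) / 2 * (b - a) := by
  rcases eq_or_ne a b with rfl | hab
  · simp
  have hd : b - a ≠ 0 := sub_ne_zero.mpr hab.symm
  have : (fun c => p + (c - a) / (b - a) * (q - p))
      = fun c => (p - a * ((q - p) / (b - a))) + c * ((q - p) / (b - a)) := by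
    funext c; field_simp; ring
  rw [this, intervalIntegral.integral_add (Continuous.intervalIntegrable (by fun_prop) _ _) (Continuous.intervalIntegrable (by fun_prop) _ _),
    intervalIntegral.integral_const, intervalIntegral.integral_mul_const, integral_id, smul_eq_mul]
  field_simp
  ring

theorem integral_crossSign_mul_crossAbs (Γ : ℝ → ℂ) (k : ℕ) :
    ∫ c, (crossSign Γ c k : ℝ) * crossAbs Γ c k
      = ((Γ k).re + (Γ ((k : ℝ) + 1)).re) / 2 * ((Γ ((k : ℝ) + 1)).im - (Γ k).im) := by
  rw [crossSign_mul_crossAbs_eq, integral_sub, integral_indicator measurableSet_Ioc,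
    integral_indicator measurableSet_Ioc, ← integral_affine_interp, intervalIntegral]
  · rfl
  · rw [integrable_indicator_iff measurableSet_Ioc]
    exact (continuous_crossAbs Γ k).integrableOn_Ioc
  · rw [integrable_indicator_iff measurableSet_Ioc]
    exact (continuous_crossAbs Γ k).integrableOn_Ioc

theorem PolygonalArc.trapezoid_nonneg (h : PolygonalArc Γ n)
    (hre : ∀ t : ℝ, 0 ≤ t → t ≤ n → 0 ≤ (Γ t).re) :
    0 ≤ ∑ k ∈ Finset.range n,
      ((Γ k).re + (Γ ((k : ℝ) + 1)).re) / 2 * ((Γ ((k : ℝ) + 1)).im - (Γ k).im) := by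
  simp_rw [← integral_crossSign_mul_crossAbs]
  rw [← integral_finsetSum _ (fun k _ => integrable_crossSign_mul_crossAbs Γ k)]
  apply integral_nonneg_of_ae
  have hfin : (Set.range (fun k : Fin (n + 1) => (Γ (k : ℕ)).im)).Finite := Set.finite_range _
  filter_upwards [hfin.measure_zero volume |> measure_eq_zero_iff_ae_notMem.mp] with c hcn
  have hc : ∀ k : ℕ, k ≤ n → (Γ k).im ≠ c := by
    intro k hk he
    exact hcn ⟨⟨k, by omega⟩, he⟩
  have := h.sum_crossAbs_nonneg hc hre
  refine this.trans_eq ?_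
  refine Finset.sum_subset (s₁ := crossSet Γ n c) (Finset.filter_subset _ _) ?_
  intro k hk hnot
  have hkn := Finset.mem_range.mp hk
  have h0 := hc k hkn.le
  have h1 := hc (k + 1) hkn
  push_cast at h1
  have hnn : ¬ ((Γ k).im - c) * ((Γ ((k : ℝ) + 1)).im - c) < 0 := by
    intro hlt; exact hnot (Finset.mem_filter.mpr ⟨hk, hlt⟩)
  have : crossSign Γ c k = 0 := by
    unfold crossSign
    rcases lt_or_gt_of_ne h0 with g0 | g0 <;> rcases lt_or_gt_of_ne h1 with g1 | g1
    · simp [g0, g1]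
    · exact absurd (mul_neg_of_neg_of_pos (sub_neg.mpr g0) (sub_pos.mpr g1)) hnn
    · exact absurd (mul_neg_of_pos_of_neg (sub_pos.mpr g0) (sub_neg.mpr g1)) hnn
    · simp [not_lt.mpr g0.le, not_lt.mpr g1.le]
  rw [this]; simp

/-- The polygonal curve through `v 0, …, v n`, extended by vertical rays. -/
noncomputable def polyline (v : ℕ → ℂ) (n : ℕ) (t : ℝ) : ℂ :=
  v 0 + (∑ k ∈ Finset.range n, ((max 0 (min (t - k) 1) : ℝ) : ℂ) * (v (k + 1) - v k))
    + ((min t 0 + max (t - n) 0 : ℝ) : ℂ) * Complex.I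

theorem polyline_eq (v : ℕ → ℂ) {n j : ℕ} (hj : j < n) {t : ℝ} (h1 : (j : ℝ) ≤ t)
    (h2 : t ≤ j + 1) : polyline v n t = v j + ((t - j : ℝ) : ℂ) * (v (j + 1) - v j) := by
  have hjn : (j : ℝ) + 1 ≤ n := by exact_mod_cast hj
  have h0 : 0 ≤ t := le_trans (Nat.cast_nonneg j) h1
  unfold polyline
  rw [min_eq_right h0, max_eq_right (by linarith), add_zero, Complex.ofReal_zero, zero_mul, add_zero,
    ← Finset.sum_range_add_sum_Ico _ (show j + 1 ≤ n from hj), Finset.sum_range_succ]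
  have e1 : ∑ k ∈ Finset.range j, ((max 0 (min (t - k) 1) : ℝ) : ℂ) * (v (k + 1) - v k)
      = v j - v 0 := by
    rw [← Finset.sum_range_sub]
    refine Finset.sum_congr rfl (fun k hk => ?_)
    have hk' : (k : ℝ) + 1 ≤ j := by exact_mod_cast Finset.mem_range.mp hk
    rw [min_eq_right (by linarith), max_eq_right zero_le_one]; simp
  have e2 : ∑ k ∈ Finset.Ico (j + 1) n, ((max 0 (min (t - k) 1) : ℝ) : ℂ) * (v (k + 1) - v k)
      = 0 := by
    refine Finset.sum_eq_zero (fun k hk => ?_)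
    have hk' : (j : ℝ) + 1 ≤ k := by exact_mod_cast (Finset.mem_Ico.mp hk).1
    rw [max_eq_left (le_trans (min_le_left _ _) (by linarith))]; simp
  rw [e1, e2, min_eq_left (by linarith), max_eq_right (by linarith)]
  ring

theorem polyline_nat (v : ℕ → ℂ) {n j : ℕ} (hn : 0 < n) (hj : j ≤ n) :
    polyline v n j = v j := by
  rcases hj.lt_or_eq with h | rfl
  · rw [polyline_eq v h le_rfl (by linarith)]; simp
  · obtain ⟨m, rfl⟩ : ∃ m, j = m + 1 := ⟨j - 1, by omega⟩
    rw [polyline_eq v (Nat.lt_succ_self m) (by push_cast; linarith) (by push_cast; linarith)]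
    push_cast
    ring

theorem continuous_polyline (v : ℕ → ℂ) (n : ℕ) : Continuous (polyline v n) := by
  unfold polyline; fun_prop

theorem exists_edge {n : ℕ} {t : ℝ} (h0 : 0 ≤ t) (hn : t < n) :
    ∃ j : ℕ, j < n ∧ (j : ℝ) ≤ t ∧ t < j + 1 :=
  ⟨⌊t⌋₊, (Nat.floor_lt h0).mpr hn, Nat.floor_le h0, Nat.lt_floor_add_one t⟩

theorem polygonalArc_polyline {v : ℕ → ℂ} {n : ℕ} (hn : 0 < n)
    (hinj : Set.InjOn (polyline v n) (Set.Icc 0 n))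
    (hbot : ∀ k, 0 < k → k ≤ n → (v 0).im < (v k).im)
    (htop : ∀ k, k < n → (v k).im < (v n).im) : PolygonalArc (polyline v n) n := by
  have him : ∀ j < n, ∀ t : ℝ, (j : ℝ) ≤ t → t ≤ j + 1 →
      (polyline v n t).im = (1 - (t - j)) * (v j).im + (t - j) * (v (j + 1)).im := by
    intro j hj t h1 h2
    rw [polyline_eq v hj h1 h2, Complex.add_im, Complex.im_ofReal_mul, Complex.sub_im]; ring
  have p0 : polyline v n 0 = v 0 := by
    have := polyline_nat v hn (Nat.zero_le n); simpa using this
  have pn : polyline v n n = v n := polyline_nat v hn le_rfl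
  have bot : ∀ t : ℝ, 0 < t → t ≤ n → (polyline v n 0).im < (polyline v n t).im := by
    intro t h0 h1
    rw [p0]
    rcases h1.lt_or_eq with h1 | rfl
    · obtain ⟨j, hj, hj1, hj2⟩ := exists_edge h0.le h1
      rw [him j hj t hj1 hj2.le]
      have a1 := hbot (j + 1) (by omega) hj
      rcases Nat.eq_zero_or_pos j with rfl | hjp
      · simp only [Nat.cast_zero, sub_zero, zero_add] at *
        nlinarith
      · have a0 := hbot j hjp hj.le
        nlinarith [mul_nonneg (sub_nonneg.mpr hj1) (sub_pos.mpr a1).le,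
          mul_pos (sub_pos.mpr hj2) (sub_pos.mpr a0)]
    · rw [pn]; exact hbot n hn le_rfl
  have top : ∀ t : ℝ, 0 ≤ t → t < n → (polyline v n t).im < (polyline v n n).im := by
    intro t h0 h1
    rw [pn]
    obtain ⟨j, hj, hj1, hj2⟩ := exists_edge h0 h1
    rw [him j hj t hj1 hj2.le]
    have a0 := htop j hj
    have a1 : (v (j + 1)).im ≤ (v n).im := by
      rcases (show j + 1 ≤ n from hj).lt_or_eq with h | h
      · exact (htop _ h).le
      · rw [h]
    nlinarith [mul_nonneg (sub_nonneg.mpr hj1) (sub_nonneg.mpr a1),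
          mul_pos (sub_pos.mpr hj2) (sub_pos.mpr a0)]
  have below : ∀ t : ℝ, t ≤ 0 → (polyline v n t).im = (v 0).im + t := by
    intro t ht
    have hn0 : (0 : ℝ) ≤ n := Nat.cast_nonneg n
    unfold polyline
    rw [Finset.sum_eq_zero (fun k _ => by
      have : (0 : ℝ) ≤ k := Nat.cast_nonneg k
      rw [max_eq_left (le_trans (min_le_left _ _) (by linarith))]; simp),
      min_eq_left ht, max_eq_right (by linarith)]
    simp
  have above : ∀ t : ℝ, (n : ℝ) ≤ t → (polyline v n t).im = (v n).im + (t - n) := by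
    intro t ht
    have hn0 : (0 : ℝ) ≤ n := Nat.cast_nonneg n
    unfold polyline
    rw [Finset.sum_congr rfl (fun k hk => by
      have : (k : ℝ) + 1 ≤ n := by exact_mod_cast Finset.mem_range.mp hk
      rw [min_eq_right (by linarith : (1 : ℝ) ≤ t - k), max_eq_right zero_le_one,
        Complex.ofReal_one, one_mul]), Finset.sum_range_sub,
      min_eq_right (by linarith), max_eq_left (by linarith)]
    simp
  have mono : ∀ s t : ℝ, s < t → s ≤ 0 ∨ (n : ℝ) ≤ t →
      (polyline v n s).im < (polyline v n t).im := by
    have hv : (v 0).im < (v n).im := hbot n hn le_rfl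
    rw [p0] at bot
    rw [pn] at top
    intro s t hst hor
    rcases hor with hs | ht
    · rw [below s hs]
      rcases le_or_gt t 0 with h | h
      · rw [below t h]; linarith
      rcases le_or_gt t n with h' | h'
      · have := bot t h h'; linarith
      · rw [above t h'.le]; linarith
    · rw [above t ht]
      rcases le_or_gt (n : ℝ) s with h | h
      · rw [above s h]; linarith
      rcases le_or_gt 0 s with h' | h'
      · have := top s h' h; linarith
      · rw [below s h'.le]; linarith
  have inj : ∀ s t : ℝ, s < t → polyline v n s ≠ polyline v n t := by
    intro s t hst he
    by_cases h : s ≤ 0 ∨ (n : ℝ) ≤ t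
    · exact absurd (congrArg Complex.im he) (mono s t hst h).ne
    · push Not at h
      exact hst.ne (hinj ⟨h.1.le, by linarith⟩ ⟨by linarith, h.2.le⟩ he)
  refine ⟨continuous_polyline v n, ?_, ?_, bot, top⟩
  · intro s t he
    by_contra hne
    rcases lt_or_gt_of_ne hne with h | h
    · exact inj s t h he
    · exact inj t s h he.symm
  · intro k hk t h1 h2
    have e1 := polyline_nat v hn (show k + 1 ≤ n from hk)
    push_cast at e1
    rw [polyline_nat v hn hk.le, e1, polyline_eq v hk h1 h2]

end

section
variable {E : Type*} [NormedAddCommGroup E] [NormedSpace ℝ E]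
open Set

theorem exists_uniform_chord_approx {γ γ' : ℝ → E} {p q : ℝ}
    (hγ : ∀ t ∈ Icc p q, HasDerivAt γ (γ' t) t) (hγ' : ContinuousOn γ' (Icc p q))
    {ε : ℝ} (hε : 0 < ε) : ∃ δ > 0, ∀ s ∈ Icc p q, ∀ t ∈ Icc p q, s ≤ t → t - s < δ →
      ∀ ξ ∈ Icc s t, ‖γ t - γ s - (t - s) • γ' ξ‖ ≤ ε * (t - s) := by
  have huc := isCompact_Icc.uniformContinuousOn_of_continuous hγ'
  obtain ⟨δ, hδ, H⟩ := Metric.uniformContinuousOn_iff.mp huc ε hε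
  refine ⟨δ, hδ, fun s hs t ht hst hd ξ hξ => ?_⟩
  have hsub : Icc s t ⊆ Icc p q := Icc_subset_Icc hs.1 ht.2
  have := (convex_Icc s t).norm_image_sub_le_of_norm_hasDerivWithin_le
    (f := fun x => γ x - x • γ' ξ) (f' := fun x => γ' x - γ' ξ) (C := ε)
    (fun x hx => by
      have h1 := (hγ x (hsub hx)).fun_sub ((hasDerivAt_id x).smul_const (γ' ξ))
      simpa using h1.hasDerivWithinAt)
    (fun x hx => by
      rw [← dist_eq_norm]
      refine (H x (hsub hx) ξ (hsub hξ) ?_).le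
      rw [Real.dist_eq, abs_lt]
      constructor <;> linarith [hx.1, hx.2, hξ.1, hξ.2])
    (left_mem_Icc.mpr hst) (right_mem_Icc.mpr hst)
  rw [Real.norm_eq_abs, abs_of_nonneg (sub_nonneg.mpr hst)] at this
  convert this using 2
  module

theorem exists_chord_lower_bound {γ γ' : ℝ → E} {p q : ℝ}
    (hγ : ∀ t ∈ Icc p q, HasDerivAt γ (γ' t) t) (hγ' : ContinuousOn γ' (Icc p q))
    (hinj : InjOn γ (Icc p q)) (himm : ∀ t ∈ Icc p q, γ' t ≠ 0) (hpq : p ≤ q) :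
    ∃ m > 0, ∀ s ∈ Icc p q, ∀ t ∈ Icc p q, s ≤ t → m * (t - s) ≤ ‖γ t - γ s‖ := by
  obtain ⟨t₀, ht₀, hmin⟩ := isCompact_Icc.exists_isMinOn (nonempty_Icc.mpr hpq) hγ'.norm
  have hc : 0 < ‖γ' t₀‖ := norm_pos_iff.mpr (himm t₀ ht₀)
  set c := ‖γ' t₀‖ with hcdef
  obtain ⟨δ, hδ, H⟩ := exists_uniform_chord_approx hγ hγ' (half_pos hc)
  have hcont : ContinuousOn γ (Icc p q) := fun t ht => (hγ t ht).continuousAt.continuousWithinAt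
  have hK : IsCompact ((Icc p q ×ˢ Icc p q) ∩ {z : ℝ × ℝ | δ ≤ z.2 - z.1}) :=
    (isCompact_Icc.prod isCompact_Icc).inter_right
      (isClosed_le continuous_const (by fun_prop))
  have hfar : ∃ μ > 0, ∀ s ∈ Icc p q, ∀ t ∈ Icc p q, δ ≤ t - s → μ ≤ ‖γ t - γ s‖ := by
    rcases ((Icc p q ×ˢ Icc p q) ∩ {z : ℝ × ℝ | δ ≤ z.2 - z.1}).eq_empty_or_nonempty with he | hne
    · refine ⟨1, one_pos, fun s hs t ht hd => ?_⟩
      have : (s, t) ∈ ((Icc p q ×ˢ Icc p q) ∩ {z : ℝ × ℝ | δ ≤ z.2 - z.1}) := ⟨⟨hs, ht⟩, hd⟩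
      rw [he] at this; exact absurd this (notMem_empty _)
    · have hcont2 : ContinuousOn (fun z : ℝ × ℝ => ‖γ z.2 - γ z.1‖)
          ((Icc p q ×ˢ Icc p q) ∩ {z : ℝ × ℝ | δ ≤ z.2 - z.1}) := by
        refine ContinuousOn.norm (ContinuousOn.sub ?_ ?_)
        · exact hcont.comp continuousOn_snd (fun z hz => hz.1.2)
        · exact hcont.comp continuousOn_fst (fun z hz => hz.1.1)
      obtain ⟨z, hz, hzmin⟩ := hK.exists_isMinOn hne hcont2
      refine ⟨‖γ z.2 - γ z.1‖, ?_, fun s hs t ht hd => hzmin (a := (s, t)) ⟨⟨hs, ht⟩, hd⟩⟩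
      rw [gt_iff_lt, norm_pos_iff, sub_ne_zero]
      intro he
      have h1 := hinj hz.1.2 hz.1.1 he
      have h2 : δ ≤ z.2 - z.1 := hz.2
      linarith
  obtain ⟨μ, hμ, Hfar⟩ := hfar
  have hL : 0 < q - p + 1 := by linarith
  refine ⟨min (c / 2) (μ / (q - p + 1)), lt_min (by positivity) (by positivity),
    fun s hs t ht hst => ?_⟩
  rcases lt_or_ge (t - s) δ with hlt | hge
  · have h1 := H s hs t ht hst hlt s (left_mem_Icc.mpr hst)
    have h2 : c ≤ ‖γ' s‖ := hmin hs
    have h3 : ‖(t - s) • γ' s‖ = (t - s) * ‖γ' s‖ := by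
      rw [norm_smul, Real.norm_of_nonneg (sub_nonneg.mpr hst)]
    have h4 : ‖(t - s) • γ' s‖ ≤ ‖γ t - γ s‖ + ‖γ t - γ s - (t - s) • γ' s‖ := by
      have := norm_sub_le (γ t - γ s) (γ t - γ s - (t - s) • γ' s)
      rwa [sub_sub_cancel] at this
    have h5 : min (c / 2) (μ / (q - p + 1)) * (t - s) ≤ c / 2 * (t - s) :=
      mul_le_mul_of_nonneg_right (min_le_left _ _) (sub_nonneg.mpr hst)
    have h6 := mul_le_mul_of_nonneg_left h2 (sub_nonneg.mpr hst)
    nlinarith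
  · have h1 := Hfar s hs t ht hge
    have h5 : min (c / 2) (μ / (q - p + 1)) * (t - s) ≤ μ / (q - p + 1) * (t - s) :=
      mul_le_mul_of_nonneg_right (min_le_right _ _) (sub_nonneg.mpr hst)
    have h6 : μ / (q - p + 1) * (t - s) ≤ μ := by
      rw [div_mul_eq_mul_div, div_le_iff₀ hL]
      nlinarith [hs.1, ht.2]
    linarith

end

open Set in
theorem polyline_injOn {γ γ' : ℝ → ℂ} {p q m ε : ℝ} {n : ℕ} (hn : 0 < n) (hpq : p < q)
    (hγ : ∀ t ∈ Icc p q, HasDerivAt γ (γ' t) t)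
    (hm : ∀ s ∈ Icc p q, ∀ t ∈ Icc p q, s ≤ t → m * (t - s) ≤ ‖γ t - γ s‖)
    (hεm : ε < m)
    (happ : ∀ s ∈ Icc p q, ∀ t ∈ Icc p q, s ≤ t → t - s ≤ (q - p) / n →
      ∀ ξ ∈ Icc s t, ‖γ t - γ s - (t - s) • γ' ξ‖ ≤ ε * (t - s)) :
    InjOn (polyline (fun k => γ (p + k * ((q - p) / n))) n) (Icc 0 n) := by
  set h := (q - p) / n with hh
  have hnR : (0 : ℝ) < n := by exact_mod_cast hn
  have hhpos : 0 < h := div_pos (by linarith) hnR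
  have hhn : n * h = q - p := by rw [hh]; field_simp
  have hmem : ∀ t : ℝ, 0 ≤ t → t ≤ n → p + t * h ∈ Icc p q := by
    intro t h0 h1
    constructor
    · nlinarith
    · nlinarith
  set v : ℕ → ℂ := fun k => γ (p + k * h) with hv
  have hbound : ∀ s t : ℝ, 0 ≤ s → s ≤ t → t ≤ n →
      ‖(polyline v n t - γ (p + t * h)) - (polyline v n s - γ (p + s * h))‖ ≤ ε * h * (t - s) := by
    intro s t hs hst ht
    refine norm_image_sub_le_of_norm_deriv_right_le_segment
      (f := fun x => polyline v n x - γ (p + x * h))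
      (f' := fun x => (v (⌊x⌋₊ + 1) - v ⌊x⌋₊) - h • γ' (p + x * h)) ?_ ?_ ?_ t
      (right_mem_Icc.mpr hst)
    · refine (continuous_polyline v n).continuousOn.sub ?_
      intro x hx
      have h1 := (hγ _ (hmem x (by linarith [hx.1]) (by linarith [hx.2]))).continuousAt
      exact (ContinuousAt.comp (f := fun x : ℝ => p + x * h) h1
        (by fun_prop)).continuousWithinAt
    · intro x hx
      have hx0 : 0 ≤ x := hs.trans hx.1
      have hxn : x < n := lt_of_lt_of_le hx.2 ht
      have j1 : (⌊x⌋₊ : ℝ) ≤ x := Nat.floor_le hx0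
      have j2 : x < ⌊x⌋₊ + 1 := Nat.lt_floor_add_one x
      have jn : ⌊x⌋₊ < n := (Nat.floor_lt hx0).mpr hxn
      refine HasDerivWithinAt.sub ?_ ?_
      · have hd : HasDerivAt (fun y : ℝ => v ⌊x⌋₊ + ((y - ⌊x⌋₊ : ℝ) : ℂ) *
            (v (⌊x⌋₊ + 1) - v ⌊x⌋₊)) (v (⌊x⌋₊ + 1) - v ⌊x⌋₊) x := by
          have h1 : HasDerivAt (fun y : ℝ => ((y - ⌊x⌋₊ : ℝ) : ℂ)) 1 x := by
            have := ((hasDerivAt_id x).sub_const (⌊x⌋₊ : ℝ)).ofReal_comp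
            simpa using this
          have := (h1.mul_const (v (⌊x⌋₊ + 1) - v ⌊x⌋₊)).const_add (v ⌊x⌋₊)
          simpa using this
        refine hd.hasDerivWithinAt.congr_of_eventuallyEq ?_ (polyline_eq v jn j1 j2.le)
        filter_upwards [self_mem_nhdsWithin, mem_nhdsWithin_of_mem_nhds (Iio_mem_nhds j2)]
          with y hy1 hy2
        exact polyline_eq v jn (j1.trans hy1) (le_of_lt hy2)
      · have h1 := hγ _ (hmem x hx0 hxn.le)
        have h2 : HasDerivAt (fun y : ℝ => p + y * h) h x := by
          simpa using ((hasDerivAt_id x).mul_const h).const_add p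
        exact (h1.scomp x h2).hasDerivWithinAt
    · intro x hx
      have hx0 : 0 ≤ x := hs.trans hx.1
      have hxn : x < n := lt_of_lt_of_le hx.2 ht
      have j1 : (⌊x⌋₊ : ℝ) ≤ x := Nat.floor_le hx0
      have j2 : x < ⌊x⌋₊ + 1 := Nat.lt_floor_add_one x
      have jn : ⌊x⌋₊ < n := (Nat.floor_lt hx0).mpr hxn
      have jn' : (⌊x⌋₊ : ℝ) + 1 ≤ n := by exact_mod_cast jn
      have := happ (p + ⌊x⌋₊ * h) (hmem _ (Nat.cast_nonneg _) (by linarith))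
        (p + ((⌊x⌋₊ + 1 : ℕ) : ℝ) * h) (hmem _ (Nat.cast_nonneg _) (by push_cast; linarith))
        (by push_cast; nlinarith) (by push_cast; linarith) (p + x * h)
        ⟨by nlinarith, by push_cast; nlinarith⟩
      have e : p + ((⌊x⌋₊ + 1 : ℕ) : ℝ) * h - (p + ⌊x⌋₊ * h) = h := by push_cast; ring
      rw [e] at this
      exact this
  have key : ∀ s t : ℝ, 0 ≤ s → s < t → t ≤ n → polyline v n s ≠ polyline v n t := by
    intro s t hs hst ht he
    have h1 := hbound s t hs hst.le ht
    have h2 := hm (p + s * h) (hmem s hs (by linarith)) (p + t * h) (hmem t (by linarith) ht)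
      (by nlinarith)
    rw [he, sub_sub_sub_cancel_left, ← norm_neg, neg_sub] at h1
    have : 0 < h * (t - s) := mul_pos hhpos (by linarith)
    have h3 : m * (h * (t - s)) ≤ ε * (h * (t - s)) := by
      calc m * (h * (t - s)) = m * (p + t * h - (p + s * h)) := by ring
        _ ≤ _ := h2
        _ ≤ _ := h1
        _ = _ := by ring
    nlinarith
  intro s hs t ht he
  by_contra hne
  rcases lt_or_gt_of_ne hne with hlt | hlt
  · exact key s t hs.1 hlt ht.2 he
  · exact key t s ht.1 hlt hs.2 he.symm

open Set in
/-- The signed area between the vertical axis and an embedded arc in the right half-plane which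
goes from its strictly lowest point to its strictly highest point is nonnegative. -/
theorem integral_mul_deriv_nonneg_of_embedded {f g f' g' : ℝ → ℝ} {p q : ℝ} (hpq : p < q)
    (hf : ∀ t ∈ Icc p q, HasDerivAt f (f' t) t) (hg : ∀ t ∈ Icc p q, HasDerivAt g (g' t) t)
    (hf' : ContinuousOn f' (Icc p q)) (hg' : ContinuousOn g' (Icc p q))
    (hinj : ∀ s ∈ Icc p q, ∀ t ∈ Icc p q, f s = f t → g s = g t → s = t)
    (himm : ∀ t ∈ Icc p q, f' t = 0 → g' t ≠ 0)
    (hbot : ∀ t ∈ Ioc p q, g p < g t) (htop : ∀ t ∈ Ico p q, g t < g q)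
    (hpos : ∀ t ∈ Icc p q, 0 ≤ f t) : 0 ≤ ∫ t in p..q, f t * g' t := by
  set γ : ℝ → ℂ := fun t => f t + g t * Complex.I with hγd
  set γ' : ℝ → ℂ := fun t => f' t + g' t * Complex.I with hγd'
  have hre : ∀ t, (γ t).re = f t := by intro t; simp [hγd]
  have him : ∀ t, (γ t).im = g t := by intro t; simp [hγd]
  have hγ : ∀ t ∈ Icc p q, HasDerivAt γ (γ' t) t := fun t ht =>
    (hf t ht).ofReal_comp.add ((hg t ht).ofReal_comp.mul_const Complex.I)
  have hγ' : ContinuousOn γ' (Icc p q) :=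
    (Complex.continuous_ofReal.comp_continuousOn hf').add
      ((Complex.continuous_ofReal.comp_continuousOn hg').mul continuousOn_const)
  obtain ⟨m, hm, Hm⟩ := exists_chord_lower_bound hγ hγ'
    (fun s hs t ht he => hinj s hs t ht (by rw [← hre s, ← hre t, he])
      (by rw [← him s, ← him t, he]))
    (fun t ht he => himm t ht (by simpa [hγd'] using congrArg Complex.re he)
      (by simpa [hγd'] using congrArg Complex.im he)) hpq.le
  obtain ⟨δ, hδ, Happ⟩ := exists_uniform_chord_approx hγ hγ' (half_pos hm)
  obtain ⟨M, hM⟩ := isCompact_Icc.exists_bound_of_continuousOn hg'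
  have hM0 : 0 ≤ M := le_trans (norm_nonneg _) (hM p (left_mem_Icc.mpr hpq.le))
  have hfc : ContinuousOn f (Icc p q) := fun t ht => (hf t ht).continuousAt.continuousWithinAt
  by_contra hneg
  push Not at hneg
  set I := ∫ t in p..q, f t * g' t with hI
  set ε := -I / (2 * (M + 1) * (q - p)) with hεd
  have hqp : 0 < q - p := by linarith
  have hε : 0 < ε := div_pos (by linarith) (by positivity)
  obtain ⟨δ', hδ', Hf⟩ := Metric.uniformContinuousOn_iff.mp
    (isCompact_Icc.uniformContinuousOn_of_continuous hfc) ε hε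
  obtain ⟨n, hn⟩ := exists_nat_gt ((q - p) / min δ δ')
  have hδδ : 0 < min δ δ' := lt_min hδ hδ'
  have hnR : (0 : ℝ) < n := lt_trans (by positivity) hn
  have hn0 : 0 < n := by exact_mod_cast hnR
  have hh : (q - p) / n < min δ δ' := by
    rw [div_lt_iff₀ hδδ] at hn
    rw [div_lt_iff₀ hnR]; linarith
  set h := (q - p) / n with hhd
  have hhpos : 0 < h := by positivity
  have hhn : n * h = q - p := by rw [hhd]; field_simp
  have hmem : ∀ k : ℕ, k ≤ n → p + k * h ∈ Icc p q := by
    intro k hk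
    have : (k : ℝ) ≤ n := by exact_mod_cast hk
    have h0 : (0 : ℝ) ≤ k := Nat.cast_nonneg k
    constructor <;> nlinarith
  have hq : p + n * h = q := by linarith
  set v : ℕ → ℂ := fun k => γ (p + k * h) with hv
  have harc : PolygonalArc (polyline v n) n := by
    refine polygonalArc_polyline hn0 (polyline_injOn (ε := m / 2) hn0 hpq hγ Hm (by linarith) ?_)
      ?_ ?_
    · intro s hs t ht hst hd
      exact Happ s hs t ht hst (lt_of_le_of_lt hd (lt_of_lt_of_le hh (min_le_left _ _)))
    · intro k hk hkn
      rw [hv]; simp only [him, Nat.cast_zero, zero_mul, add_zero]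
      have hk' : (0 : ℝ) < k := by exact_mod_cast hk
      exact hbot _ ⟨by nlinarith, (hmem k hkn).2⟩
    · intro k hkn
      rw [hv]; simp only [him, hq]
      have hk' : (k : ℝ) < n := by exact_mod_cast hkn
      exact htop _ ⟨(hmem k hkn.le).1, by nlinarith⟩
  have htrap := harc.trapezoid_nonneg (by
    intro t h0 hn1
    have hv0 : ∀ k ≤ n, 0 ≤ (v k).re := fun k hk => by
      rw [hv]; simp only [hre]; exact hpos _ (hmem k hk)
    rcases hn1.lt_or_eq with hlt | rfl
    · obtain ⟨j, hj, hj1, hj2⟩ := exists_edge h0 hlt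
      rw [polyline_eq v hj hj1 hj2.le, Complex.add_re, Complex.re_ofReal_mul, Complex.sub_re]
      have a0 := hv0 j hj.le
      have a1 := hv0 (j + 1) hj
      nlinarith [mul_nonneg (sub_nonneg.mpr hj1) a1, mul_nonneg (sub_pos.mpr hj2).le a0]
    · rw [polyline_nat v hn0 le_rfl]; exact hv0 n le_rfl)
  have hsum : I = ∑ k ∈ Finset.range n,
      ∫ t in (p + k * h)..(p + ((k + 1 : ℕ) : ℝ) * h), f t * g' t := by
    rw [intervalIntegral.sum_integral_adjacent_intervals (a := fun k : ℕ => p + k * h)]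
    · simp only [Nat.cast_zero, zero_mul, add_zero, hq, hI]
    · intro k hk
      refine ContinuousOn.intervalIntegrable ((hfc.mul hg').mono ?_)
      exact uIcc_subset_Icc (hmem k hk.le) (hmem (k + 1) hk)
  have hedge : ∀ k ∈ Finset.range n,
      ((polyline v n k).re + (polyline v n ((k : ℝ) + 1)).re) / 2 *
        ((polyline v n ((k : ℝ) + 1)).im - (polyline v n k).im) - ε * M * h ≤
      ∫ t in (p + k * h)..(p + ((k + 1 : ℕ) : ℝ) * h), f t * g' t := by
    intro k hk
    have hkn : k < n := Finset.mem_range.mp hk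
    have e1 := polyline_nat v hn0 (show k + 1 ≤ n from hkn)
    push_cast at e1
    rw [polyline_nat v hn0 hkn.le, e1]
    have r0 : (v k).re = f (p + k * h) := hre _
    have r1 : (v (k + 1)).re = f (p + ((k + 1 : ℕ) : ℝ) * h) := hre _
    have i0 : (v k).im = g (p + k * h) := him _
    have i1 : (v (k + 1)).im = g (p + ((k + 1 : ℕ) : ℝ) * h) := him _
    rw [r0, r1, i0, i1]
    set a := p + k * h with ha
    set b := p + ((k + 1 : ℕ) : ℝ) * h with hb
    have hab : b - a = h := by rw [ha, hb]; push_cast; ring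
    have hamem : a ∈ Icc p q := hmem k hkn.le
    have hbmem : b ∈ Icc p q := hmem (k + 1) hkn
    have hsub : uIcc a b ⊆ Icc p q := uIcc_subset_Icc hamem hbmem
    have hFTC : ∫ t in a..b, g' t = g b - g a :=
      intervalIntegral.integral_eq_sub_of_hasDerivAt (fun t ht => hg t (hsub ht))
        (hg'.mono hsub).intervalIntegrable
    have hest : ‖∫ t in a..b, (f t - (f a + f b) / 2) * g' t‖ ≤ ε * M * |b - a| := by
      refine intervalIntegral.norm_integral_le_of_norm_le_const (fun t ht => ?_)
      have ht' : t ∈ Icc a b := by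
        rw [uIoc_of_le (by linarith)] at ht; exact ⟨ht.1.le, ht.2⟩
      have htm : t ∈ Icc p q := ⟨hamem.1.trans ht'.1, ht'.2.trans hbmem.2⟩
      have hhδ : h < δ' := lt_of_lt_of_le hh (min_le_right _ _)
      have d1 := Hf t htm a hamem (by
        rw [Real.dist_eq, abs_of_nonneg (by linarith [ht'.1])]; linarith [ht'.2])
      have d2 := Hf t htm b hbmem (by
        rw [Real.dist_eq, abs_of_nonpos (by linarith [ht'.2])]; linarith [ht'.1])
      rw [Real.dist_eq, abs_lt] at d1 d2
      rw [norm_mul]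
      refine mul_le_mul ?_ (hM t htm) (norm_nonneg _) hε.le
      rw [Real.norm_eq_abs, abs_le]
      constructor <;> linarith [d1.1, d1.2, d2.1, d2.2]
    have hsplit : ∫ t in a..b, (f t - (f a + f b) / 2) * g' t
        = (∫ t in a..b, f t * g' t) - (f a + f b) / 2 * (g b - g a) := by
      rw [← hFTC, ← intervalIntegral.integral_const_mul, ← intervalIntegral.integral_sub]
      · congr 1; funext t; ring
      · exact ((hfc.mul hg').mono hsub).intervalIntegrable
      · exact ((hg'.mono hsub).intervalIntegrable).const_mul _
    rw [hsplit, hab, abs_of_pos hhpos, Real.norm_eq_abs, abs_le] at hest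
    linarith [hest.1]
  have hfinal := Finset.sum_le_sum hedge
  rw [← hsum, Finset.sum_sub_distrib, Finset.sum_const, Finset.card_range, nsmul_eq_mul] at hfinal
  have hc : n * (ε * M * h) = ε * M * (q - p) := by rw [← hhn]; ring
  rw [hc] at hfinal
  have h1 : ε * (2 * (M + 1) * (q - p)) = -I := by
    rw [hεd]; field_simp
  have : ε * M * (q - p) ≤ ε * (M + 1) * (q - p) := by
    have := mul_pos hε hqp
    nlinarith
  nlinarith

section
variable {E : Type*} [NormedAddCommGroup E] [NormedSpace ℝ E]
open Set Filter Topology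
open scoped NNReal

theorem exists_global_solution [CompleteSpace E] {G : E → E} {K L : ℝ≥0} (hK : LipschitzWith K G)
    (hL : ∀ y, ‖G y‖ ≤ L) (y₀ : E) :
    ∃ f : ℝ → E, f 0 = y₀ ∧ ∀ t, HasDerivAt f (G (f t)) t := by
  have step : ∀ n : ℕ, ∃ f : ℝ → E, f 0 = y₀ ∧
      ∀ t ∈ Ioo (-(n + 1 : ℝ)) (n + 1), HasDerivAt f (G (f t)) t := by
    intro n
    have hpos : (0 : ℝ) < n + 1 := by positivity
    have h0 : (0 : ℝ) ∈ Icc (-(n + 1 : ℝ)) (n + 1) := ⟨by linarith, hpos.le⟩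
    have hpl : IsPicardLindelof (fun _ => G) (⟨0, h0⟩ : Icc (-(n + 1 : ℝ)) (n + 1)) y₀
        (L * (n + 1)) 0 L K := by
      refine IsPicardLindelof.of_time_independent (fun x _ => hL x) hK.lipschitzOnWith ?_
      simp
    obtain ⟨f, hf0, hf⟩ := hpl.exists_eq_forall_mem_Icc_hasDerivWithinAt₀
    exact ⟨f, hf0, fun t ht => (hf t (Ioo_subset_Icc_self ht)).hasDerivAt (Icc_mem_nhds ht.1 ht.2)⟩
  choose F hF0 hF using step
  have hagree : ∀ n m : ℕ, n ≤ m → EqOn (F n) (F m) (Ioo (-(n + 1 : ℝ)) (n + 1)) := by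
    intro n m hnm
    have hc : (n : ℝ) ≤ m := by exact_mod_cast hnm
    have hpos : (0 : ℝ) < n + 1 := by positivity
    refine ODE_solution_unique_of_mem_Ioo (v := fun _ => G) (s := fun _ => univ) (K := K)
      (fun _ _ => hK.lipschitzOnWith) (t₀ := 0) ⟨by linarith, hpos⟩
      (fun t ht => ⟨hF n t ht, trivial⟩) (fun t ht => ⟨hF m t ⟨?_, ?_⟩, trivial⟩)
      ((hF0 n).trans (hF0 m).symm)
    · linarith [ht.1]
    · linarith [ht.2]
  have hceil : ∀ t : ℝ, t ∈ Ioo (-((⌈|t|⌉₊ : ℝ) + 1)) (⌈|t|⌉₊ + 1) := fun t => by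
    have := abs_le.mp (Nat.le_ceil |t|)
    exact ⟨by linarith [this.1], by linarith [this.2]⟩
  refine ⟨fun t => F ⌈|t|⌉₊ t, by simp [hF0], fun t => ?_⟩
  refine (hF _ t (hceil t)).congr_of_eventuallyEq ?_
  filter_upwards [Ioo_mem_nhds (hceil t).1 (hceil t).2] with s hs
  rcases le_total ⌈|s|⌉₊ ⌈|t|⌉₊ with h | h
  · exact hagree _ _ h (hceil s)
  · exact (hagree _ _ h hs).symm

theorem dist_solutions_le {G : E → E} {K : ℝ≥0} (hK : LipschitzWith K G) {f g : ℝ → E}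
    (hf : ∀ t, HasDerivAt f (G (f t)) t) (hg : ∀ t, HasDerivAt g (G (g t)) t) (t : ℝ) :
    dist (f t) (g t) ≤ dist (f 0) (g 0) * exp (K * |t|) := by
  rcases le_total 0 t with h | h
  · rw [abs_of_nonneg h]
    have := dist_le_of_trajectories_ODE (v := fun _ => G) (a := 0) (b := t) (fun _ => hK)
      (fun s _ => (hf s).continuousAt.continuousWithinAt) (fun s _ => (hf s).hasDerivWithinAt)
      (fun s _ => (hg s).continuousAt.continuousWithinAt) (fun s _ => (hg s).hasDerivWithinAt)
      le_rfl t ⟨h, le_rfl⟩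
    simpa using this
  · rw [abs_of_nonpos h]
    have hrev : ∀ {f : ℝ → E}, (∀ t, HasDerivAt f (G (f t)) t) →
        ∀ t, HasDerivAt (fun s => f (-s)) (-G (f (-t))) t := fun {f} hf t => by
      have := (hf (-t)).scomp t (hasDerivAt_neg t)
      simpa [Function.comp_def] using this
    have := dist_le_of_trajectories_ODE (v := fun _ y => -G y) (K := K) (a := 0) (b := -t)
      (f := fun s => f (-s)) (g := fun s => g (-s)) (fun _ => hK.neg)
      (fun s _ => (hrev hf s).continuousAt.continuousWithinAt)
      (fun s _ => (hrev hf s).hasDerivWithinAt)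
      (fun s _ => (hrev hg s).continuousAt.continuousWithinAt)
      (fun s _ => (hrev hg s).hasDerivWithinAt)
      le_rfl (-t) ⟨by linarith, le_rfl⟩
    simpa using this

theorem continuous_uncurry_solution {X : Type*} [TopologicalSpace X] {G : E → E} {K L : ℝ≥0}
    (hK : LipschitzWith K G) (hL : ∀ y, ‖G y‖ ≤ L) {Y : X → ℝ → E}
    (hY : ∀ a t, HasDerivAt (Y a) (G (Y a t)) t) (hY0 : Continuous fun a => Y a 0) :
    Continuous fun p : X × ℝ => Y p.1 p.2 := by
  have hlip : ∀ a s t, dist (Y a s) (Y a t) ≤ L * |s - t| := fun a s t => by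
    rw [dist_eq_norm, ← Real.norm_eq_abs]
    exact (convex_univ).norm_image_sub_le_of_norm_hasDerivWithin_le
      (fun x _ => (hY a x).hasDerivWithinAt) (fun x _ => hL _) (mem_univ t) (mem_univ s)
  rw [continuous_iff_continuousAt]
  rintro ⟨a, t⟩
  rw [ContinuousAt, tendsto_iff_dist_tendsto_zero]
  have hz : Tendsto (fun p : X × ℝ => L * |p.2 - t| + dist (Y p.1 0) (Y a 0) * exp (K * |t|))
      (𝓝 (a, t)) (𝓝 0) := by
    have : Continuous fun p : X × ℝ => L * |p.2 - t| + dist (Y p.1 0) (Y a 0) * exp (K * |t|) := by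
      fun_prop
    simpa using this.tendsto (a, t)
  refine squeeze_zero (fun _ => dist_nonneg) (fun p => ?_) hz
  exact (dist_triangle _ (Y p.1 t) _).trans
    (add_le_add (hlip _ _ _) (dist_solutions_le hK (hY _) (hY _) t))

theorem exists_taylor_bound [ProperSpace E] {F : Type*} [NormedAddCommGroup F] [NormedSpace ℝ F]
    {G : E → F} (hG : ContDiff ℝ 2 G) (R : ℝ) :
    ∃ M : ℝ, 0 ≤ M ∧ ∀ y ∈ Metric.closedBall (0 : E) R, ∀ z ∈ Metric.closedBall (0 : E) R,
      ‖G z - G y - fderiv ℝ G y (z - y)‖ ≤ M * ‖z - y‖ ^ 2 := by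
  have hD : ContDiff ℝ 1 (fderiv ℝ G) := hG.fderiv_right (by norm_num)
  have hDD : Continuous (fderiv ℝ (fderiv ℝ G)) := hD.continuous_fderiv one_ne_zero
  obtain ⟨M, hM⟩ := (isCompact_closedBall (0 : E) R).exists_bound_of_continuousOn
    (f := fderiv ℝ (fderiv ℝ G)) hDD.continuousOn
  have hconv := convex_closedBall (0 : E) R
  refine ⟨max M 0, le_max_right _ _, fun y hy z hz => ?_⟩
  have hseg : segment ℝ y z ⊆ Metric.closedBall (0 : E) R := hconv.segment_subset hy hz
  have hb : ∀ w ∈ segment ℝ y z, ‖fderiv ℝ G w - fderiv ℝ G y‖ ≤ max M 0 * ‖z - y‖ := by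
    intro w hw
    have h1 := hconv.norm_image_sub_le_of_norm_fderiv_le (f := fderiv ℝ G) (C := max M 0)
      (fun x _ => (hD.differentiable one_ne_zero) x)
      (fun x hx => (hM x hx).trans (le_max_left _ _)) hy (hseg hw)
    refine h1.trans (mul_le_mul_of_nonneg_left ?_ (le_max_right _ _))
    obtain ⟨θ, hθ, rfl⟩ := (segment_eq_image' ℝ y z) ▸ hw
    rw [add_sub_cancel_left, norm_smul, Real.norm_eq_abs, abs_of_nonneg hθ.1]
    exact mul_le_of_le_one_left (norm_nonneg _) hθ.2
  have := (convex_segment y z).norm_image_sub_le_of_norm_fderiv_le' (f := G)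
    (φ := fderiv ℝ G y) (C := max M 0 * ‖z - y‖)
    (fun x _ => (hG.differentiable two_ne_zero) x) hb
    (left_mem_segment ℝ y z) (right_mem_segment ℝ y z)
  rw [sq, ← mul_assoc]
  exact this

end

section
variable {E : Type*} [NormedAddCommGroup E] [NormedSpace ℝ E]
open Set Filter Topology
open scoped NNReal

theorem norm_solution_le {G : E → E} {L : ℝ≥0} (hL : ∀ y, ‖G y‖ ≤ L) {f : ℝ → E}
    (hf : ∀ t, HasDerivAt f (G (f t)) t) (t : ℝ) : ‖f t‖ ≤ ‖f 0‖ + L * |t| := by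
  have := (convex_univ).norm_image_sub_le_of_norm_hasDerivWithin_le
    (fun x _ => (hf x).hasDerivWithinAt) (fun x _ => hL _) (mem_univ 0) (mem_univ t)
  rw [sub_zero, Real.norm_eq_abs] at this
  linarith [norm_le_norm_add_norm_sub' (f t) (f 0)]

theorem gronwallBound_zero_le {K : ℝ≥0} {ε t T : ℝ} (hε : 0 ≤ ε) (htT : t ≤ T) :
    gronwallBound 0 (K + 1 : ℝ≥0) ε t ≤ ε * exp ((K + 1) * T) := by
  have hK : (0 : ℝ) ≤ K := K.2
  rw [gronwallBound_of_K_ne_0 (by positivity)]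
  push_cast
  have h1 : ε / ((K : ℝ) + 1) ≤ ε := div_le_self hε (by linarith)
  have h2 : exp ((K + 1 : ℝ) * t) ≤ exp ((K + 1) * T) :=
    exp_le_exp.mpr (mul_le_mul_of_nonneg_left htT (by linarith))
  have h3 : 0 ≤ ε / ((K : ℝ) + 1) := by positivity
  have h4 := exp_pos ((K + 1 : ℝ) * T)
  nlinarith

variable [ProperSpace E] {G : E → E} {K L : ℝ≥0} {Y : ℝ → ℝ → E} {y₀ e : E}

theorem exists_diffQuotient_bound (hG : ContDiff ℝ 2 G) (hK : LipschitzWith K G)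
    (hL : ∀ y, ‖G y‖ ≤ L) (hY : ∀ a t, HasDerivAt (Y a) (G (Y a t)) t)
    (hY0 : ∀ a, Y a 0 = y₀ + a • e) (T A : ℝ) :
    ∃ C, 0 ≤ C ∧ ∀ a, |a| ≤ A → ∀ h, |h| ≤ 1 → h ≠ 0 → ∀ t ∈ Icc 0 T,
      ‖h⁻¹ • (G (Y (a + h) t) - G (Y a t)) -
        fderiv ℝ G (Y a t) (h⁻¹ • (Y (a + h) t - Y a t))‖ ≤ C * |h| := by
  obtain ⟨M, hM0, hM⟩ := exists_taylor_bound hG (‖y₀‖ + (A + 1) * ‖e‖ + L * T)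
  refine ⟨M * (‖e‖ * exp (K * T)) ^ 2, by positivity, fun a ha h hh h0 t ht => ?_⟩
  have hball : ∀ b, |b| ≤ A + 1 →
      Y b t ∈ Metric.closedBall (0 : E) (‖y₀‖ + (A + 1) * ‖e‖ + L * T) := by
    intro b hb
    rw [mem_closedBall_zero_iff]
    refine (norm_solution_le hL (hY b) t).trans ?_
    rw [hY0, abs_of_nonneg ht.1]
    have h1 := norm_add_le y₀ (b • e)
    rw [norm_smul, Real.norm_eq_abs] at h1
    have h2 := mul_le_mul_of_nonneg_right hb (norm_nonneg e)
    have h3 := mul_le_mul_of_nonneg_left ht.2 L.2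
    have h4 : (L : ℝ) = L.1 := rfl
    rw [← h4] at h3
    linarith
  have hd : ‖Y (a + h) t - Y a t‖ ≤ |h| * (‖e‖ * exp (K * T)) := by
    have h1 := dist_solutions_le hK (hY (a + h)) (hY a) t
    rw [dist_eq_norm, dist_eq_norm, hY0, hY0, abs_of_nonneg ht.1] at h1
    have h2 : y₀ + (a + h) • e - (y₀ + a • e) = h • e := by module
    rw [h2, norm_smul, Real.norm_eq_abs, mul_assoc] at h1
    have h3 : exp (K * t) ≤ exp (K * T) := exp_le_exp.mpr (mul_le_mul_of_nonneg_left ht.2 K.2)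
    exact h1.trans (by gcongr)
  have hT := hM (Y a t) (hball a (by linarith)) (Y (a + h) t)
    (hball _ ((abs_add_le _ _).trans (by linarith)))
  rw [map_smul, ← smul_sub, norm_smul, norm_inv, Real.norm_eq_abs]
  have hpos : 0 < |h| := abs_pos.mpr h0
  rw [inv_mul_le_iff₀ hpos]
  calc _ ≤ _ := hT
    _ ≤ M * (|h| * (‖e‖ * exp (K * T))) ^ 2 := by gcongr
    _ = _ := by ring

theorem exists_diffQuotient_cauchy (hG : ContDiff ℝ 2 G) (hK : LipschitzWith K G)
    (hL : ∀ y, ‖G y‖ ≤ L) (hY : ∀ a t, HasDerivAt (Y a) (G (Y a t)) t)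
    (hY0 : ∀ a, Y a 0 = y₀ + a • e) (T A : ℝ) :
    ∃ C, 0 ≤ C ∧ ∀ a, |a| ≤ A → ∀ h, |h| ≤ 1 → h ≠ 0 → ∀ k, |k| ≤ 1 → k ≠ 0 → ∀ t ∈ Icc 0 T,
      dist (h⁻¹ • (Y (a + h) t - Y a t)) (k⁻¹ • (Y (a + k) t - Y a t)) ≤ C * (|h| + |k|) := by
  obtain ⟨C, hC, H⟩ := exists_diffQuotient_bound hG hK hL hY hY0 T A
  refine ⟨C * exp ((K + 1) * T), by positivity, fun a ha h hh h0 k hk k0 t ht => ?_⟩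
  have hq : ∀ h t, HasDerivAt (fun t => h⁻¹ • (Y (a + h) t - Y a t))
      (h⁻¹ • (G (Y (a + h) t) - G (Y a t))) t := fun h t =>
    ((hY (a + h) t).sub (hY a t)).const_smul h⁻¹
  have hlip : ∀ t, LipschitzWith (K + 1) fun y => fderiv ℝ G (Y a t) y := fun t => by
    refine (fderiv ℝ G (Y a t)).lipschitz.weaken ?_
    refine le_trans (?_ : ‖fderiv ℝ G (Y a t)‖₊ ≤ K) (by simp)
    exact norm_fderiv_le_of_lipschitz ℝ hK
  have key := dist_le_of_approx_trajectories_ODE (v := fun t y => fderiv ℝ G (Y a t) y)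
    (a := 0) (b := T) (δ := 0) (εf := C * |h|) (εg := C * |k|) hlip
    (fun s _ => (hq h s).continuousAt.continuousWithinAt) (fun s _ => (hq h s).hasDerivWithinAt)
    (fun s hs => by rw [dist_eq_norm]; exact H a ha h hh h0 s (Ico_subset_Icc_self hs))
    (fun s _ => (hq k s).continuousAt.continuousWithinAt) (fun s _ => (hq k s).hasDerivWithinAt)
    (fun s hs => by rw [dist_eq_norm]; exact H a ha k hk k0 s (Ico_subset_Icc_self hs))
    (by
      have : ∀ h : ℝ, h ≠ 0 → h⁻¹ • (Y (a + h) 0 - Y a 0) = e := fun h h0 => by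
        rw [hY0, hY0, show y₀ + (a + h) • e - (y₀ + a • e) = h • e by module, smul_smul,
          inv_mul_cancel₀ h0, one_smul]
      rw [this h h0, this k k0, dist_self]) t ht
  refine key.trans ?_
  rw [sub_zero]
  refine (gronwallBound_zero_le (by positivity) ht.2).trans (le_of_eq ?_)
  ring

theorem exists_variation (hG : ContDiff ℝ 2 G) (hK : LipschitzWith K G)
    (hL : ∀ y, ‖G y‖ ≤ L) (hY : ∀ a t, HasDerivAt (Y a) (G (Y a t)) t)
    (hY0 : ∀ a, Y a 0 = y₀ + a • e) :
    ∃ V : ℝ → ℝ → E, ∀ T A : ℝ, ∃ C, 0 ≤ C ∧ ∀ a, |a| ≤ A → ∀ h, |h| ≤ 1 → h ≠ 0 →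
      ∀ t ∈ Icc 0 T, ‖h⁻¹ • (Y (a + h) t - Y a t) - V a t‖ ≤ C * |h| := by
  have hpos : ∀ n : ℕ, (0 : ℝ) < 1 / (n + 1) := fun n => by positivity
  have hle : ∀ n : ℕ, |(1 : ℝ) / (n + 1)| ≤ 1 := fun n => by
    rw [abs_of_pos (hpos n), div_le_one (by positivity)]
    linarith [(Nat.cast_nonneg n : (0 : ℝ) ≤ n)]
  have hlim := tendsto_one_div_add_atTop_nhds_zero_nat (𝕜 := ℝ)
  have hex : ∀ a t : ℝ, 0 ≤ t → ∃ v, Tendsto (fun n : ℕ => (1 / ((n : ℝ) + 1))⁻¹ •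
      (Y (a + 1 / ((n : ℝ) + 1)) t - Y a t)) atTop (𝓝 v) := by
    intro a t ht
    obtain ⟨C, hC, H⟩ := exists_diffQuotient_cauchy hG hK hL hY hY0 t |a|
    refine cauchySeq_tendsto_of_complete
      (cauchySeq_of_le_tendsto_0 (fun n : ℕ => C * (2 * (1 / ((n : ℝ) + 1)))) ?_ ?_)
    · intro n m N hn hm
      refine (H a le_rfl _ (hle n) (hpos n).ne' _ (hle m) (hpos m).ne' t ⟨ht, le_rfl⟩).trans ?_
      refine mul_le_mul_of_nonneg_left ?_ hC
      rw [abs_of_pos (hpos n), abs_of_pos (hpos m)]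
      have h1 := one_div_le_one_div_of_le (by positivity : (0 : ℝ) < N + 1)
        (by exact_mod_cast Nat.succ_le_succ hn : (N : ℝ) + 1 ≤ n + 1)
      have h2 := one_div_le_one_div_of_le (by positivity : (0 : ℝ) < N + 1)
        (by exact_mod_cast Nat.succ_le_succ hm : (N : ℝ) + 1 ≤ m + 1)
      linarith
    · simpa using (hlim.const_mul 2).const_mul C
  choose V hV using fun a (t : Ici (0 : ℝ)) => hex a t t.2
  refine ⟨fun a t => V a ⟨max t 0, mem_Ici.mpr (le_max_right _ _)⟩, fun T A => ?_⟩
  obtain ⟨C, hC, H⟩ := exists_diffQuotient_cauchy hG hK hL hY hY0 T A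
  refine ⟨C, hC, fun a ha h hh h0 t ht => ?_⟩
  have h1 := hV a ⟨max t 0, mem_Ici.mpr (le_max_right _ _)⟩
  simp only [max_eq_left ht.1] at h1 ⊢
  have h2 := (tendsto_const_nhds (x := h⁻¹ • (Y (a + h) t - Y a t))).dist h1
  have h3 : Tendsto (fun n : ℕ => C * (|h| + |1 / ((n : ℝ) + 1)|)) atTop (𝓝 (C * (|h| + |0|))) :=
    (hlim.abs.const_add _).const_mul _
  rw [abs_zero, add_zero] at h3
  rw [← dist_eq_norm]
  exact le_of_tendsto_of_tendsto' h2 h3 fun n => H a ha h hh h0 _ (hle n) (hpos n).ne' t ht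

end

section
variable {E : Type*} [NormedAddCommGroup E] [NormedSpace ℝ E]
open Set Filter Topology
open scoped NNReal

variable [ProperSpace E] {G : E → E} {K L : ℝ≥0} {Y : ℝ → ℝ → E} {y₀ e : E}

theorem exists_variation_field (hG : ContDiff ℝ 2 G) (hK : LipschitzWith K G)
    (hL : ∀ y, ‖G y‖ ≤ L) (hY : ∀ a t, HasDerivAt (Y a) (G (Y a t)) t)
    (hY0 : ∀ a, Y a 0 = y₀ + a • e) :
    ∃ V : ℝ → ℝ → E, (∀ a t, 0 ≤ t → HasDerivAt (fun b => Y b t) (V a t) a) ∧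
      ContinuousOn (fun p : ℝ × ℝ => V p.1 p.2) (univ ×ˢ Ici 0) ∧ (∀ a, V a 0 = e) ∧
      ∀ a t, 0 < t → HasDerivAt (V a) (fderiv ℝ G (Y a t) (V a t)) t := by
  obtain ⟨V, hV⟩ := exists_variation hG hK hL hY hY0
  have hcY : Continuous fun p : ℝ × ℝ => Y p.1 p.2 :=
    continuous_uncurry_solution hK hL hY (by simp_rw [hY0]; fun_prop)
  have hlim : Tendsto (fun n : ℕ => 1 / ((n : ℝ) + 1)) atTop (𝓝 0) :=
    tendsto_one_div_add_atTop_nhds_zero_nat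
  have hpos : ∀ n : ℕ, (0 : ℝ) < 1 / (n + 1) := fun n => by positivity
  have hle : ∀ n : ℕ, |(1 : ℝ) / (n + 1)| ≤ 1 := fun n => by
    rw [abs_of_pos (hpos n), div_le_one (by positivity)]
    linarith [(Nat.cast_nonneg n : (0 : ℝ) ≤ n)]
  have hsmall : ∀ C ε : ℝ, 0 < ε → ∀ᶠ n : ℕ in atTop, C * |1 / ((n : ℝ) + 1)| < ε := by
    intro C ε hε
    have : Tendsto (fun n : ℕ => C * |1 / ((n : ℝ) + 1)|) atTop (𝓝 (C * |0|)) :=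
      hlim.abs.const_mul C
    rw [abs_zero, mul_zero] at this
    exact this.eventually_lt_const hε
  have hparam : ∀ a t, 0 ≤ t → HasDerivAt (fun b => Y b t) (V a t) a := by
    intro a t ht
    obtain ⟨C, hC, H⟩ := hV t |a|
    rw [hasDerivAt_iff_tendsto_slope_zero, tendsto_iff_norm_sub_tendsto_zero]
    refine squeeze_zero' (g := fun h => C * |h|) (Eventually.of_forall fun _ => norm_nonneg _) ?_ ?_
    · have h1 : ∀ᶠ h : ℝ in 𝓝[≠] 0, |h| ≤ 1 := by
        refine eventually_nhdsWithin_of_eventually_nhds ?_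
        filter_upwards [Icc_mem_nhds (by norm_num : (-1 : ℝ) < 0) one_pos] with h hh
        exact abs_le.mpr hh
      filter_upwards [h1, self_mem_nhdsWithin] with h hh h0
      exact H a le_rfl h hh h0 t ⟨ht, le_rfl⟩
    · have : Continuous fun h : ℝ => C * |h| := by fun_prop
      simpa using (this.tendsto 0).mono_left nhdsWithin_le_nhds
  refine ⟨V, hparam, ?_, fun a => ?_, fun a t ht => ?_⟩
  · rintro ⟨a, t⟩ -
    have hloc : TendstoUniformlyOn (fun (n : ℕ) (p : ℝ × ℝ) =>
        (1 / ((n : ℝ) + 1))⁻¹ • (Y (p.1 + 1 / ((n : ℝ) + 1)) p.2 - Y p.1 p.2))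
        (fun p => V p.1 p.2) atTop (Metric.closedBall a 1 ×ˢ Icc 0 (t + 1)) := by
      obtain ⟨C, hC, H⟩ := hV (t + 1) (|a| + 1)
      rw [Metric.tendstoUniformlyOn_iff]
      intro ε hε
      filter_upwards [hsmall C ε hε] with n hn
      rintro ⟨b, s⟩ ⟨hb, hs⟩
      rw [dist_comm, dist_eq_norm]
      refine (H b ?_ _ (hle n) (hpos n).ne' s hs).trans_lt hn
      have h1 : |b - a| ≤ 1 := by simpa [Real.dist_eq] using hb
      have h2 := abs_add_le a (b - a)
      rw [add_sub_cancel] at h2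
      linarith
    have hcont := hloc.continuousOn (Frequently.of_forall fun n => by fun_prop)
    by_cases h0 : 0 ≤ t
    · refine (hcont ⟨a, t⟩ ⟨Metric.mem_closedBall_self zero_le_one, h0, by linarith⟩).mono_of_mem_nhdsWithin ?_
      have h1 : Metric.closedBall a 1 ×ˢ Iic (t + 1) ∈ 𝓝 (a, t) :=
        prod_mem_nhds (Metric.closedBall_mem_nhds _ one_pos) (Iic_mem_nhds (by linarith))
      filter_upwards [mem_nhdsWithin_of_mem_nhds h1, self_mem_nhdsWithin] with p hp hp'
      exact ⟨hp.1, hp'.2, hp.2⟩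
    · refine continuousWithinAt_of_notMem_closure fun h => h0 ?_
      rw [closure_prod_eq, closure_Ici] at h
      exact h.2
  · refine (hparam a 0 le_rfl).unique ?_
    simp_rw [hY0]
    simpa using ((hasDerivAt_id a).smul_const e).const_add y₀
  · obtain ⟨C, hC, H⟩ := hV (t + 1) |a|
    obtain ⟨C', hC', H'⟩ := exists_diffQuotient_bound hG hK hL hY hY0 (t + 1) |a|
    refine hasDerivAt_of_tendstoLocallyUniformlyOn (s := Ioo 0 (t + 1)) (l := atTop)
      (f := fun (n : ℕ) s => (1 / ((n : ℝ) + 1))⁻¹ • (Y (a + 1 / ((n : ℝ) + 1)) s - Y a s))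
      (f' := fun (n : ℕ) s =>
        (1 / ((n : ℝ) + 1))⁻¹ • (G (Y (a + 1 / ((n : ℝ) + 1)) s) - G (Y a s)))
      (g' := fun s => fderiv ℝ G (Y a s) (V a s))
      isOpen_Ioo ?_ ?_ ?_ ⟨ht, by linarith⟩
    · refine TendstoUniformlyOn.tendstoLocallyUniformlyOn ?_
      rw [Metric.tendstoUniformlyOn_iff]
      intro ε hε
      filter_upwards [hsmall (C' + K * C) ε hε] with n hn s hs
      rw [dist_comm, dist_eq_norm]
      refine lt_of_le_of_lt ?_ hn
      have h1 := H a le_rfl _ (hle n) (hpos n).ne' s (Ioo_subset_Icc_self hs)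
      have h2 := H' a le_rfl _ (hle n) (hpos n).ne' s (Ioo_subset_Icc_self hs)
      have h3 := (fderiv ℝ G (Y a s)).le_of_opNorm_le (norm_fderiv_le_of_lipschitz ℝ hK)
        ((1 / ((n : ℝ) + 1))⁻¹ • (Y (a + 1 / ((n : ℝ) + 1)) s - Y a s) - V a s)
      rw [map_sub] at h3
      have h4 := mul_le_mul_of_nonneg_left h1 K.2
      have h5 := norm_sub_le_norm_sub_add_norm_sub
        ((1 / ((n : ℝ) + 1))⁻¹ • (G (Y (a + 1 / ((n : ℝ) + 1)) s) - G (Y a s)))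
        (fderiv ℝ G (Y a s) ((1 / ((n : ℝ) + 1))⁻¹ • (Y (a + 1 / ((n : ℝ) + 1)) s - Y a s)))
        (fderiv ℝ G (Y a s) (V a s))
      have h6 : (K : ℝ) = K.1 := rfl
      rw [← h6] at h4
      calc _ ≤ _ := h5
        _ ≤ C' * |1 / ((n : ℝ) + 1)| + K * (C * |1 / ((n : ℝ) + 1)|) :=
            add_le_add h2 (h3.trans h4)
        _ = _ := by ring
    · exact Eventually.of_forall fun n s _ => ((hY _ s).sub (hY a s)).const_smul _
    · intro s hs
      rw [tendsto_iff_norm_sub_tendsto_zero]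
      have h1 : Tendsto (fun n : ℕ => C * |1 / ((n : ℝ) + 1)|) atTop (𝓝 (C * |0|)) :=
        hlim.abs.const_mul C
      rw [abs_zero, mul_zero] at h1
      exact squeeze_zero (fun _ => norm_nonneg _)
        (fun n => H a le_rfl _ (hle n) (hpos n).ne' s (Ioo_subset_Icc_self hs)) h1

end

section
variable {E : Type*} [NormedAddCommGroup E]

/-- Bounded and Lipschitz real-valued functions. -/
def BddLip (f : E → ℝ) : Prop :=
  ∃ K : ℝ, 0 ≤ K ∧ (∀ y, |f y| ≤ K) ∧ ∀ y z, |f y - f z| ≤ K * ‖y - z‖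

theorem BddLip.mul {f g : E → ℝ} (hf : BddLip f) (hg : BddLip g) :
    BddLip fun y => f y * g y := by
  obtain ⟨K, hK, h1, h2⟩ := hf
  obtain ⟨M, hM, h3, h4⟩ := hg
  refine ⟨2 * K * M, by positivity, fun y => ?_, fun y z => ?_⟩
  · rw [abs_mul]
    nlinarith [mul_le_mul (h1 y) (h3 y) (abs_nonneg _) hK, mul_nonneg hK hM]
  · rw [show f y * g y - f z * g z = f y * (g y - g z) + (f y - f z) * g z by ring]
    refine (abs_add_le _ _).trans ?_
    rw [abs_mul, abs_mul]
    have h5 := mul_le_mul (h1 y) (h4 y z) (abs_nonneg _) hK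
    have h6 := mul_le_mul (h2 y z) (h3 z) (abs_nonneg _) (by positivity)
    linarith

theorem BddLip.add {f g : E → ℝ} (hf : BddLip f) (hg : BddLip g) :
    BddLip fun y => f y + g y := by
  obtain ⟨K, hK, h1, h2⟩ := hf
  obtain ⟨M, hM, h3, h4⟩ := hg
  refine ⟨K + M, by positivity, fun y => ?_, fun y z => ?_⟩
  · exact (abs_add_le _ _).trans (add_le_add (h1 y) (h3 y))
  · rw [show f y + g y - (f z + g z) = (f y - f z) + (g y - g z) by ring, add_mul]
    exact (abs_add_le _ _).trans (add_le_add (h2 y z) (h4 y z))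

theorem BddLip.const (c : ℝ) : BddLip fun _ : E => c :=
  ⟨|c|, abs_nonneg c, fun _ => le_rfl, fun y z => by simp; positivity⟩

theorem bddLip_of_quotient {p q : E → ℝ} {c : ℝ} (hc : 0 ≤ c) (hq : ∀ y, 1 ≤ q y)
    (hpq : ∀ y, |p y| ≤ q y) (hp : ∀ y z, ‖y - z‖ ≤ 1 → |p y - p z| ≤ c * ‖y - z‖ * q y)
    (hqd : ∀ y z, ‖y - z‖ ≤ 1 → |q y - q z| ≤ c * ‖y - z‖ * q y) :
    BddLip fun y => p y / q y := by
  have hb : ∀ y, |p y / q y| ≤ 1 := fun y => by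
    have h0 : 0 < q y := zero_lt_one.trans_le (hq y)
    rw [abs_div, abs_of_pos h0, div_le_one h0]
    exact hpq y
  refine ⟨2 * c + 2, by positivity, fun y => (hb y).trans (by linarith), fun y z => ?_⟩
  have h0 : 0 < q y := zero_lt_one.trans_le (hq y)
  have h1 : 0 < q z := zero_lt_one.trans_le (hq z)
  rcases le_total ‖y - z‖ 1 with h | h
  · have hid : p y / q y - p z / q z
        = (p y - p z) / q y + (p z / q z) * ((q z - q y) / q y) := by
      field_simp; ring
    rw [hid]
    refine (abs_add_le _ _).trans ?_
    rw [abs_mul, abs_div, abs_div (q z - q y), abs_of_pos h0, abs_sub_comm (q z)]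
    have h2 : |p y - p z| / q y ≤ c * ‖y - z‖ := by
      rw [div_le_iff₀ h0]; exact hp y z h
    have h3 : |q y - q z| / q y ≤ c * ‖y - z‖ := by
      rw [div_le_iff₀ h0]; exact hqd y z h
    have h4 : |p z / q z| * (|q y - q z| / q y) ≤ 1 * (c * ‖y - z‖) :=
      mul_le_mul (hb z) h3 (by positivity) zero_le_one
    nlinarith [norm_nonneg (y - z)]
  · have := abs_sub (p y / q y) (p z / q z)
    nlinarith [hb y, hb z, norm_nonneg (y - z)]

end

section
open scoped NNReal

/-- The geodesic field in the variables `(r, x, ω)`, where `ω` is the angle of the tangent,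
slowed down so as to be smooth, bounded and Lipschitz on the whole space. -/
noncomputable def field (lam : ℝ) (y : ℝ × ℝ × ℝ) : ℝ × ℝ × ℝ :=
  (y.1 / (1 + y.1 ^ 2 + y.2.1 ^ 2) * cos y.2.2,
   y.1 / (1 + y.1 ^ 2 + y.2.1 ^ 2) * sin y.2.2,
   (-(lam - 1)) * (1 / (1 + y.1 ^ 2 + y.2.1 ^ 2) * sin y.2.2) +
    ((1 / 2) * (y.1 ^ 2 / (1 + y.1 ^ 2 + y.2.1 ^ 2) * sin y.2.2) +
     (-(1 / 2)) * (y.1 * y.2.1 / (1 + y.1 ^ 2 + y.2.1 ^ 2) * cos y.2.2)))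

theorem contDiff_field (lam : ℝ) {n : WithTop ℕ∞} : ContDiff ℝ n (field lam) := by
  have hq : ∀ y : ℝ × ℝ × ℝ, 1 + y.1 ^ 2 + y.2.1 ^ 2 ≠ 0 := fun y => by positivity
  unfold field
  fun_prop (disch := exact hq _)

theorem abs_fst_sub_le (y z : ℝ × ℝ × ℝ) : |y.1 - z.1| ≤ ‖y - z‖ := norm_fst_le (y - z)

theorem abs_snd_fst_sub_le (y z : ℝ × ℝ × ℝ) : |y.2.1 - z.2.1| ≤ ‖y - z‖ :=
  (norm_fst_le (y - z).2).trans (norm_snd_le (y - z))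

theorem abs_snd_snd_sub_le (y z : ℝ × ℝ × ℝ) : |y.2.2 - z.2.2| ≤ ‖y - z‖ :=
  (norm_snd_le (y - z).2).trans (norm_snd_le (y - z))

theorem bddLip_sin_angle : BddLip fun y : ℝ × ℝ × ℝ => sin y.2.2 :=
  ⟨1, zero_le_one, fun y => abs_sin_le_one _, fun y z => by
    rw [one_mul]; exact (abs_sin_sub_sin_le _ _).trans (abs_snd_snd_sub_le y z)⟩

theorem bddLip_cos_angle : BddLip fun y : ℝ × ℝ × ℝ => cos y.2.2 :=
  ⟨1, zero_le_one, fun y => abs_cos_le_one _, fun y z => by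
    rw [one_mul]; exact (abs_cos_sub_cos_le _ _).trans (abs_snd_snd_sub_le y z)⟩

theorem abs_mul_sub_mul_le {a b a' b' d : ℝ} (ha : |a - a'| ≤ d) (hb : |b - b'| ≤ d) (hd : d ≤ 1) :
    |a * b - a' * b'| ≤ d * (|a| + |b| + 1) := by
  have hd0 : 0 ≤ d := (abs_nonneg _).trans ha
  rw [show a * b - a' * b' = a * (b - b') + b * (a - a') - (a - a') * (b - b') by ring]
  have h1 := abs_sub (a * (b - b') + b * (a - a')) ((a - a') * (b - b'))
  have h2 := abs_add_le (a * (b - b')) (b * (a - a'))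
  rw [abs_mul, abs_mul] at h2
  rw [abs_mul (a - a')] at h1
  have h3 := mul_le_mul ha hb (abs_nonneg _) hd0
  nlinarith [mul_le_mul_of_nonneg_left hb (abs_nonneg a),
    mul_le_mul_of_nonneg_left ha (abs_nonneg b)]

theorem bddLip_quotient {p : ℝ × ℝ × ℝ → ℝ} (hp : ∀ y, |p y| ≤ 1 + y.1 ^ 2 + y.2.1 ^ 2)
    (hpd : ∀ y z : ℝ × ℝ × ℝ, ‖y - z‖ ≤ 1 →
      |p y - p z| ≤ ‖y - z‖ * (2 * |y.1| + 2 * |y.2.1| + 2)) :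
    BddLip fun y => p y / (1 + y.1 ^ 2 + y.2.1 ^ 2) := by
  have hlin : ∀ (y : ℝ × ℝ × ℝ) (d : ℝ), 0 ≤ d → d * (2 * |y.1| + 2 * |y.2.1| + 2) ≤
      4 * d * (1 + y.1 ^ 2 + y.2.1 ^ 2) := fun y d hd => by
    rw [mul_comm 4 d, mul_assoc]
    refine mul_le_mul_of_nonneg_left ?_ hd
    nlinarith [sq_nonneg (|y.1| - 1), sq_nonneg (|y.2.1| - 1), sq_abs y.1, sq_abs y.2.1]
  have hq1 : ∀ y : ℝ × ℝ × ℝ, 1 ≤ 1 + y.1 ^ 2 + y.2.1 ^ 2 := fun y => by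
    nlinarith [sq_nonneg y.1, sq_nonneg y.2.1]
  refine bddLip_of_quotient (c := 4) (by norm_num) hq1 hp (fun y z h => (hpd y z h).trans (hlin y _ (norm_nonneg _)))
    (fun y z h => le_trans ?_ (hlin y _ (norm_nonneg _)))
  have h1 := abs_mul_sub_mul_le (abs_fst_sub_le y z) (abs_fst_sub_le y z) h
  have h2 := abs_mul_sub_mul_le (abs_snd_fst_sub_le y z) (abs_snd_fst_sub_le y z) h
  rw [show 1 + y.1 ^ 2 + y.2.1 ^ 2 - (1 + z.1 ^ 2 + z.2.1 ^ 2) =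
    (y.1 * y.1 - z.1 * z.1) + (y.2.1 * y.2.1 - z.2.1 * z.2.1) by ring]
  refine (abs_add_le _ _).trans ((add_le_add h1 h2).trans (le_of_eq (by ring)))

theorem exists_field_bounds (lam : ℝ) :
    ∃ K : ℝ≥0, LipschitzWith K (field lam) ∧ ∀ y, ‖field lam y‖ ≤ K := by
  have hone : BddLip fun y : ℝ × ℝ × ℝ => 1 / (1 + y.1 ^ 2 + y.2.1 ^ 2) :=
    bddLip_quotient (p := fun _ => 1)
      (fun y => by rw [abs_one]; nlinarith [sq_nonneg y.1, sq_nonneg y.2.1]) (fun y z h => by simp; positivity)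
  have hr : BddLip fun y : ℝ × ℝ × ℝ => y.1 / (1 + y.1 ^ 2 + y.2.1 ^ 2) :=
    bddLip_quotient (p := fun y => y.1)
      (fun y => by nlinarith [sq_abs y.1, sq_nonneg y.2.1, sq_nonneg (|y.1| - 1)]) (fun y z h => by
        nlinarith [abs_fst_sub_le y z, mul_nonneg (norm_nonneg (y - z)) (abs_nonneg y.1),
          mul_nonneg (norm_nonneg (y - z)) (abs_nonneg y.2.1), norm_nonneg (y - z)])
  have hrr : BddLip fun y : ℝ × ℝ × ℝ => y.1 ^ 2 / (1 + y.1 ^ 2 + y.2.1 ^ 2) :=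
    bddLip_quotient (p := fun y => y.1 ^ 2) (fun y => by
        rw [abs_of_nonneg (sq_nonneg _)]; nlinarith [sq_nonneg y.2.1]) (fun y z h => by
        have := abs_mul_sub_mul_le (abs_fst_sub_le y z) (abs_fst_sub_le y z) h
        rw [sq, sq]
        refine this.trans (mul_le_mul_of_nonneg_left ?_ (norm_nonneg _))
        linarith [abs_nonneg y.2.1])
  have hrx : BddLip fun y : ℝ × ℝ × ℝ => y.1 * y.2.1 / (1 + y.1 ^ 2 + y.2.1 ^ 2) :=
    bddLip_quotient (p := fun y => y.1 * y.2.1) (fun y => by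
        rw [abs_mul]; nlinarith [sq_nonneg (|y.1| - |y.2.1|), sq_abs y.1, sq_abs y.2.1])
      (fun y z h => by
        have := abs_mul_sub_mul_le (abs_fst_sub_le y z) (abs_snd_fst_sub_le y z) h
        refine this.trans (mul_le_mul_of_nonneg_left ?_ (norm_nonneg _))
        linarith [abs_nonneg y.1, abs_nonneg y.2.1])
  obtain ⟨K₁, hK₁, hb₁, hl₁⟩ := hr.mul bddLip_cos_angle
  obtain ⟨K₂, hK₂, hb₂, hl₂⟩ := hr.mul bddLip_sin_angle
  obtain ⟨K₃, hK₃, hb₃, hl₃⟩ :=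
    ((BddLip.const (-(lam - 1))).mul (hone.mul bddLip_sin_angle)).add
      (((BddLip.const (1 / 2)).mul (hrr.mul bddLip_sin_angle)).add
        ((BddLip.const (-(1 / 2))).mul (hrx.mul bddLip_cos_angle)))
  refine ⟨⟨K₁ + K₂ + K₃, by positivity⟩, LipschitzWith.of_dist_le_mul fun y z => ?_, fun y => ?_⟩
  · rw [dist_eq_norm, dist_eq_norm]
    change _ ≤ (K₁ + K₂ + K₃) * ‖y - z‖
    have hn := norm_nonneg (y - z)
    refine norm_prod_le_iff.mpr ⟨(hl₁ y z).trans ?_, norm_prod_le_iff.mpr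
      ⟨(hl₂ y z).trans ?_, (hl₃ y z).trans ?_⟩⟩ <;> gcongr <;> linarith
  · change _ ≤ K₁ + K₂ + K₃
    refine norm_prod_le_iff.mpr ⟨(hb₁ y).trans ?_, norm_prod_le_iff.mpr
      ⟨(hb₂ y).trans ?_, (hb₃ y).trans ?_⟩⟩ <;> linarith

end

section
open Set Filter Topology
open scoped NNReal

/-- The Euclidean speed of the time-changed geodesics. -/
noncomputable def speed (r x : ℝ) : ℝ := r / (1 + r ^ 2 + x ^ 2)

/-- The curvature of a geodesic through `(r, x)` with tangent angle `ω`. -/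
noncomputable def curv (lam r x ω : ℝ) : ℝ :=
  ((lam - 1) / r - r / 2) * sin ω + x / 2 * cos ω

/-- Geodesics, in terms of position and tangent angle. -/
structure Traj (lam : ℝ) (r x ω : ℝ → ℝ) : Prop where
  pos : ∀ t, 0 < r t
  hr : ∀ t, HasDerivAt r (speed (r t) (x t) * cos (ω t)) t
  hx : ∀ t, HasDerivAt x (speed (r t) (x t) * sin (ω t)) t
  hω : ∀ t, HasDerivAt ω (-(speed (r t) (x t) * curv lam (r t) (x t) (ω t))) t

theorem speed_pos {r x : ℝ} (hr : 0 < r) : 0 < speed r x := by unfold speed; positivity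

theorem field_eq {lam r x ω : ℝ} (hr : r ≠ 0) : field lam (r, x, ω) =
    (speed r x * cos ω, speed r x * sin ω, -(speed r x * curv lam r x ω)) := by
  have : 1 + r ^ 2 + x ^ 2 ≠ 0 := by positivity
  unfold field speed curv
  refine Prod.ext rfl (Prod.ext rfl ?_)
  simp only
  field_simp
  ring

variable {lam : ℝ} {r x ω : ℝ → ℝ}

theorem Traj.continuous_r (h : Traj lam r x ω) : Continuous r :=
  continuous_iff_continuousAt.mpr fun t => (h.hr t).continuousAt

theorem Traj.continuous_x (h : Traj lam r x ω) : Continuous x :=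
  continuous_iff_continuousAt.mpr fun t => (h.hx t).continuousAt

theorem Traj.continuous_ω (h : Traj lam r x ω) : Continuous ω :=
  continuous_iff_continuousAt.mpr fun t => (h.hω t).continuousAt

theorem Traj.speed_pos (h : Traj lam r x ω) (t : ℝ) : 0 < speed (r t) (x t) :=
  Angenent.speed_pos (h.pos t)

theorem Traj.continuous_speed (h : Traj lam r x ω) : Continuous fun t => speed (r t) (x t) := by
  have h1 := h.continuous_r
  have h2 := h.continuous_x
  unfold speed
  exact h1.div (by fun_prop) fun t => by positivity

theorem Traj.continuous_curv (h : Traj lam r x ω) :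
    Continuous fun t => curv lam (r t) (x t) (ω t) := by
  have h1 := h.continuous_r
  have h2 := h.continuous_x
  have h3 := h.continuous_ω
  have h4 : Continuous fun t => (lam - 1) / r t := continuous_const.div h1 fun t => (h.pos t).ne'
  unfold curv
  fun_prop

theorem Traj.hasDerivAt_field (h : Traj lam r x ω) (t : ℝ) :
    HasDerivAt (fun t => (r t, x t, ω t)) (field lam (r t, x t, ω t)) t := by
  rw [field_eq (h.pos t).ne']
  exact (h.hr t).prodMk ((h.hx t).prodMk (h.hω t))

theorem Traj.eq_of_eq_at {r₂ x₂ ω₂ : ℝ → ℝ} (h : Traj lam r x ω) (h₂ : Traj lam r₂ x₂ ω₂) {t₀ : ℝ}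
    (hr : r t₀ = r₂ t₀) (hx : x t₀ = x₂ t₀) (hω : ω t₀ = ω₂ t₀) (t : ℝ) :
    r t = r₂ t ∧ x t = x₂ t ∧ ω t = ω₂ t := by
  obtain ⟨K, hK, -⟩ := exists_field_bounds lam
  have := ODE_solution_unique_univ (v := fun _ => field lam) (s := fun _ => univ) (t₀ := t₀)
    (fun _ => hK.lipschitzOnWith) (fun t => ⟨h.hasDerivAt_field t, trivial⟩)
    (fun t => ⟨h₂.hasDerivAt_field t, trivial⟩) (by rw [hr, hx, hω])
  have ht := congrFun this t
  exact ⟨congrArg Prod.fst ht, congrArg (fun y => y.2.1) ht, congrArg (fun y => y.2.2) ht⟩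

theorem Traj.reflect (h : Traj lam r x ω) (c : ℝ) {d : ℝ} (hc : ∀ θ, cos (d - θ) = -cos θ)
    (hs : ∀ θ, sin (d - θ) = sin θ) :
    Traj lam (fun t => r (c - t)) (fun t => -x (c - t)) (fun t => d - ω (c - t)) := by
  have hsp : ∀ a b, speed a (-b) = speed a b := fun a b => by simp [speed]
  refine ⟨fun t => h.pos _, fun t => ?_, fun t => ?_, fun t => ?_⟩
  · simpa [hsp, hc, Function.comp_def] using
      (h.hr (c - t)).comp t ((hasDerivAt_id t).const_sub c)
  · simpa [hsp, hs, Function.comp_def] using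
      ((h.hx (c - t)).comp t ((hasDerivAt_id t).const_sub c)).fun_neg
  · have := ((h.hω (c - t)).comp t ((hasDerivAt_id t).const_sub c)).const_sub d
    refine this.congr_deriv ?_
    simp only [hsp, curv, hc, hs]
    ring

theorem Traj.shift (h : Traj lam r x ω) (c : ℝ) :
    Traj lam (fun t => r (t + c)) (fun t => x (t + c)) (fun t => ω (t + c)) :=
  ⟨fun _ => h.pos _, fun t => (h.hr (t + c)).comp_add_const t c,
    fun t => (h.hx (t + c)).comp_add_const t c, fun t => (h.hω (t + c)).comp_add_const t c⟩

theorem hasDerivAt_fst_comp {E F : Type*} [NormedAddCommGroup E] [NormedSpace ℝ E]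
    [NormedAddCommGroup F] [NormedSpace ℝ F] {f : ℝ → E × F} {f' : E × F} {t : ℝ}
    (hf : HasDerivAt f f' t) : HasDerivAt (fun t => (f t).1) f'.1 t :=
  (ContinuousLinearMap.fst ℝ E F).hasFDerivAt.comp_hasDerivAt t hf

theorem hasDerivAt_snd_comp {E F : Type*} [NormedAddCommGroup E] [NormedSpace ℝ E]
    [NormedAddCommGroup F] [NormedSpace ℝ F] {f : ℝ → E × F} {f' : E × F} {t : ℝ}
    (hf : HasDerivAt f f' t) : HasDerivAt (fun t => (f t).2) f'.2 t :=
  (ContinuousLinearMap.snd ℝ E F).hasFDerivAt.comp_hasDerivAt t hf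

theorem traj_of_solution {f : ℝ → ℝ × ℝ × ℝ} (hf : ∀ t, HasDerivAt f (field lam (f t)) t)
    (h0 : 0 < (f 0).1) : Traj lam (fun t => (f t).1) (fun t => (f t).2.1) (fun t => (f t).2.2) := by
  have h1 : ∀ t, HasDerivAt (fun t => (f t).1) (field lam (f t)).1 t := fun t => hasDerivAt_fst_comp (hf t)
  have h2' : ∀ t, HasDerivAt (fun t => (f t).2) (field lam (f t)).2 t := fun t => hasDerivAt_snd_comp (hf t)
  have h2 : ∀ t, HasDerivAt (fun t => (f t).2.1) (field lam (f t)).2.1 t := fun t => hasDerivAt_fst_comp (h2' t)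
  have h3 : ∀ t, HasDerivAt (fun t => (f t).2.2) (field lam (f t)).2.2 t := fun t => hasDerivAt_snd_comp (h2' t)
  have hcf : Continuous f := continuous_iff_continuousAt.mpr fun t => (hf t).continuousAt
  have hpos : ∀ t, 0 < (f t).1 := by
    set g : ℝ → ℝ := fun t => cos (f t).2.2 / (1 + (f t).1 ^ 2 + (f t).2.1 ^ 2) with hg
    have hgc : Continuous g := by
      refine Continuous.div (by fun_prop) (by fun_prop) fun t => by positivity
    have hI : ∀ t, HasDerivAt (fun t => ∫ s in (0 : ℝ)..t, g s) (g t) t := fun t =>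
      intervalIntegral.integral_hasDerivAt_right (hgc.intervalIntegrable _ _)
        (hgc.stronglyMeasurableAtFilter _ _) hgc.continuousAt
    have hconst : ∀ t, HasDerivAt (fun t => (f t).1 * exp (-∫ s in (0 : ℝ)..t, g s)) 0 t := fun t => by
      refine ((h1 t).mul (hI t).neg.exp).congr_deriv ?_
      simp only [field, hg]
      ring
    intro t
    have := is_const_of_deriv_eq_zero (fun t => (hconst t).differentiableAt)
      (fun t => (hconst t).deriv) t 0
    simp only [intervalIntegral.integral_same, neg_zero, exp_zero, mul_one] at this
    refine pos_of_mul_pos_left ?_ (exp_pos (-∫ s in (0 : ℝ)..t, g s)).le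
    rw [this]
    exact h0
  have he : ∀ t, field lam (f t) = _ := fun t => field_eq (lam := lam) (r := (f t).1)
    (x := (f t).2.1) (ω := (f t).2.2) (hpos t).ne'
  refine ⟨hpos, fun t => ?_, fun t => ?_, fun t => ?_⟩
  · exact (h1 t).congr_deriv (by rw [he])
  · exact (h2 t).congr_deriv (by rw [he])
  · exact (h3 t).congr_deriv (by rw [he])

theorem exists_orbit (lam : ℝ) : ∃ Y : ℝ → ℝ → ℝ × ℝ × ℝ, (∀ a, Y a 0 = (a, 0, π / 2)) ∧
    ∀ a t, HasDerivAt (Y a) (field lam (Y a t)) t := by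
  obtain ⟨K, hK, hL⟩ := exists_field_bounds lam
  choose Y h0 h1 using fun a : ℝ => exists_global_solution hK hL (a, 0, π / 2)
  exact ⟨Y, h0, h1⟩

/-- The solution starting orthogonally to the half-line `x = 0` at the point `(a, 0)`. -/
noncomputable def orbit (lam a : ℝ) : ℝ → ℝ × ℝ × ℝ := (exists_orbit lam).choose a

theorem orbit_zero (lam a : ℝ) : orbit lam a 0 = (a, 0, π / 2) :=
  (exists_orbit lam).choose_spec.1 a

theorem hasDerivAt_orbit (lam a t : ℝ) :
    HasDerivAt (orbit lam a) (field lam (orbit lam a t)) t :=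
  (exists_orbit lam).choose_spec.2 a t

theorem traj_orbit {a : ℝ} (ha : 0 < a) : Traj lam (fun t => (orbit lam a t).1)
    (fun t => (orbit lam a t).2.1) (fun t => (orbit lam a t).2.2) :=
  traj_of_solution (hasDerivAt_orbit lam a) (by rw [orbit_zero]; exact ha)

theorem continuous_orbit (lam : ℝ) : Continuous fun p : ℝ × ℝ => orbit lam p.1 p.2 := by
  obtain ⟨K, hK, hL⟩ := exists_field_bounds lam
  refine continuous_uncurry_solution hK hL (hasDerivAt_orbit lam) ?_
  simp_rw [orbit_zero]
  fun_prop

end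

section
open Set Filter Topology

theorem le_of_hasDerivAt_nonneg {f f' : ℝ → ℝ} {p q : ℝ} (hpq : p ≤ q)
    (hc : ContinuousOn f (Icc p q)) (hd : ∀ t ∈ Ioo p q, HasDerivAt f (f' t) t)
    (h : ∀ t ∈ Ioo p q, 0 ≤ f' t) : f p ≤ f q := by
  refine monotoneOn_of_deriv_nonneg (convex_Icc p q) hc ?_ ?_ (left_mem_Icc.mpr hpq)
    (right_mem_Icc.mpr hpq) hpq
  · rw [interior_Icc]
    exact fun t ht => (hd t ht).differentiableAt.differentiableWithinAt
  · rw [interior_Icc]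
    exact fun t ht => (hd t ht).deriv ▸ h t ht

theorem lt_of_hasDerivAt_pos {f f' : ℝ → ℝ} {p q : ℝ} (hpq : p < q)
    (hc : ContinuousOn f (Icc p q)) (hd : ∀ t ∈ Ioo p q, HasDerivAt f (f' t) t)
    (h : ∀ t ∈ Ioo p q, 0 < f' t) : f p < f q := by
  refine strictMonoOn_of_deriv_pos (convex_Icc p q) hc ?_ (left_mem_Icc.mpr hpq.le)
    (right_mem_Icc.mpr hpq.le) hpq
  rw [interior_Icc]
  exact fun t ht => (hd t ht).deriv ▸ h t ht

theorem exists_first_zero {f : ℝ → ℝ} (hf : Continuous f) {p q : ℝ} (hp : 0 < f p) (hpq : p ≤ q)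
    (hq : f q ≤ 0) : ∃ t, p < t ∧ t ≤ q ∧ f t = 0 ∧ ∀ s, p ≤ s → s < t → 0 < f s := by
  obtain ⟨z, hz, hz0⟩ := intermediate_value_Icc' hpq hf.continuousOn ⟨hq, hp.le⟩
  have hcl : IsClosed (Icc p q ∩ f ⁻¹' {0}) := isClosed_Icc.inter (isClosed_singleton.preimage hf)
  have hcomp : IsCompact (Icc p q ∩ f ⁻¹' {0}) := isCompact_Icc.of_isClosed_subset hcl inter_subset_left
  obtain ⟨t, ⟨ht, ht0⟩, hmin⟩ := hcomp.exists_isLeast ⟨z, hz, hz0⟩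
  have ht0' : f t = 0 := ht0
  have hne : p ≠ t := fun h => by rw [h, ht0'] at hp; exact lt_irrefl _ hp
  refine ⟨t, lt_of_le_of_ne ht.1 hne, ht.2, ht0', fun s hps hst => ?_⟩
  by_contra hs
  push Not at hs
  obtain ⟨z', hz', hz0'⟩ := intermediate_value_Icc' hps hf.continuousOn ⟨hs, hp.le⟩
  have := hmin ⟨⟨hz'.1, hz'.2.trans (hst.le.trans ht.2)⟩, hz0'⟩
  linarith [hz'.2]

theorem exists_integratingFactor {g : ℝ → ℝ} (hg : Continuous g) :
    ∃ E : ℝ → ℝ, (∀ t, 0 < E t) ∧ ∀ t, HasDerivAt E (E t * g t) t := by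
  refine ⟨fun t => exp (∫ s in (0 : ℝ)..t, g s), fun t => exp_pos _, fun t => ?_⟩
  exact (intervalIntegral.integral_hasDerivAt_right (hg.intervalIntegrable _ _)
    (hg.stronglyMeasurableAtFilter _ _) hg.continuousAt).exp

/-- The coefficient `(λ - 1)/r - r/2` of the geodesic equation. -/
noncomputable def drift (lam r : ℝ) : ℝ := (lam - 1) / r - r / 2

theorem hasDerivAt_drift {lam r : ℝ} (hr : r ≠ 0) :
    HasDerivAt (drift lam) (-((lam - 1) / r ^ 2) - 1 / 2) r := by
  have := ((hasDerivAt_inv hr).const_mul (lam - 1)).sub ((hasDerivAt_id r).div_const 2)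
  refine (this.congr_deriv ?_).congr_of_eventuallyEq (Eventually.of_forall fun y => ?_)
  · simp [div_eq_mul_inv]
  · simp [drift, div_eq_mul_inv]

variable {lam : ℝ} {r x ω : ℝ → ℝ}

theorem Traj.hasDerivAt_sin (h : Traj lam r x ω) (t : ℝ) : HasDerivAt (fun t => sin (ω t))
    (-(speed (r t) (x t) * curv lam (r t) (x t) (ω t) * cos (ω t))) t :=
  (h.hω t).sin.congr_deriv (by ring)

theorem Traj.hasDerivAt_cos (h : Traj lam r x ω) (t : ℝ) : HasDerivAt (fun t => cos (ω t))
    (speed (r t) (x t) * curv lam (r t) (x t) (ω t) * sin (ω t)) t :=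
  (h.hω t).cos.congr_deriv (by ring)

theorem Traj.hasDerivAt_drift (h : Traj lam r x ω) (t : ℝ) :
    HasDerivAt (fun t => drift lam (r t))
      ((-((lam - 1) / r t ^ 2) - 1 / 2) * (speed (r t) (x t) * cos (ω t))) t :=
  (Angenent.hasDerivAt_drift (h.pos t).ne').comp t (h.hr t)

theorem curv_eq (lam r x ω : ℝ) : curv lam r x ω = drift lam r * sin ω + x / 2 * cos ω := rfl

theorem Traj.hasDerivAt_curv (h : Traj lam r x ω) (t : ℝ) :
    HasDerivAt (fun t => curv lam (r t) (x t) (ω t))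
      (-(speed (r t) (x t) * ((lam - 1) / r t ^ 2 * cos (ω t) * sin (ω t) +
        curv lam (r t) (x t) (ω t) *
          (drift lam (r t) * cos (ω t) - x t / 2 * sin (ω t))))) t := by
  simp only [curv_eq]
  refine (((h.hasDerivAt_drift t).mul (h.hasDerivAt_sin t)).add
    (((h.hx t).div_const 2).mul (h.hasDerivAt_cos t))).congr_deriv ?_
  simp only [curv_eq]
  ring

theorem Traj.continuous_drift (h : Traj lam r x ω) : Continuous fun t => drift lam (r t) :=
  continuous_iff_continuousAt.mpr fun t => (h.hasDerivAt_drift t).continuousAt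

/-- An integrating factor turns the curvature into a function whose monotonicity is governed by
the sign of the tangent angle. -/
theorem Traj.exists_curv_factor (h : Traj lam r x ω) :
    ∃ E : ℝ → ℝ, (∀ t, 0 < E t) ∧
      ∀ t, HasDerivAt (fun t => curv lam (r t) (x t) (ω t) * E t)
        (-(speed (r t) (x t) * ((lam - 1) / r t ^ 2 * cos (ω t) * sin (ω t)) * E t)) t := by
  have h1 := h.continuous_speed
  have h2 := h.continuous_x
  have h3 := h.continuous_ω
  have h4 := h.continuous_drift
  obtain ⟨E, hE, hE'⟩ := exists_integratingFactor (g := fun t => speed (r t) (x t) *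
    (drift lam (r t) * cos (ω t) - x t / 2 * sin (ω t))) (by fun_prop)
  refine ⟨E, hE, fun t => ((h.hasDerivAt_curv t).mul (hE' t)).congr_deriv ?_⟩
  ring

/-- A geodesic arc leaving the half-line `x = 0` orthogonally and returning to it at time `S`. -/
structure Arc (lam : ℝ) (r x ω : ℝ → ℝ) (S : ℝ) : Prop extends Traj lam r x ω where
  lam_gt : 1 < lam
  S_pos : 0 < S
  x_zero : x 0 = 0
  ω_zero : ω 0 = π / 2
  x_S : x S = 0
  x_pos : ∀ t ∈ Ioo 0 S, 0 < x t
  ω_mem : ∀ t ∈ Icc 0 S, ω t ∈ Icc (-(π / 2)) (π / 2)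

variable {S : ℝ}

theorem Arc.cos_nonneg (h : Arc lam r x ω S) {t : ℝ} (ht : t ∈ Icc 0 S) : 0 ≤ cos (ω t) :=
  Real.cos_nonneg_of_mem_Icc (h.ω_mem t ht)

theorem Traj.le_of_curv_nonneg (h : Traj lam r x ω) {p q : ℝ} (hpq : p ≤ q)
    (hk : ∀ t ∈ Ioo p q, 0 ≤ curv lam (r t) (x t) (ω t)) : ω q ≤ ω p := by
  have := le_of_hasDerivAt_nonneg (f := fun t => -ω t) hpq h.continuous_ω.neg.continuousOn
    (fun t _ => (h.hω t).fun_neg)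
    (fun t ht => by rw [neg_neg]; exact mul_nonneg (h.speed_pos t).le (hk t ht))
  linarith

theorem Traj.lt_of_curv_pos (h : Traj lam r x ω) {p q : ℝ} (hpq : p < q)
    (hk : ∀ t ∈ Ioo p q, 0 < curv lam (r t) (x t) (ω t)) : ω q < ω p := by
  have := lt_of_hasDerivAt_pos (f := fun t => -ω t) hpq h.continuous_ω.neg.continuousOn
    (fun t _ => (h.hω t).fun_neg)
    (fun t ht => by rw [neg_neg]; exact mul_pos (h.speed_pos t) (hk t ht))
  linarith

theorem Traj.curv_pos_of_nonpos_angle (h : Traj lam r x ω) (hlam : 1 < lam) {p q : ℝ} (hpq : p ≤ q)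
    (hω : ω p ≤ 0) (hc : ∀ t ∈ Icc p q, ω t ∈ Icc (-(π / 2)) (π / 2))
    (hk : 0 < curv lam (r p) (x p) (ω p)) :
    0 < curv lam (r q) (x q) (ω q) := by
  by_contra hq
  push Not at hq
  obtain ⟨z, hpz, hzq, hz, hzlt⟩ := exists_first_zero h.continuous_curv hk hpq hq
  obtain ⟨E, hE, hE'⟩ := h.exists_curv_factor
  have hle := le_of_hasDerivAt_nonneg hpz.le
    (fun t _ => (hE' t).continuousAt.continuousWithinAt) (fun t _ => hE' t) (fun t ht => by
      have h1 : ω t ≤ 0 := (h.le_of_curv_nonneg ht.1.le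
        fun s hs => (hzlt s hs.1.le (hs.2.trans ht.2)).le).trans hω
      have hmem := hc t ⟨ht.1.le, ht.2.le.trans hzq⟩
      have h2 : sin (ω t) ≤ 0 := sin_nonpos_of_nonpos_of_neg_pi_le h1 (by linarith [hmem.1, pi_pos])
      have h3 := Real.cos_nonneg_of_mem_Icc hmem
      have h4 : 0 ≤ (lam - 1) / r t ^ 2 := div_nonneg (by linarith) (sq_nonneg _)
      have h5 := mul_nonneg (mul_nonneg h4 h3) (neg_nonneg.mpr h2)
      have h6 := mul_nonneg (mul_nonneg (h.speed_pos t).le h5) (hE t).le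
      linarith)
  rw [hz, zero_mul] at hle
  linarith [mul_pos hk (hE p)]

theorem Traj.curv_pos_of_nonneg_angle (h : Traj lam r x ω) (hlam : 1 < lam) {p q : ℝ} (hpq : p ≤ q)
    (hc : ∀ t ∈ Ioo p q, ω t ∈ Icc 0 (π / 2))
    (hk : 0 < curv lam (r q) (x q) (ω q)) :
    0 < curv lam (r p) (x p) (ω p) := by
  obtain ⟨E, hE, hE'⟩ := h.exists_curv_factor
  have hle := le_of_hasDerivAt_nonneg (f := fun t => -(curv lam (r t) (x t) (ω t) * E t)) hpq
    (fun t _ => (hE' t).continuousAt.neg.continuousWithinAt) (fun t _ => (hE' t).fun_neg)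
    (fun t ht => by
      have hmem := hc t ht
      have h2 : 0 ≤ sin (ω t) := sin_nonneg_of_nonneg_of_le_pi hmem.1 (by linarith [hmem.2, pi_pos])
      have h3 : 0 ≤ cos (ω t) :=
        Real.cos_nonneg_of_mem_Icc ⟨by linarith [hmem.1, pi_pos], hmem.2⟩
      have h4 : 0 ≤ (lam - 1) / r t ^ 2 := div_nonneg (by linarith) (sq_nonneg _)
      have h6 := mul_nonneg (mul_nonneg (h.speed_pos t).le (mul_nonneg (mul_nonneg h4 h3) h2))
        (hE t).le
      linarith)
  have h1 := mul_pos hk (hE q)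
  exact pos_of_mul_pos_left (by linarith) (hE p).le

theorem Arc.exists_top (h : Arc lam r x ω S) :
    ∃ p ∈ Ioo 0 S, ω p = 0 ∧ ∀ s, 0 ≤ s → s < p → 0 < ω s := by
  obtain ⟨z, hz, hz0⟩ := exists_hasDerivAt_eq_zero h.S_pos h.continuous_x.continuousOn
    (by rw [h.x_zero, h.x_S]) (fun t _ => h.hx t)
  have hsin : sin (ω z) = 0 := (mul_eq_zero.mp hz0).resolve_left (h.speed_pos z).ne'
  have hmem := h.ω_mem z (Ioo_subset_Icc_self hz)
  have hωz : ω z = 0 := (sin_eq_zero_iff_of_lt_of_lt (by linarith [hmem.1, pi_pos])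
    (by linarith [hmem.2, pi_pos])).mp hsin
  obtain ⟨p, hp0, hpz, hp, hlt⟩ := exists_first_zero h.continuous_ω
    (by rw [h.ω_zero]; positivity) hz.1.le hωz.le
  exact ⟨p, ⟨hp0, hpz.trans_lt hz.2⟩, hp, hlt⟩

theorem Arc.curv_pos (h : Arc lam r x ω S) {t : ℝ} (ht : t ∈ Icc 0 S) :
    0 < curv lam (r t) (x t) (ω t) := by
  obtain ⟨p, hp, hωp, hlt⟩ := h.exists_top
  have hkp : 0 < curv lam (r p) (x p) (ω p) := by
    rw [curv_eq, hωp, sin_zero, cos_zero]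
    linarith [h.x_pos p hp]
  rcases le_total t p with htp | htp
  · refine h.curv_pos_of_nonneg_angle h.lam_gt htp (fun s hs => ⟨?_, ?_⟩) hkp
    · exact (hlt s (ht.1.trans hs.1.le) hs.2).le
    · exact (h.ω_mem s ⟨ht.1.trans hs.1.le, hs.2.le.trans hp.2.le⟩).2
  · exact h.curv_pos_of_nonpos_angle h.lam_gt htp hωp.le
      (fun s hs => h.ω_mem s ⟨hp.1.le.trans hs.1, hs.2.trans ht.2⟩) hkp

theorem Arc.ω_lt (h : Arc lam r x ω S) {s t : ℝ} (hs : 0 ≤ s) (hst : s < t) (ht : t ≤ S) :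
    ω t < ω s :=
  h.lt_of_curv_pos hst fun u hu => h.curv_pos ⟨hs.trans hu.1.le, hu.2.le.trans ht⟩

theorem Arc.cos_pos (h : Arc lam r x ω S) {t : ℝ} (ht : t ∈ Ioo 0 S) : 0 < cos (ω t) := by
  have h1 := h.ω_lt le_rfl ht.1 ht.2.le
  have h2 := h.ω_lt ht.1.le ht.2 le_rfl
  have h3 := (h.ω_mem S ⟨h.S_pos.le, le_rfl⟩).1
  rw [h.ω_zero] at h1
  exact Real.cos_pos_of_mem_Ioo ⟨by linarith, h1⟩

theorem Arc.r_lt (h : Arc lam r x ω S) {s t : ℝ} (hs : 0 ≤ s) (hst : s < t) (ht : t ≤ S) :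
    r s < r t :=
  lt_of_hasDerivAt_pos hst h.continuous_r.continuousOn (fun u _ => h.hr u)
    fun u hu => mul_pos (h.speed_pos u) (h.cos_pos ⟨hs.trans_lt hu.1, hu.2.trans_le ht⟩)

theorem Arc.r_le (h : Arc lam r x ω S) {s t : ℝ} (hs : 0 ≤ s) (hst : s ≤ t) (ht : t ≤ S) :
    r s ≤ r t := by
  rcases hst.eq_or_lt with rfl | hlt
  · exact le_rfl
  · exact (h.r_lt hs hlt ht).le

theorem Arc.sin_neg (h : Arc lam r x ω S) {p t : ℝ} (hp : 0 ≤ p) (hωp : ω p = 0) (hpt : p < t)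
    (ht : t ≤ S) : sin (ω t) < 0 := by
  have h1 := h.ω_lt hp hpt ht
  have h2 := (h.ω_mem t ⟨hp.trans hpt.le, ht⟩).1
  exact sin_neg_of_neg_of_neg_pi_lt (by linarith) (by linarith [pi_pos])

theorem Arc.sin_pos (h : Arc lam r x ω S) {p t : ℝ} (ht : 0 ≤ t) (hωp : ω p = 0) (htp : t < p)
    (hp : p ≤ S) : 0 < sin (ω t) := by
  have h1 := h.ω_lt ht htp hp
  have h2 := (h.ω_mem t ⟨ht, htp.le.trans hp⟩).2
  exact sin_pos_of_pos_of_lt_pi (by linarith) (by linarith [pi_pos])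

theorem Arc.ω_S_neg (h : Arc lam r x ω S) : ω S < 0 := by
  obtain ⟨p, hp, hωp, -⟩ := h.exists_top
  have := h.ω_lt hp.1.le hp.2 le_rfl
  rwa [hωp] at this

end

section
open Set Filter Topology

variable {lam : ℝ} {r x ω : ℝ → ℝ} {S : ℝ}

/-- The radius of the cylinder, which is the geodesic of constant radius. -/
noncomputable def cylRadius (lam : ℝ) : ℝ := √(2 * (lam - 1))

theorem cylRadius_pos (hlam : 1 < lam) : 0 < cylRadius lam := sqrt_pos.mpr (by linarith)

theorem cylRadius_sq (hlam : 1 < lam) : cylRadius lam ^ 2 = 2 * (lam - 1) :=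
  sq_sqrt (by linarith)

theorem drift_eq (hlam : 1 < lam) {r : ℝ} (hr : 0 < r) :
    drift lam r = (cylRadius lam - r) * (cylRadius lam + r) / (2 * r) := by
  have := cylRadius_sq hlam
  unfold drift
  field_simp
  linarith

theorem le_drift (hlam : 1 < lam) {r : ℝ} (hr : 0 < r) (hrc : r ≤ cylRadius lam) :
    cylRadius lam - r ≤ drift lam r := by
  rw [drift_eq hlam hr, le_div_iff₀ (by linarith)]
  nlinarith

theorem drift_pos (hlam : 1 < lam) {r : ℝ} (hr : 0 < r) (hrc : r < cylRadius lam) :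
    0 < drift lam r := by linarith [le_drift hlam hr hrc.le]

theorem drift_le (hlam : 1 < lam) {r : ℝ} (hr : 0 < r) (hrc : cylRadius lam ≤ r) :
    drift lam r ≤ -((r - cylRadius lam) / 2) := by
  have := cylRadius_pos hlam
  rw [drift_eq hlam hr, div_le_iff₀ (by linarith)]
  nlinarith

theorem drift_nonpos (hlam : 1 < lam) {r : ℝ} (hr : 0 < r) (hrc : cylRadius lam ≤ r) :
    drift lam r ≤ 0 := by linarith [drift_le hlam hr hrc]

theorem Traj.hasDerivAt_cot (h : Traj lam r x ω) {t : ℝ} (hs : sin (ω t) ≠ 0) :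
    HasDerivAt (fun t => cos (ω t) / sin (ω t))
      (speed (r t) (x t) * curv lam (r t) (x t) (ω t) / sin (ω t) ^ 2) t := by
  refine ((h.hasDerivAt_cos t).div (h.hasDerivAt_sin t) hs).congr_deriv ?_
  congr 1
  linear_combination (speed (r t) (x t) * curv lam (r t) (x t) (ω t)) * sin_sq_add_cos_sq (ω t)

theorem Traj.hasDerivAt_gauss (h : Traj lam r x ω) (t : ℝ) :
    HasDerivAt (fun t => exp (-(x t ^ 2) / 4))
      (exp (-(x t ^ 2) / 4) * (-(x t / 2) * (speed (r t) (x t) * sin (ω t)))) t := by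
  refine (((h.hx t).fun_pow 2).fun_neg.div_const 4).exp.congr_deriv ?_
  norm_num
  ring

theorem Traj.hasDerivAt_height_aux (h : Traj lam r x ω) {t : ℝ} (hs : sin (ω t) ≠ 0) (ρ : ℝ) :
    HasDerivAt (fun t => exp (-(x t ^ 2) / 4) *
        (cos (ω t) / sin (ω t) * (1 - x t ^ 2 / 4) + x t / 2 * (r t - ρ)))
      (exp (-(x t ^ 2) / 4) * speed (r t) (x t) *
        ((1 - x t ^ 2 / 4) * (drift lam (r t) / sin (ω t) + x t * cos (ω t) ^ 3 /
          (2 * sin (ω t) ^ 2)) + sin (ω t) * (r t - ρ) / 2 * (1 - x t ^ 2 / 2))) t := by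
  refine ((h.hasDerivAt_gauss t).mul (((h.hasDerivAt_cot hs).mul
    (((h.hx t).fun_pow 2).div_const 4 |>.const_sub 1)).add
    (((h.hx t).div_const 2).mul ((h.hr t).sub_const ρ)))).congr_deriv ?_
  have hc : cos (ω t) ^ 3 = cos (ω t) * (1 - sin (ω t) ^ 2) := by rw [← cos_sq']; ring
  rw [curv_eq, hc]
  norm_num
  field_simp
  ring

theorem Arc.cylRadius_le_of_ascending (h : Arc lam r x ω S) {p t : ℝ} (hp : p ≤ S) (hωp : ω p = 0)
    (ht : 0 < t) (htp : t < p) (hx2 : x t = 2) : cylRadius lam ≤ r t := by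
  by_contra hlt
  push Not at hlt
  have hxmono : ∀ u ∈ Ioo 0 t, x u < 2 := fun u hu => by
    rw [← hx2]
    exact lt_of_hasDerivAt_pos hu.2 h.continuous_x.continuousOn (fun v _ => h.hx v) fun v hv =>
      mul_pos (h.speed_pos v) (h.sin_pos (hu.1.le.trans hv.1.le) hωp (hv.2.trans htp) hp)
  have hle := le_of_hasDerivAt_nonneg (p := 0) (q := t) (f := fun t => exp (-(x t ^ 2) / 4) *
        (cos (ω t) / sin (ω t) * (1 - x t ^ 2 / 4) + x t / 2 * (r t - cylRadius lam))) ht.le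
    (fun u hu => (h.hasDerivAt_height_aux
      (h.sin_pos hu.1 hωp (hu.2.trans_lt htp) hp).ne' _).continuousAt.continuousWithinAt)
    (fun u hu => h.hasDerivAt_height_aux
      (h.sin_pos hu.1.le hωp (hu.2.trans htp) hp).ne' _) (fun u hu => by
      have hs := h.sin_pos hu.1.le hωp (hu.2.trans htp) hp
      have hs1 := sin_le_one (ω u)
      have huS : u ∈ Ioo 0 S := ⟨hu.1, hu.2.trans (htp.trans_le hp)⟩
      have hc := h.cos_pos huS
      have hx0 := h.x_pos u huS
      have hx2 := hxmono u hu
      have hr := h.r_lt hu.1.le hu.2 (htp.le.trans hp)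
      have hd := le_drift h.lam_gt (h.pos u) (hr.trans hlt).le
      refine mul_nonneg (mul_nonneg (exp_pos _).le (h.speed_pos u).le) ?_
      have hv : 0 ≤ 1 - x u ^ 2 / 4 := by nlinarith
      have h1 : (cylRadius lam - r u) * sin (ω u) ≤ drift lam (r u) / sin (ω u) := by
        rw [le_div_iff₀ hs]
        nlinarith [mul_nonneg (show 0 ≤ cylRadius lam - r u by linarith)
          (show 0 ≤ 1 - sin (ω u) ^ 2 by nlinarith)]
      have h2 : 0 ≤ x u * cos (ω u) ^ 3 / (2 * sin (ω u) ^ 2) := by positivity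
      have h3 := mul_nonneg hv (sub_nonneg.mpr h1)
      have h4 := mul_nonneg hv h2
      have h5 : 0 ≤ sin (ω u) * (cylRadius lam - r u) := mul_nonneg hs.le (by linarith)
      nlinarith)
  have hE := exp_pos (-(2 : ℝ) ^ 2 / 4)
  simp only [h.x_zero, h.ω_zero, hx2, cos_pi_div_two] at hle
  norm_num at hle
  nlinarith [exp_pos (-(1 : ℝ))]

theorem Arc.x_le_two (h : Arc lam r x ω S) {t : ℝ} (ht : t ∈ Icc 0 S) : x t ≤ 2 := by
  obtain ⟨p, hp, hωp, -⟩ := h.exists_top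
  have hxp : x t ≤ x p := by
    rcases le_total t p with htp | htp
    · exact le_of_hasDerivAt_nonneg htp h.continuous_x.continuousOn (fun v _ => h.hx v) fun v hv =>
        mul_nonneg (h.speed_pos v).le (h.sin_pos (ht.1.trans hv.1.le) hωp hv.2 hp.2.le).le
    · have := le_of_hasDerivAt_nonneg (f := fun v => -x v) htp h.continuous_x.neg.continuousOn
        (fun v _ => (h.hx v).fun_neg) fun v hv => by
          have := h.sin_neg hp.1.le hωp hv.1 (hv.2.le.trans ht.2)
          nlinarith [h.speed_pos v]
      linarith
  by_contra hx2
  push Not at hx2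
  replace hx2 := hx2.trans_le hxp
  obtain ⟨t2, ht2, hxt2⟩ := intermediate_value_Icc hp.1.le h.continuous_x.continuousOn
    (show (2 : ℝ) ∈ Icc (x 0) (x p) from ⟨by rw [h.x_zero]; norm_num, hx2.le⟩)
  obtain ⟨t3, ht3, hxt3⟩ := intermediate_value_Icc' hp.2.le h.continuous_x.continuousOn
    (show (2 : ℝ) ∈ Icc (x S) (x p) from ⟨by rw [h.x_S]; norm_num, hx2.le⟩)
  have h20 : 0 < t2 := lt_of_le_of_ne ht2.1 fun he => by
    rw [← he, h.x_zero] at hxt2; norm_num at hxt2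
  have h2p : t2 < p := lt_of_le_of_ne ht2.2 fun he => by rw [he] at hxt2; linarith
  have h3p : p < t3 := lt_of_le_of_ne ht3.1 fun he => by rw [he] at hx2; linarith
  have h3S : t3 < S := lt_of_le_of_ne ht3.2 fun he => by
    rw [he, h.x_S] at hxt3; norm_num at hxt3
  have hrc := h.cylRadius_le_of_ascending hp.2.le hωp h20 h2p hxt2
  have hr23 := h.r_lt h20.le (h2p.trans h3p) h3S.le
  have hsn : ∀ u ∈ Icc t3 S, sin (ω u) < 0 := fun u hu =>
    h.sin_neg hp.1.le hωp (h3p.trans_le hu.1) hu.2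
  have hxmono : ∀ u ∈ Ioo t3 S, x u < 2 := fun u hu => by
    rw [← hxt3]
    have := lt_of_hasDerivAt_pos (f := fun v => -x v) hu.1 h.continuous_x.neg.continuousOn
      (fun v _ => (h.hx v).fun_neg) fun v hv => by
        have := hsn v ⟨hv.1.le, hv.2.le.trans hu.2.le⟩
        nlinarith [h.speed_pos v]
    linarith
  have hle := le_of_hasDerivAt_nonneg (p := t3) (q := S) (f := fun t => exp (-(x t ^ 2) / 4) *
        (cos (ω t) / sin (ω t) * (1 - x t ^ 2 / 4) + x t / 2 * (r t - cylRadius lam))) h3S.le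
    (fun u hu => (h.hasDerivAt_height_aux (hsn u hu).ne _).continuousAt.continuousWithinAt)
    (fun u hu => h.hasDerivAt_height_aux (hsn u ⟨hu.1.le, hu.2.le⟩).ne _) (fun u hu => by
      have hs := hsn u ⟨hu.1.le, hu.2.le⟩
      have hs1 := neg_one_le_sin (ω u)
      have huS : u ∈ Ioo 0 S := ⟨h20.trans (h2p.trans (h3p.trans hu.1)), hu.2⟩
      have hc := h.cos_pos huS
      have hx0 := h.x_pos u huS
      have hx2 := hxmono u hu
      have hr := h.r_lt (hp.1.le.trans ht3.1) hu.1 hu.2.le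
      have hd := drift_le h.lam_gt (h.pos u) (hrc.trans (hr23.trans hr).le)
      refine mul_nonneg (mul_nonneg (exp_pos _).le (h.speed_pos u).le) ?_
      have hv : 0 ≤ 1 - x u ^ 2 / 4 := by nlinarith
      have h1 : (r u - cylRadius lam) / 2 * (-sin (ω u)) ≤ drift lam (r u) / sin (ω u) := by
        rw [le_div_iff_of_neg hs]
        nlinarith [mul_nonneg (show 0 ≤ r u - cylRadius lam by linarith)
          (show 0 ≤ 1 - sin (ω u) ^ 2 by nlinarith)]
      have h2 : 0 ≤ x u * cos (ω u) ^ 3 / (2 * sin (ω u) ^ 2) := by positivity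
      have h3 := mul_nonneg hv (sub_nonneg.mpr h1)
      have h4 := mul_nonneg hv h2
      have h5 : 0 ≤ (-sin (ω u)) * (r u - cylRadius lam) := mul_nonneg (by linarith) (by linarith)
      nlinarith [mul_nonneg h5 (sq_nonneg (x u))])
  have hcS := h.cos_nonneg ⟨h.S_pos.le, le_rfl⟩
  have hsS := hsn S ⟨h3S.le, le_rfl⟩
  have hdiv := div_nonpos_of_nonneg_of_nonpos hcS hsS.le
  simp only [h.x_S, hxt3] at hle
  norm_num at hle
  nlinarith [exp_pos (-(1 : ℝ)), mul_pos (exp_pos (-(1 : ℝ)))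
    (show 0 < r t3 - cylRadius lam by linarith)]

end

section
open Set Filter Topology

variable {lam : ℝ}

theorem eventually_forall_pos {f : ℝ × ℝ → ℝ} (hf : Continuous f) {K : Set ℝ} (hK : IsCompact K)
    {a₀ : ℝ} (h : ∀ t ∈ K, 0 < f (a₀, t)) : ∀ᶠ a in 𝓝 a₀, ∀ t ∈ K, 0 < f (a, t) :=
  hK.eventually_forall_of_forall_eventually (P := fun a t => 0 < f (a, t)) fun t ht =>
    hf.continuousAt.eventually (lt_mem_nhds (h t ht))

theorem exists_eventually_forall_pos {f : ℝ × ℝ → ℝ} (hf : Continuous f) {a₀ t₀ : ℝ}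
    (h : 0 < f (a₀, t₀)) : ∃ ε > 0, ∀ᶠ a in 𝓝 a₀, ∀ t ∈ Icc (t₀ - ε) (t₀ + ε), 0 < f (a, t) := by
  have hc : Continuous fun t => f (a₀, t) := by fun_prop
  obtain ⟨ε, hε, hball⟩ := Metric.eventually_nhds_iff.mp (hc.continuousAt.eventually (lt_mem_nhds h))
  refine ⟨ε / 2, by positivity, eventually_forall_pos hf isCompact_Icc fun t ht => hball ?_⟩
  rw [Real.dist_eq, abs_lt]
  constructor <;> linarith [ht.1, ht.2]

/-- The distance to the axis of rotation along `orbit lam a`. -/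
noncomputable def rad (lam a t : ℝ) : ℝ := (orbit lam a t).1

/-- The height above the half-line `x = 0` along `orbit lam a`. -/
noncomputable def hgt (lam a t : ℝ) : ℝ := (orbit lam a t).2.1

/-- The tangent angle along `orbit lam a`. -/
noncomputable def ang (lam a t : ℝ) : ℝ := (orbit lam a t).2.2

theorem traj_rad {a : ℝ} (ha : 0 < a) : Traj lam (rad lam a) (hgt lam a) (ang lam a) :=
  traj_orbit ha

theorem continuous_rad (lam : ℝ) : Continuous fun p : ℝ × ℝ => rad lam p.1 p.2 :=
  (continuous_orbit lam).fst

theorem continuous_hgt (lam : ℝ) : Continuous fun p : ℝ × ℝ => hgt lam p.1 p.2 :=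
  (continuous_orbit lam).snd.fst

theorem continuous_ang (lam : ℝ) : Continuous fun p : ℝ × ℝ => ang lam p.1 p.2 :=
  (continuous_orbit lam).snd.snd

@[simp] theorem rad_zero (lam a : ℝ) : rad lam a 0 = a := by simp [rad, orbit_zero]

@[simp] theorem hgt_zero (lam a : ℝ) : hgt lam a 0 = 0 := by simp [hgt, orbit_zero]

@[simp] theorem ang_zero (lam a : ℝ) : ang lam a 0 = π / 2 := by simp [ang, orbit_zero]

theorem eventually_landing {a₀ S₀ : ℝ} (ha₀ : 0 < a₀) (hS₀ : 0 < S₀)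
    (hx : ∀ t ∈ Ioo 0 S₀, 0 < hgt lam a₀ t) (hxS : hgt lam a₀ S₀ = 0)
    (hs : sin (ang lam a₀ S₀) < 0) {η : ℝ} (hη : 0 < η) :
    ∀ᶠ a in 𝓝 a₀, ∃ S, 0 < S ∧ |S - S₀| < η ∧ (∀ t ∈ Ioo 0 S, 0 < hgt lam a t) ∧
      hgt lam a S = 0 := by
  have hcx := continuous_hgt lam
  have hcs : Continuous fun p : ℝ × ℝ => sin (ang lam p.1 p.2) :=
    continuous_sin.comp (continuous_ang lam)
  obtain ⟨ε₁, hε₁, h1⟩ := exists_eventually_forall_pos hcs (a₀ := a₀) (t₀ := 0) (by simp)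
  obtain ⟨ε₂, hε₂, h2⟩ := exists_eventually_forall_pos hcs.neg (a₀ := a₀) (t₀ := S₀)
    (by simpa using hs)
  obtain ⟨e, he, heη, heε, heS⟩ : ∃ e > 0, e < η ∧ e ≤ ε₂ ∧ e < S₀ :=
    ⟨min (η / 2) (min ε₂ (S₀ / 2)), by positivity,
      (min_le_left _ _).trans_lt (by linarith), (min_le_right _ _).trans (min_le_left _ _),
      ((min_le_right _ _).trans (min_le_right _ _)).trans_lt (by linarith)⟩
  have hdec : ∀ a, 0 < a → (∀ t ∈ Icc (S₀ - ε₂) (S₀ + ε₂), 0 < -sin (ang lam a t)) →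
      ∀ p q, S₀ - e ≤ p → p < q → q ≤ S₀ + e → hgt lam a q < hgt lam a p := by
    intro a ha hsin p q hp hpq hq
    have := lt_of_hasDerivAt_pos (f := fun v => -hgt lam a v) hpq
      (traj_rad ha).continuous_x.neg.continuousOn (fun v _ => ((traj_rad ha).hx v).fun_neg)
      fun v hv => by
        have h3 := hsin v ⟨by linarith [hv.1], by linarith [hv.2]⟩
        have h4 := mul_pos ((traj_rad (lam := lam) ha).speed_pos v) h3
        linarith
    linarith
  have h2' := h2.self_of_nhds
  have h3 : ∀ᶠ a in 𝓝 a₀, ∀ t ∈ Icc (min ε₁ (S₀ - e)) (S₀ - e), 0 < hgt lam a t :=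
    eventually_forall_pos hcx isCompact_Icc fun t ht =>
      hx t ⟨(lt_min hε₁ (by linarith)).trans_le ht.1, by linarith [ht.2]⟩
  have hneg := hdec a₀ ha₀ h2' S₀ (S₀ + e) (by linarith) (by linarith) le_rfl
  rw [hxS] at hneg
  have h4 : ∀ᶠ a in 𝓝 a₀, hgt lam a (S₀ + e) < 0 := by
    have hc : Continuous fun a => hgt lam a (S₀ + e) := hcx.comp (by fun_prop : Continuous fun a : ℝ => (a, S₀ + e))
    exact hc.continuousAt.eventually (gt_mem_nhds hneg)
  filter_upwards [h1, h2, h3, h4, lt_mem_nhds ha₀] with a h1 h2 h3 h4 ha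
  have hT := traj_rad (lam := lam) ha
  have hp1 : 0 < hgt lam a (S₀ - e) := h3 _ ⟨min_le_right _ _, le_rfl⟩
  obtain ⟨S, hS, hS0⟩ := intermediate_value_Icc' (by linarith) hT.continuous_x.continuousOn
    (show (0 : ℝ) ∈ Icc (hgt lam a (S₀ + e)) (hgt lam a (S₀ - e)) from ⟨h4.le, hp1.le⟩)
  have hSpos : 0 < S := by linarith [hS.1]
  refine ⟨S, hSpos, abs_lt.mpr ⟨by linarith [hS.1], by linarith [hS.2]⟩, fun t ht => ?_, hS0⟩
  rcases lt_or_ge t (min ε₁ (S₀ - e)) with hlt | hge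
  · have := lt_of_hasDerivAt_pos ht.1 hT.continuous_x.continuousOn (fun v _ => hT.hx v) fun v hv =>
      mul_pos (hT.speed_pos v) (h1 v ⟨by linarith [hv.1],
        by linarith [hv.2, min_le_left ε₁ (S₀ - e)]⟩)
    rwa [hgt_zero] at this
  · rcases le_or_gt t (S₀ - e) with hle | hgt'
    · exact h3 t ⟨hge, hle⟩
    · rw [← hS0]
      exact hdec a ha h2 t S hgt'.le ht.2 hS.2

/-- The orbit starting at distance `a` from the axis returns to the half-line at time `S`, with
tangent angle in the open interval `(-π/2, 0)`. -/
def Lands (lam a S : ℝ) : Prop :=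
  0 < a ∧ Arc lam (rad lam a) (hgt lam a) (ang lam a) S ∧ -(π / 2) < ang lam a S

theorem Lands.eventually {a₀ S₀ : ℝ} (h : Lands lam a₀ S₀) {η : ℝ} (hη : 0 < η) :
    ∀ᶠ a in 𝓝 a₀, ∃ S, |S - S₀| < η ∧ Lands lam a S := by
  obtain ⟨ha₀, hA, hend⟩ := h
  have hca := continuous_ang lam
  have hcf : Continuous fun p : ℝ × ℝ => -(field lam (orbit lam p.1 p.2)).2.2 :=
    ((contDiff_field (n := 1) lam).continuous.comp (continuous_orbit lam)).snd.snd.neg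
  have hfe : ∀ a, 0 < a → ∀ t, (field lam (orbit lam a t)).2.2 =
      -(speed (rad lam a t) (hgt lam a t) * curv lam (rad lam a t) (hgt lam a t) (ang lam a t)) :=
    fun a ha t => congrArg (fun y => y.2.2) (field_eq ((traj_rad (lam := lam) ha).pos t).ne')
  obtain ⟨ε₁, hε₁, h1⟩ := exists_eventually_forall_pos hcf (a₀ := a₀) (t₀ := 0) (by
    simp only [hfe a₀ ha₀, neg_neg]
    exact mul_pos (hA.speed_pos 0) (hA.curv_pos ⟨le_rfl, hA.S_pos.le⟩))
  obtain ⟨ε₂, hε₂, h2⟩ := exists_eventually_forall_pos (f := fun p => π / 2 + ang lam p.1 p.2)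
    (by fun_prop) (a₀ := a₀) (t₀ := S₀) (by simpa using by linarith)
  obtain ⟨ε₃, hε₃, h3⟩ := exists_eventually_forall_pos (f := fun p => π / 2 - ang lam p.1 p.2)
    (by fun_prop) (a₀ := a₀) (t₀ := S₀) (by simpa using by linarith [hA.ω_S_neg, pi_pos])
  obtain ⟨η', hη', hη1, hη2, hη3⟩ : ∃ η' > 0, η' ≤ η ∧ η' ≤ ε₂ ∧ η' ≤ ε₃ :=
    ⟨min η (min ε₂ ε₃), by positivity, min_le_left _ _,
      (min_le_right _ _).trans (min_le_left _ _), (min_le_right _ _).trans (min_le_right _ _)⟩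
  have hland := eventually_landing ha₀ hA.S_pos hA.x_pos hA.x_S
    (sin_neg_of_neg_of_neg_pi_lt hA.ω_S_neg (by linarith [pi_pos])) hη'
  have h4 : ∀ᶠ a in 𝓝 a₀, ∀ t ∈ Icc 0 S₀, 0 < π / 2 + ang lam a t :=
    eventually_forall_pos (f := fun p => π / 2 + ang lam p.1 p.2) (by fun_prop) isCompact_Icc
      fun t ht => by
        rcases ht.2.eq_or_lt with rfl | hlt
        · simpa using by linarith
        · have := hA.ω_lt ht.1 hlt le_rfl
          simpa using by linarith
  have h5 : ∀ᶠ a in 𝓝 a₀, ∀ t ∈ Icc ε₁ S₀, 0 < π / 2 - ang lam a t :=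
    eventually_forall_pos (f := fun p => π / 2 - ang lam p.1 p.2) (by fun_prop) isCompact_Icc
      fun t ht => by
        have := hA.ω_lt le_rfl (hε₁.trans_le ht.1) ht.2
        rw [ang_zero] at this
        simpa using by linarith
  filter_upwards [h1, h2, h3, h4, h5, hland, lt_mem_nhds ha₀] with a h1 h2 h3 h4 h5 hland ha
  obtain ⟨S, hS, hSd, hxp, hxS⟩ := hland
  rw [abs_lt] at hSd
  have hT := traj_rad (lam := lam) ha
  have hlow : ∀ t ∈ Icc 0 S, -(π / 2) < ang lam a t := fun t ht => by
    rcases le_total t S₀ with hle | hge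
    · linarith [h4 t ⟨ht.1, hle⟩]
    · linarith [h2 t ⟨by linarith, by linarith [ht.2]⟩]
  refine ⟨S, abs_lt.mpr ⟨by linarith, by linarith⟩, ha, ⟨hT, hA.lam_gt, hS, hgt_zero _ _,
    ang_zero _ _, hxS, hxp, fun t ht => ⟨(hlow t ht).le, ?_⟩⟩, hlow S ⟨hS.le, le_rfl⟩⟩
  rcases le_total t ε₁ with hle | hge
  · rw [← ang_zero lam a]
    refine hT.le_of_curv_nonneg ht.1 fun v hv => ?_
    have h6 := h1 v ⟨by linarith [hv.1], by linarith [hv.2]⟩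
    simp only [hfe a ha, neg_neg] at h6
    exact (pos_of_mul_pos_right h6 (hT.speed_pos v).le).le
  · rcases le_total t S₀ with hle | hge'
    · linarith [h5 t ⟨hge, hle⟩]
    · linarith [h3 t ⟨by linarith, by linarith [ht.2]⟩]

end

section
open Set Filter Topology

variable {lam : ℝ} {r x ω : ℝ → ℝ}

theorem Traj.hasDerivAt_tan (h : Traj lam r x ω) {t : ℝ} (hc : cos (ω t) ≠ 0) :
    HasDerivAt (fun t => tan (ω t))
      (-(speed (r t) (x t) * curv lam (r t) (x t) (ω t) / cos (ω t) ^ 2)) t :=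
  ((Real.hasDerivAt_tan hc).comp t (h.hω t)).congr_deriv (by ring)

/-- The height of the intersection of the tangent line with the axis of rotation. -/
theorem Traj.hasDerivAt_intercept (h : Traj lam r x ω) {t : ℝ} (hc : cos (ω t) ≠ 0) :
    HasDerivAt (fun t => x t - r t * tan (ω t))
      (speed (r t) (x t) * (r t * curv lam (r t) (x t) (ω t) / cos (ω t) ^ 2)) t := by
  refine ((h.hx t).sub ((h.hr t).mul (h.hasDerivAt_tan hc))).congr_deriv ?_
  rw [tan_eq_sin_div_cos]
  field_simp
  ring

theorem curv_eq_intercept {r x ω : ℝ} (hr : r ≠ 0) (hc : cos ω ≠ 0) :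
    curv lam r x ω = (lam - 1) * sin ω / r + cos ω / 2 * (x - r * tan ω) := by
  rw [tan_eq_sin_div_cos]
  unfold curv
  field_simp
  ring

theorem Traj.not_bounded (h : Traj lam r x ω) {X : ℝ} (hx : ∀ t, 0 ≤ t → x t ∈ Icc 0 X)
    (hω : ∀ t, 0 ≤ t → ω t ∈ Icc (-(π / 2)) (π / 2)) {f f' : ℝ → ℝ} {t₀ k B : ℝ} (ht₀ : 0 ≤ t₀)
    (hk : 0 < k) (hd : ∀ t, t₀ ≤ t → HasDerivAt f (f' t) t)
    (hf' : ∀ t, t₀ ≤ t → k * speed (r t) (x t) ≤ f' t) (hB : ∀ t, t₀ ≤ t → f t ≤ B) : False := by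
  set M := 1 + r 0 ^ 2 + X ^ 2 with hM
  have hMpos : 0 < M := by positivity
  have hra : ∀ t, 0 ≤ t → r 0 ≤ r t := fun t ht =>
    le_of_hasDerivAt_nonneg ht h.continuous_r.continuousOn (fun v _ => h.hr v) fun v hv =>
      mul_nonneg (h.speed_pos v).le (Real.cos_nonneg_of_mem_Icc (hω v hv.1.le))
  have hr2 : ∀ t, 0 ≤ t → r t ^ 2 ≤ r 0 ^ 2 + 2 * t := fun t ht => by
    have := le_of_hasDerivAt_nonneg (f := fun t => 2 * t - r t ^ 2) ht
      (by have := h.continuous_r; fun_prop)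
      (fun v _ => ((hasDerivAt_id v).const_mul 2).fun_sub ((h.hr v).fun_pow 2)) fun v hv => by
        have h1 : r v * (speed (r v) (x v) * cos (ω v)) ≤ 1 := by
          unfold speed
          rw [show r v * (r v / (1 + r v ^ 2 + x v ^ 2) * cos (ω v)) =
            r v ^ 2 * cos (ω v) / (1 + r v ^ 2 + x v ^ 2) by ring, div_le_one (by positivity)]
          nlinarith [cos_le_one (ω v), sq_nonneg (r v), sq_nonneg (x v)]
        norm_num
        linarith
    linarith
  have hsp : ∀ t, 0 ≤ t → r 0 / (M + 2 * t) ≤ speed (r t) (x t) := fun t ht => by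
    have h1 := hx t ht
    unfold speed
    refine div_le_div₀ (h.pos t).le (hra t ht) (by positivity) ?_
    nlinarith [hr2 t ht, h1.1, h1.2]
  set A : ℝ → ℝ := fun t => k * (r 0 / 2) * log (M + 2 * t) with hA
  have hAd : ∀ t, 0 ≤ t → HasDerivAt A (k * (r 0 / (M + 2 * t))) t := fun t ht => by
    have hne : M + 2 * t ≠ 0 := by positivity
    refine (((((hasDerivAt_id t).const_mul 2).const_add M).log hne).const_mul
      (k * (r 0 / 2))).congr_deriv ?_
    simp only [id]
    field_simp
  have hmono : ∀ t, t₀ ≤ t → A t ≤ A t₀ + (B - f t₀) := fun t ht => by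
    have := le_of_hasDerivAt_nonneg (f := fun t => f t - A t) ht
      (fun v hv => ((hd v hv.1).fun_sub (hAd v (ht₀.trans hv.1))).continuousAt.continuousWithinAt)
      (fun v hv => (hd v hv.1.le).fun_sub (hAd v (ht₀.trans hv.1.le))) fun v hv => by
        have := mul_le_mul_of_nonneg_left (hsp v (ht₀.trans hv.1.le)) hk.le
        linarith [hf' v hv.1.le]
    linarith [hB t ht]
  have hlim : Tendsto A atTop atTop := by
    refine Tendsto.const_mul_atTop (mul_pos hk (half_pos (h.pos 0))) (tendsto_log_atTop.comp ?_)
    exact tendsto_atTop_add_const_left _ _ (tendsto_id.const_mul_atTop two_pos)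
  obtain ⟨t, ht1, ht2⟩ := ((hlim.eventually_gt_atTop (A t₀ + (B - f t₀))).and
    (eventually_ge_atTop t₀)).exists
  exact absurd (hmono t ht2) (not_le.mpr ht1)

/-- A convex orbit of bounded height cannot avoid both the half-line and the vertical direction
forever. -/
theorem Traj.not_eternal (h : Traj lam r x ω) (hlam : 1 < lam) (hx0 : x 0 = 0) (hω0 : ω 0 = π / 2)
    (hk0 : 0 < curv lam (r 0) (x 0) (ω 0)) {X : ℝ} (hx : ∀ t, 0 ≤ t → x t ∈ Icc 0 X)
    (hω : ∀ t, 0 ≤ t → ω t ∈ Icc (-(π / 2)) (π / 2))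
    (hk : ∀ t, 0 ≤ t → 0 ≤ curv lam (r t) (x t) (ω t)) : False := by
  have hanti : ∀ s t, 0 ≤ s → s ≤ t → ω t ≤ ω s := fun s t hs hst =>
    h.le_of_curv_nonneg hst fun v hv => hk v (hs.trans hv.1.le)
  by_cases hneg : ∃ t₀, 0 ≤ t₀ ∧ ω t₀ < 0
  · obtain ⟨t₀, ht₀, hlt⟩ := hneg
    have hs : sin (ω t₀) < 0 := sin_neg_of_neg_of_neg_pi_lt hlt
      (by linarith [(hω t₀ ht₀).1, pi_pos])
    refine h.not_bounded hx hω ht₀ (neg_pos.mpr hs) (fun t _ => (h.hx t).fun_neg) (fun t ht => ?_)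
      (B := 0) (fun t ht => by linarith [(hx t (ht₀.trans ht)).1])
    have := sin_le_sin_of_le_of_le_pi_div_two (hω t (ht₀.trans ht)).1 (hω t₀ ht₀).2
      (hanti _ _ ht₀ ht)
    nlinarith [h.speed_pos t]
  push Not at hneg
  obtain ⟨ε, hε, hball⟩ := Metric.eventually_nhds_iff.mp
    ((h.continuous_curv.continuousAt.eventually (lt_mem_nhds hk0)).and
    ((continuous_sin.comp h.continuous_ω).continuousAt.eventually
      (lt_mem_nhds (show 0 < sin (ω 0) by rw [hω0]; simp))))
  set t₁ := ε / 2 with ht₁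
  have ht₁pos : 0 < t₁ := by positivity
  have hnear : ∀ v ∈ Ioo 0 t₁, dist v 0 < ε := fun v hv => by
    rw [Real.dist_eq, sub_zero, abs_of_pos hv.1]; linarith [hv.2]
  have hω1 : ω t₁ < π / 2 := hω0 ▸ h.lt_of_curv_pos ht₁pos fun v hv => (hball (hnear v hv)).1
  have hx1 : 0 < x t₁ := hx0 ▸ lt_of_hasDerivAt_pos ht₁pos h.continuous_x.continuousOn
    (fun v _ => h.hx v) fun v hv => mul_pos (h.speed_pos v) (hball (hnear v hv)).2
  have hω1' := hneg t₁ ht₁pos.le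
  set m := cos (ω t₁) with hm
  have hmpos : 0 < m := Real.cos_pos_of_mem_Ioo ⟨by linarith [pi_pos], hω1⟩
  have hcm : ∀ t, t₁ ≤ t → m ≤ cos (ω t) := fun t ht =>
    cos_le_cos_of_nonneg_of_le_pi (hneg t (ht₁pos.le.trans ht)) (by linarith [pi_pos])
      (hanti _ _ ht₁pos.le ht)
  have hcpos : ∀ t, t₁ ≤ t → 0 < cos (ω t) := fun t ht => hmpos.trans_le (hcm t ht)
  have hsn : ∀ t, t₁ ≤ t → 0 ≤ sin (ω t) := fun t ht => by
    have ht' := ht₁pos.le.trans ht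
    exact sin_nonneg_of_nonneg_of_le_pi (hneg t ht') (by linarith [(hω t ht').2, pi_pos])
  have htn : ∀ t, t₁ ≤ t → 0 ≤ tan (ω t) := fun t ht => by
    rw [tan_eq_sin_div_cos]; exact div_nonneg (hsn t ht) (hcpos t ht).le
  have hrun : ∀ B, (∀ t, t₁ ≤ t → r t ≤ B) → False := fun B hB =>
    h.not_bounded hx hω ht₁pos.le hmpos (fun t _ => h.hr t) (fun t ht => by
      rw [mul_comm]; exact mul_le_mul_of_nonneg_left (hcm t ht) (h.speed_pos t).le) hB
  have hra : ∀ t, t₁ ≤ t → r t₁ ≤ r t := fun t ht =>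
    le_of_hasDerivAt_nonneg ht h.continuous_r.continuousOn (fun v _ => h.hr v) fun v hv =>
      mul_nonneg (h.speed_pos v).le (hcpos v hv.1.le).le
  have hD := fun t (ht : t₁ ≤ t) => h.hasDerivAt_intercept (hcpos t ht).ne'
  by_cases hDp : ∃ t₀, t₁ ≤ t₀ ∧ 0 < x t₀ - r t₀ * tan (ω t₀)
  · obtain ⟨t₀, ht₀, hpos⟩ := hDp
    have hDmono : ∀ t, t₀ ≤ t → x t₀ - r t₀ * tan (ω t₀) ≤ x t - r t * tan (ω t) := fun t ht =>
      le_of_hasDerivAt_nonneg (f := fun t => x t - r t * tan (ω t)) ht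
        (fun v hv => (hD v (ht₀.trans hv.1)).continuousAt.continuousWithinAt)
        (fun v hv => hD v (ht₀.trans hv.1.le)) fun v hv => by
          have h1 := hk v ((ht₁pos.le.trans ht₀).trans hv.1.le)
          have h2 := h.pos v
          have h3 := h.speed_pos v
          positivity
    refine h.not_bounded hx hω (ht₁pos.le.trans ht₀)
      (mul_pos (h.pos t₁) (half_pos hpos)) (fun t ht => hD t (ht₀.trans ht))
      (fun t ht => ?_) (B := X) fun t ht => ?_
    · have ht' := ht₀.trans ht
      have hc := hcpos t ht'
      rw [mul_comm]
      refine mul_le_mul_of_nonneg_left ?_ (h.speed_pos t).le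
      rw [le_div_iff₀ (by positivity), curv_eq_intercept (h.pos t).ne' hc.ne']
      have h1 := hDmono t ht
      have h2 := hra t ht'
      have h3 : 0 ≤ (lam - 1) * sin (ω t) / r t :=
        div_nonneg (mul_nonneg (by linarith) (hsn t ht')) (h.pos t).le
      set d := x t₀ - r t₀ * tan (ω t₀)
      set D := x t - r t * tan (ω t)
      have h4 : d / 2 * cos (ω t) ^ 2 ≤ cos (ω t) / 2 * D := by
        have : cos (ω t) ^ 2 ≤ cos (ω t) := by nlinarith [cos_le_one (ω t)]
        nlinarith
      calc r t₁ * (d / 2) * cos (ω t) ^ 2 = r t₁ * (d / 2 * cos (ω t) ^ 2) := by ring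
        _ ≤ r t * ((lam - 1) * sin (ω t) / r t + cos (ω t) / 2 * D) :=
          mul_le_mul h2 (by linarith) (by positivity) (h.pos t).le
    · have := mul_nonneg (h.pos t).le (htn t (ht₀.trans ht))
      linarith [(hx t ((ht₁pos.le.trans ht₀).trans ht)).2]
  · push Not at hDp
    have hq : ∀ t, t₁ ≤ t → x t₁ / r t₁ ≤ x t / r t := fun t ht =>
      le_of_hasDerivAt_nonneg (f := fun t => x t / r t) ht
        (h.continuous_x.div h.continuous_r fun t => (h.pos t).ne').continuousOn
        (fun v _ => (h.hx v).fun_div (h.hr v) (h.pos v).ne') fun v hv => by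
          have h1 := hDp v hv.1.le
          have hc := hcpos v hv.1.le
          rw [tan_eq_sin_div_cos, sub_nonpos, mul_div_assoc', le_div_iff₀ hc] at h1
          refine div_nonneg ?_ (sq_nonneg _)
          nlinarith [h.speed_pos v]
    refine hrun (X * r t₁ / x t₁) fun t ht => ?_
    have h1 := hq t ht
    rw [div_le_div_iff₀ (h.pos _) (h.pos _)] at h1
    rw [le_div_iff₀ hx1]
    nlinarith [(hx t (ht₁pos.le.trans ht)).2, h.pos t₁]

end

section
open Set Filter Topology
open scoped NNReal

variable {lam : ℝ}

/-- The rate at which the tangent angle decreases along `orbit lam a`. -/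
noncomputable def bend (lam a t : ℝ) : ℝ := -(field lam (orbit lam a t)).2.2

theorem continuous_bend (lam : ℝ) : Continuous fun p : ℝ × ℝ => bend lam p.1 p.2 :=
  ((contDiff_field (n := 1) lam).continuous.comp (continuous_orbit lam)).snd.snd.neg

theorem bend_eq {a : ℝ} (ha : 0 < a) (t : ℝ) : bend lam a t =
    speed (rad lam a t) (hgt lam a t) * curv lam (rad lam a t) (hgt lam a t) (ang lam a t) := by
  have := congrArg (fun y => y.2.2) (field_eq (lam := lam) (x := hgt lam a t) (ω := ang lam a t)
    ((traj_rad (lam := lam) ha).pos t).ne')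
  rw [bend]
  exact neg_eq_iff_eq_neg.mpr this

theorem Arc.start_lt {r x ω : ℝ → ℝ} {S : ℝ} (h : Arc lam r x ω S) : r 0 < cylRadius lam := by
  have h1 := h.curv_pos ⟨le_rfl, h.S_pos.le⟩
  rw [h.ω_zero, h.x_zero, curv_eq] at h1
  simp only [sin_pi_div_two, mul_one, zero_div, zero_mul, add_zero] at h1
  by_contra hge
  push Not at hge
  linarith [drift_nonpos h.lam_gt (h.pos 0) hge]

theorem Lands.lt_cylRadius {a S : ℝ} (h : Lands lam a S) : a < cylRadius lam := by
  simpa using h.2.1.start_lt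

theorem ang_cylRadius (hlam : 1 < lam) (t : ℝ) : ang lam (cylRadius lam) t = π / 2 := by
  have hpos := cylRadius_pos hlam
  obtain ⟨K, hK, hL⟩ := exists_field_bounds lam
  set G : ℝ → ℝ := fun x => (field lam (cylRadius lam, x, π / 2)).2.1 with hG
  have hGK : LipschitzWith K G := by
    refine LipschitzWith.of_dist_le_mul fun x y => ?_
    have h1 := hK.dist_le_mul (cylRadius lam, x, π / 2) (cylRadius lam, y, π / 2)
    simp only [Prod.dist_eq, dist_self] at h1
    simp only [dist_nonneg, max_eq_left, max_eq_right] at h1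
    exact (le_max_left _ _).trans ((le_max_right _ _).trans h1)
  have hGL : ∀ x, ‖G x‖ ≤ K := fun x =>
    ((norm_fst_le _).trans (norm_snd_le _)).trans (hL (cylRadius lam, x, π / 2))
  obtain ⟨X, hX0, hX⟩ := exists_global_solution hGK hGL 0
  have hd0 : drift lam (cylRadius lam) = 0 := by rw [drift_eq hlam hpos]; simp
  have hf : ∀ t, HasDerivAt (fun t => (cylRadius lam, X t, π / 2))
      (field lam (cylRadius lam, X t, π / 2)) t := fun t => by
    have h2 := hX t
    simp only [hG, field_eq (lam := lam) (x := X t) (ω := π / 2) hpos.ne'] at h2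
    rw [field_eq hpos.ne']
    refine ((hasDerivAt_const t (cylRadius lam)).prodMk (h2.prodMk (hasDerivAt_const t (π / 2)))).congr_deriv ?_
    rw [curv_eq, hd0]
    simp
  exact ((traj_rad hpos).eq_of_eq_at (traj_of_solution hf hpos) (t₀ := 0) (by simp)
    (by simpa using hX0.symm) (by simp) t).2.2

theorem tendsto_uncurry {f : ℝ × ℝ → ℝ} (hf : Continuous f) {l : Filter ℝ} {a : ℝ} (hl : l ≤ 𝓝 a)
    (t : ℝ) : Tendsto (fun v => f (v, t)) l (𝓝 (f (a, t))) := by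
  have hc : Continuous fun v => f (v, t) := by fun_prop
  exact hc.continuousAt.mono_left hl

theorem limit_props {l : Filter ℝ} [l.NeBot] {a t : ℝ} (ha : 0 < a) (hl : l ≤ 𝓝 a) {T : ℝ → ℝ}
    (hT : ∀ᶠ v in l, 0 < v ∧ Lands lam v (T v)) (ht0 : 0 ≤ t) (ht : ∀ᶠ v in l, t < T v) :
    hgt lam a t ∈ Icc 0 2 ∧ ang lam a t ∈ Icc (-(π / 2)) (π / 2) ∧
      0 ≤ curv lam (rad lam a t) (hgt lam a t) (ang lam a t) := by
  have h1 := tendsto_uncurry (continuous_hgt lam) hl t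
  have h2 := tendsto_uncurry (continuous_ang lam) hl t
  have h3 := tendsto_uncurry (continuous_bend lam) hl t
  refine ⟨isClosed_Icc.mem_of_tendsto h1 ?_, isClosed_Icc.mem_of_tendsto h2 ?_, ?_⟩
  · filter_upwards [hT, ht] with v hv htv
    have hA := hv.2.2.1
    refine ⟨?_, hA.x_le_two ⟨ht0, htv.le⟩⟩
    rcases ht0.eq_or_lt with rfl | hlt
    · simp
    · exact (hA.x_pos t ⟨hlt, htv⟩).le
  · filter_upwards [hT, ht] with v hv htv
    exact hv.2.2.1.ω_mem t ⟨ht0, htv.le⟩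
  · have h4 : 0 ≤ bend lam a t := by
      refine ge_of_tendsto h3 ?_
      filter_upwards [hT, ht] with v hv htv
      rw [bend_eq hv.1]
      exact mul_nonneg (hv.2.2.1.speed_pos t).le (hv.2.2.1.curv_pos ⟨ht0, htv.le⟩).le
    rw [bend_eq ha] at h4
    exact nonneg_of_mul_nonneg_right h4 ((traj_rad (lam := lam) ha).speed_pos t)

theorem exists_arc_of_limit (hlam : 1 < lam) {l : Filter ℝ} [l.NeBot] {a : ℝ} (ha : 0 < a)
    (hl : l ≤ 𝓝 a) {T : ℝ → ℝ} (hT : ∀ᶠ v in l, 0 < v ∧ Lands lam v (T v)) {S : ℝ}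
    (hS : Tendsto T l (𝓝 S)) : Arc lam (rad lam a) (hgt lam a) (ang lam a) S := by
  have hcs : Continuous fun p : ℝ × ℝ => sin (ang lam p.1 p.2) :=
    continuous_sin.comp (continuous_ang lam)
  obtain ⟨ε, hε, h1⟩ := exists_eventually_forall_pos hcs (a₀ := a) (t₀ := 0) (by simp)
  have hnear : ∀ v, 0 < v → (∀ t ∈ Icc (0 - ε) (0 + ε), 0 < sin (ang lam v t)) →
      ∀ t, 0 < t → t ≤ ε → 0 < hgt lam v t := fun v hv hsin t ht0 ht => by
    have := lt_of_hasDerivAt_pos ht0 (traj_rad hv).continuous_x.continuousOn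
      (fun u _ => (traj_rad (lam := lam) hv).hx u) fun u hu => mul_pos ((traj_rad hv).speed_pos u)
        (hsin u ⟨by linarith [hu.1], by linarith [hu.2]⟩)
    rwa [hgt_zero] at this
  have hSε : ε ≤ S := by
    refine ge_of_tendsto hS ?_
    filter_upwards [hT, hl h1] with v hv hsin
    by_contra hlt
    push Not at hlt
    exact (hnear v hv.1 hsin _ hv.2.2.1.S_pos hlt.le).ne' hv.2.2.1.x_S
  have hSpos := hε.trans_le hSε
  have hP := fun t (ht : t ∈ Ico 0 S) => limit_props (lam := lam) ha hl hT ht.1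
    (hS.eventually (lt_mem_nhds ht.2))
  have hTr := traj_rad (lam := lam) ha
  have hclos : Icc 0 S ⊆ closure (Ico 0 S) := by rw [closure_Ico hSpos.ne]
  have hωmem : ∀ t ∈ Icc 0 S, ang lam a t ∈ Icc (-(π / 2)) (π / 2) := fun t ht =>
    closure_minimal (fun u hu => (hP u hu).2.1)
      (isClosed_Icc.preimage hTr.continuous_ω) (hclos ht)
  have hxS : hgt lam a S = 0 := by
    have h2 : Tendsto (fun v => hgt lam v (T v)) l (𝓝 (hgt lam a S)) :=
      ((continuous_hgt lam).tendsto (a, S)).comp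
        ((show Tendsto (fun v : ℝ => v) l (𝓝 a) from hl).prodMk_nhds hS)
    refine tendsto_nhds_unique h2 (tendsto_const_nhds.congr' ?_)
    filter_upwards [hT] with v hv
    exact hv.2.2.1.x_S.symm
  refine ⟨hTr, hlam, hSpos, hgt_zero _ _, ang_zero _ _, hxS, fun t ht => ?_, hωmem⟩
  refine lt_of_le_of_ne (hP t ⟨ht.1.le, ht.2⟩).1.1 fun h0 => ?_
  have hmin : IsLocalMin (hgt lam a) t := by
    filter_upwards [Ioo_mem_nhds ht.1 ht.2] with u hu
    rw [← h0]
    exact (hP u ⟨hu.1.le, hu.2⟩).1.1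
  have hsin : sin (ang lam a t) = 0 :=
    (mul_eq_zero.mp (hmin.hasDerivAt_eq_zero (hTr.hx t))).resolve_left (hTr.speed_pos t).ne'
  have hm := hωmem t ⟨ht.1.le, ht.2.le⟩
  have hω0 : ang lam a t = 0 := (sin_eq_zero_iff_of_lt_of_lt (by linarith [hm.1, pi_pos])
    (by linarith [hm.2, pi_pos])).mp hsin
  have hmono := le_of_hasDerivAt_nonneg (min_le_left t ε) hTr.continuous_x.continuousOn
    (fun u _ => hTr.hx u) fun u hu => by
      have hu0 : 0 < u := (lt_min ht.1 hε).trans hu.1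
      have h3 := hTr.le_of_curv_nonneg hu.2.le fun w hw =>
        (hP w ⟨(hu0.trans hw.1).le, hw.2.trans ht.2⟩).2.2
      have h4 := (hωmem u ⟨hu0.le, (hu.2.trans ht.2).le⟩).2
      refine mul_nonneg (hTr.speed_pos u).le (sin_nonneg_of_nonneg_of_le_pi ?_ ?_)
      · linarith
      · linarith [pi_pos]
  have := hnear a ha h1.self_of_nhds (min t ε) (lt_min ht.1 hε) (min_le_right _ _)
  linarith

/-- At the end of an interval of starting points whose orbits land, the orbit returns to the
half-line orthogonally. -/
theorem exists_orthogonal_arc (hlam : 1 < lam) {a : ℝ} (ha : 0 < a)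
    (hgood : ∀ v ∈ Ioo 0 a, ∃ S, Lands lam v S) (hbad : ¬ ∃ S, Lands lam a S) :
    ∃ S, Arc lam (rad lam a) (hgt lam a) (ang lam a) S ∧ ang lam a S = -(π / 2) := by
  choose! T hT using hgood
  have hT' : ∀ᶠ v in 𝓝[<] a, 0 < v ∧ Lands lam v (T v) := by
    filter_upwards [Ioo_mem_nhdsLT ha] with v hv using ⟨hv.1, hT v hv⟩
  by_cases hbdd : ∃ M, ∃ᶠ v in 𝓝[<] a, T v ≤ M
  · obtain ⟨M, hM⟩ := hbdd
    have hM' : ∃ᶠ v in 𝓝[<] a, T v ∈ Icc 0 M :=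
      (hM.and_eventually hT').mono fun v hv => ⟨hv.2.2.2.1.S_pos.le, hv.1⟩
    obtain ⟨S, -, hS⟩ := isCompact_Icc.exists_mapClusterPt_of_frequently hM'
    obtain ⟨U, hU, hUS⟩ := mapClusterPt_iff_ultrafilter.mp hS
    have hA := exists_arc_of_limit hlam (l := U) ha (hU.trans nhdsWithin_le_nhds) (hU hT') hUS
    refine ⟨S, hA, le_antisymm ?_ (hA.ω_mem S ⟨hA.S_pos.le, le_rfl⟩).1⟩
    by_contra hlt
    push Not at hlt
    exact hbad ⟨S, ha, hA, hlt⟩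
  · exfalso
    push Not at hbdd
    have hP := fun t (ht : 0 ≤ t) => limit_props (lam := lam) (l := 𝓝[<] a) ha nhdsWithin_le_nhds
      hT' ht (hbdd t)
    have hle : a ≤ cylRadius lam := le_of_tendsto (f := fun v : ℝ => v) (x := 𝓝[<] a)
      nhdsWithin_le_nhds (hT'.mono fun v hv => hv.2.lt_cylRadius.le)
    have hTr := traj_rad (lam := lam) ha
    rcases hle.eq_or_lt with heq | hlt
    · refine hTr.not_bounded (X := 2) (fun t ht => (hP t ht).1) (fun t ht => (hP t ht).2.1) le_rfl
        one_pos (fun t _ => hTr.hx t) (fun t _ => ?_) fun t ht => (hP t ht).1.2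
      have : ang lam a t = π / 2 := by rw [heq]; exact ang_cylRadius hlam t
      rw [this]
      simp
    · refine hTr.not_eternal hlam (hgt_zero _ _) (ang_zero _ _) ?_ (X := 2)
        (fun t ht => (hP t ht).1) (fun t ht => (hP t ht).2.1) fun t ht => (hP t ht).2.2
      rw [curv_eq]
      simpa using drift_pos hlam ha hlt

/-- The supremum of the starting points below which all orbits land. -/
theorem exists_critical (hlam : 1 < lam) {a₂ : ℝ} (ha₂ : 0 < a₂)
    (hgood : ∀ v ∈ Ioo 0 a₂, ∃ S, Lands lam v S) :
    ∃ a, a₂ ≤ a ∧ (∀ v ∈ Ioo 0 a, ∃ S, Lands lam v S) ∧ ¬ ∃ S, Lands lam a S := by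
  set J : Set ℝ := {u | 0 < u ∧ ∀ v ∈ Ioo 0 u, ∃ S, Lands lam v S} with hJ
  have hmem : a₂ ∈ J := ⟨ha₂, hgood⟩
  have hbdd : BddAbove J := ⟨cylRadius lam, fun u hu => by
    by_contra hlt
    push Not at hlt
    have hpos := cylRadius_pos hlam
    obtain ⟨S, hS⟩ := hu.2 ((cylRadius lam + u) / 2) ⟨by linarith, by linarith⟩
    linarith [hS.lt_cylRadius]⟩
  have hle := le_csSup hbdd hmem
  have hall : ∀ v ∈ Ioo 0 (sSup J), ∃ S, Lands lam v S := fun v hv => by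
    obtain ⟨u, hu, hvu⟩ := exists_lt_of_lt_csSup ⟨a₂, hmem⟩ hv.2
    exact hu.2 v ⟨hv.1, hvu⟩
  refine ⟨sSup J, hle, hall, fun ⟨S, hS⟩ => ?_⟩
  obtain ⟨ε, hε, hball⟩ := Metric.eventually_nhds_iff.mp (hS.eventually one_pos)
  have hin : sSup J + ε / 2 ∈ J := ⟨by linarith, fun v hv => by
    rcases lt_or_ge v (sSup J) with hlt | hge
    · exact hall v ⟨hv.1, hlt⟩
    · obtain ⟨S', -, hS'⟩ := hball (y := v) (by
        rw [Real.dist_eq, abs_of_nonneg (by linarith)]; linarith [hv.2])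
      exact ⟨S', hS'⟩⟩
  linarith [le_csSup hbdd hin]

end

section
open Set Filter Topology

variable {lam : ℝ} {r x ω : ℝ → ℝ} {T : ℝ}

/-- A geodesic leaving the half-line `x = 0` orthogonally which stays convex and graphical over the
half-line up to time `T`. -/
structure Graphical (lam : ℝ) (r x ω : ℝ → ℝ) (T : ℝ) : Prop extends Traj lam r x ω where
  lam_gt : 1 < lam
  T_pos : 0 < T
  x_zero : x 0 = 0
  ω_zero : ω 0 = π / 2
  x_pos : ∀ t ∈ Ioo 0 T, 0 < x t
  curv_pos : ∀ t ∈ Ioo 0 T, 0 < curv lam (r t) (x t) (ω t)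
  ω_gt : ∀ t ∈ Ioo 0 T, -(π / 2) < ω t

namespace Graphical

theorem x_nonneg (h : Graphical lam r x ω T) {t : ℝ} (ht : t ∈ Icc 0 T) : 0 ≤ x t := by
  have hcl : Icc 0 T ⊆ closure (Ioo 0 T) := by rw [closure_Ioo h.T_pos.ne]
  exact closure_minimal (t := {t | 0 ≤ x t}) (fun _ hu => (h.x_pos _ hu).le)
    (isClosed_le continuous_const h.continuous_x) (hcl ht)

theorem curv_nonneg (h : Graphical lam r x ω T) {t : ℝ} (ht : t ∈ Icc 0 T) :
    0 ≤ curv lam (r t) (x t) (ω t) := by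
  have hcl : Icc 0 T ⊆ closure (Ioo 0 T) := by rw [closure_Ioo h.T_pos.ne]
  exact closure_minimal (t := {t | 0 ≤ curv lam (r t) (x t) (ω t)})
    (fun u hu => (h.curv_pos u hu).le) (isClosed_le continuous_const h.continuous_curv) (hcl ht)

theorem ω_le (h : Graphical lam r x ω T) {s t : ℝ} (hs : 0 ≤ s) (hst : s ≤ t) (ht : t ≤ T) :
    ω t ≤ ω s :=
  h.le_of_curv_nonneg hst fun u hu => h.curv_nonneg ⟨hs.trans hu.1.le, hu.2.le.trans ht⟩

theorem ω_lt_pi_half (h : Graphical lam r x ω T) {t : ℝ} (ht : t ∈ Ioc 0 T) : ω t < π / 2 := by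
  rw [← h.ω_zero]
  exact h.lt_of_curv_pos ht.1 fun u hu => h.curv_pos u ⟨hu.1, hu.2.trans_le ht.2⟩

theorem cos_pos (h : Graphical lam r x ω T) {t : ℝ} (ht : t ∈ Ioo 0 T) : 0 < cos (ω t) :=
  Real.cos_pos_of_mem_Ioo ⟨h.ω_gt t ht, h.ω_lt_pi_half ⟨ht.1, ht.2.le⟩⟩

theorem cos_pos' (h : Graphical lam r x ω T) {t : ℝ} (ht : t ∈ Ioc 0 T) (hω : 0 ≤ ω t) :
    0 < cos (ω t) :=
  Real.cos_pos_of_mem_Ioo ⟨by linarith [pi_pos], h.ω_lt_pi_half ht⟩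

theorem r_le (h : Graphical lam r x ω T) {s t : ℝ} (hs : 0 ≤ s) (hst : s ≤ t) (ht : t ≤ T) :
    r s ≤ r t :=
  le_of_hasDerivAt_nonneg hst h.continuous_r.continuousOn (fun u _ => h.hr u)
    fun _ hu => (mul_pos (h.speed_pos _)
      (h.cos_pos ⟨hs.trans_lt hu.1, hu.2.trans_le ht⟩)).le

theorem sin_nonneg (h : Graphical lam r x ω T) {u t : ℝ} (hu : 0 ≤ u) (hut : u ≤ t) (ht : t ≤ T)
    (hω : 0 ≤ ω t) : 0 ≤ sin (ω u) := by
  have h1 := h.ω_le hu hut ht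
  have h2 := h.ω_le le_rfl hu (hut.trans ht)
  rw [h.ω_zero] at h2
  exact sin_nonneg_of_nonneg_of_le_pi (hω.trans h1) (by linarith [pi_pos])

theorem rise_le (h : Graphical lam r x ω T) {p t : ℝ} (hp : 0 < p) (hpt : p ≤ t) (ht : t ≤ T)
    (hω : -(π / 2) < ω p) : x t ≤ x p + (r t - r p) * tan (ω p) := by
  have := le_of_hasDerivAt_nonneg (f := fun t => r t * tan (ω p) - x t) hpt
    (by have := h.continuous_r; have := h.continuous_x; fun_prop)
    (fun u _ => ((h.hr u).mul_const _).fun_sub (h.hx u)) fun u hu => by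
      have hu' : u ∈ Ioo 0 T := ⟨hp.trans hu.1, hu.2.trans_le ht⟩
      have h1 := h.cos_pos hu'
      have h2 := strictMonoOn_tan.monotoneOn (a := ω u) (b := ω p)
        ⟨h.ω_gt u hu', h.ω_lt_pi_half ⟨hu'.1, hu'.2.le⟩⟩ ⟨hω, h.ω_lt_pi_half ⟨hp, hpt.trans ht⟩⟩
        (h.ω_le hp.le hu.1.le hu'.2.le)
      rw [tan_eq_sin_div_cos (ω u), div_le_iff₀ h1] at h2
      have h3 := mul_le_mul_of_nonneg_left h2 (h.speed_pos u).le
      linarith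
  linarith

theorem le_rise (h : Graphical lam r x ω T) {p t : ℝ} (hp : 0 < p) (hpt : p ≤ t) (ht : t ≤ T)
    (hω : 0 ≤ ω t) : x p + (r t - r p) * tan (ω t) ≤ x t := by
  have := le_of_hasDerivAt_nonneg (f := fun u => x u - r u * tan (ω t)) hpt
    (by have := h.continuous_r; have := h.continuous_x; fun_prop)
    (fun u _ => (h.hx u).fun_sub ((h.hr u).mul_const _)) fun u hu => by
      have hu' : u ∈ Ioo 0 T := ⟨hp.trans hu.1, hu.2.trans_le ht⟩
      have h1 := h.cos_pos hu'
      have h2 := strictMonoOn_tan.monotoneOn (a := ω t) (b := ω u)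
        ⟨by linarith [pi_pos], h.ω_lt_pi_half ⟨hp.trans_le hpt, ht⟩⟩
        ⟨h.ω_gt u hu', h.ω_lt_pi_half ⟨hu'.1, hu'.2.le⟩⟩ (h.ω_le hu'.1.le hu.2.le ht)
      rw [tan_eq_sin_div_cos (ω u), le_div_iff₀ h1] at h2
      have h3 := mul_le_mul_of_nonneg_left h2 (h.speed_pos u).le
      linarith
  linarith

theorem sub_mul_sin_le (h : Graphical lam r x ω T) {t : ℝ} (ht : t ∈ Icc 0 T) (hω : 0 ≤ ω t) :
    (r t - r 0) * sin (ω t) ≤ x t * cos (ω t) := by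
  have := le_of_hasDerivAt_nonneg (f := fun t => x t * cos (ω t) - (r t - r 0) * sin (ω t)) ht.1
    (by have := h.continuous_r; have := h.continuous_x; have := h.continuous_ω; fun_prop)
    (fun u _ => ((h.hx u).mul (h.hasDerivAt_cos u)).fun_sub
      (((h.hr u).sub_const (r 0)).mul (h.hasDerivAt_sin u))) fun u hu => by
      have hu' : u ∈ Ioo 0 T := ⟨hu.1, hu.2.trans_le ht.2⟩
      have h1 := h.cos_pos hu'
      have h2 := h.sin_nonneg hu.1.le hu.2.le ht.2 hω
      have h3 := h.r_le le_rfl hu.1.le hu'.2.le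
      have h4 := mul_nonneg (mul_pos (h.speed_pos u) (h.curv_pos u hu')).le
        (add_nonneg (mul_nonneg (h.x_pos u hu').le h2) (mul_nonneg (sub_nonneg.mpr h3) h1.le))
      linarith
  simp only [h.x_zero, zero_mul, sub_self] at this
  linarith

theorem intercept_mono (h : Graphical lam r x ω T) {p t : ℝ} (hp : 0 < p) (hpt : p ≤ t) (ht : t ≤ T)
    (hω : 0 ≤ ω t) : x p - r p * tan (ω p) ≤ x t - r t * tan (ω t) := by
  have hc : ∀ u ∈ Icc p t, 0 < cos (ω u) := fun u hu => h.cos_pos' ⟨hp.trans_le hu.1, hu.2.trans ht⟩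
    (hω.trans (h.ω_le (hp.le.trans hu.1) hu.2 ht))
  refine le_of_hasDerivAt_nonneg (f := fun t => x t - r t * tan (ω t)) hpt
    (fun u hu => (h.hasDerivAt_intercept (hc u hu).ne').continuousAt.continuousWithinAt)
    (fun u hu => h.hasDerivAt_intercept (hc u ⟨hu.1.le, hu.2.le⟩).ne') fun u hu => ?_
  exact mul_nonneg (h.speed_pos u).le (div_nonneg (mul_nonneg (h.pos u).le
    (h.curv_nonneg ⟨hp.le.trans hu.1.le, hu.2.le.trans ht⟩)) (sq_nonneg _))

theorem intercept_growth (h : Graphical lam r x ω T) {p t : ℝ} (hp : 0 < p) (hpt : p ≤ t)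
    (ht : t ≤ T) (hω : 0 ≤ ω t) (h0 : 0 ≤ x p - r p * tan (ω p)) :
    (x p - r p * tan (ω p)) * (1 + (r t ^ 2 - r p ^ 2) / 4) ≤ x t - r t * tan (ω t) := by
  have hc : ∀ u ∈ Icc p t, 0 < cos (ω u) := fun u hu => h.cos_pos' ⟨hp.trans_le hu.1, hu.2.trans ht⟩
    (hω.trans (h.ω_le (hp.le.trans hu.1) hu.2 ht))
  set D := x p - r p * tan (ω p) with hD
  have := le_of_hasDerivAt_nonneg (f := fun t => (x t - r t * tan (ω t)) - D * (r t ^ 2 / 4)) hpt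
    (fun u hu => ((h.hasDerivAt_intercept (hc u hu).ne').fun_sub
      ((((h.hr u).fun_pow 2).div_const 4).const_mul D)).continuousAt.continuousWithinAt)
    (fun u hu => ((h.hasDerivAt_intercept (hc u ⟨hu.1.le, hu.2.le⟩).ne').fun_sub
      ((((h.hr u).fun_pow 2).div_const 4).const_mul D))) fun u hu => by
      have hcu := hc u ⟨hu.1.le, hu.2.le⟩
      have hωu := hω.trans (h.ω_le (hp.le.trans hu.1.le) hu.2.le ht)
      have h1 := h.intercept_mono hp hu.1.le (hu.2.le.trans ht) hωu
      have h2 := h.sin_nonneg (hp.le.trans hu.1.le) hu.2.le ht hω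
      have hr := h.pos u
      have hW := h.speed_pos u
      have h3 : D * cos (ω u) / 2 ≤ curv lam (r u) (x u) (ω u) := by
        rw [curv_eq_intercept hr.ne' hcu.ne']
        have h4 : 0 ≤ (lam - 1) * sin (ω u) / r u :=
          div_nonneg (mul_nonneg (by linarith [h.lam_gt]) h2) hr.le
        nlinarith
      have h5 : D * cos (ω u) / 2 ≤ curv lam (r u) (x u) (ω u) / cos (ω u) ^ 2 := by
        rw [le_div_iff₀ (by positivity)]
        refine le_trans ?_ h3
        have : cos (ω u) ^ 2 ≤ 1 := cos_sq_le_one _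
        have : 0 ≤ D * cos (ω u) / 2 := by positivity
        nlinarith
      have h6 := mul_le_mul_of_nonneg_left h5 (mul_pos hW hr).le
      rw [mul_div_assoc]
      norm_num
      linarith
  linarith

theorem intercept_lower (h : Graphical lam r x ω T) {p q ρ : ℝ} (hp : 0 < p) (hpq : p < q)
    (hq : q ≤ T) (hω : 0 ≤ ω q) (hrp : r p = ρ) (hrq : r q = 2 * ρ) (ha : r 0 ≤ ρ / 2)
    (ha' : r 0 ≤ ρ * (lam - 1) / 32) (ha'' : 2 * ρ * r 0 ≤ lam - 1) :
    min (1 / 2) ((lam - 1) / 16) / 3 * x q ≤ x q - r q * tan (ω q) := by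
  set μ := (lam - 1) / 2 with hμ
  have hlam := h.lam_gt
  have hμpos : 0 < μ := by linarith
  have hρ : 0 < ρ := hrp ▸ h.pos p
  have ha0 := h.pos 0
  have hc : ∀ u ∈ Icc p q, 0 < cos (ω u) := fun u hu => h.cos_pos' ⟨hp.trans_le hu.1, hu.2.trans hq⟩
    (hω.trans (h.ω_le (hp.le.trans hu.1) hu.2 hq))
  have hωp := hω.trans (h.ω_le hp.le hpq.le hq)
  have htan : ∀ u ∈ Icc p q, (r u - r 0) * tan (ω u) ≤ x u := fun u hu => by
    rw [tan_eq_sin_div_cos, mul_div_assoc', div_le_iff₀ (hc u hu)]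
    exact h.sub_mul_sin_le ⟨hp.le.trans hu.1, hu.2.trans hq⟩
      (hω.trans (h.ω_le (hp.le.trans hu.1) hu.2 hq))
  have hsin : ∀ u ∈ Icc p q, 0 ≤ sin (ω u) := fun u hu =>
    h.sin_nonneg (hp.le.trans hu.1) hu.2 hq hω
  have htn : ∀ u ∈ Icc p q, 0 ≤ tan (ω u) := fun u hu => by
    rw [tan_eq_sin_div_cos]; exact div_nonneg (hsin u hu) (hc u hu).le
  have hpI : p ∈ Icc p q := ⟨le_rfl, hpq.le⟩
  have hqI : q ∈ Icc p q := ⟨hpq.le, le_rfl⟩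
  have h1 := htan p hpI
  have h2 := h.rise_le hp hpq.le hq (by linarith [pi_pos])
  have h3 := h.le_rise hp hpq.le hq hω
  have htp := htn p hpI
  have htq := htn q hqI
  have hxp := h.x_nonneg ⟨hp.le, hpq.le.trans hq⟩
  rw [hrp] at h1
  rw [hrp, hrq] at h2 h3
  have h4 : ρ / 2 * tan (ω p) ≤ x p := by nlinarith
  have hxq3 : x q ≤ 3 * x p := by nlinarith
  have hmono : (x p - r p * tan (ω p)) - μ * x p ≤ (x q - r q * tan (ω q)) - μ * x q :=
    le_of_hasDerivAt_nonneg (f := fun t => (x t - r t * tan (ω t)) - μ * x t) hpq.le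
      (fun u hu => ((h.hasDerivAt_intercept (hc u hu).ne').fun_sub
        ((h.hx u).const_mul μ)).continuousAt.continuousWithinAt)
      (fun u hu => (h.hasDerivAt_intercept (hc u ⟨hu.1.le, hu.2.le⟩).ne').fun_sub
        ((h.hx u).const_mul μ)) fun u hu => by
        have huI : u ∈ Icc p q := ⟨hu.1.le, hu.2.le⟩
        have hcu := hc u huI
        have hsu := hsin u huI
        have hru := h.pos u
        have hru2 : r u ≤ 2 * ρ := hrq ▸ h.r_le (hp.le.trans hu.1.le) hu.2.le hq
        have h5 := h.sub_mul_sin_le ⟨hp.le.trans hu.1.le, hu.2.le.trans hq⟩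
          (hω.trans (h.ω_le (hp.le.trans hu.1.le) hu.2.le hq))
        have h6 : r u * curv lam (r u) (x u) (ω u) =
            (lam - 1) * sin (ω u) + r u / 2 * (x u * cos (ω u) - r u * sin (ω u)) := by
          unfold curv; field_simp; ring
        have h7 : μ * sin (ω u) ≤ r u * curv lam (r u) (x u) (ω u) := by
          rw [h6]
          have h8 : r u * r 0 ≤ lam - 1 := by nlinarith
          have h9 := mul_le_mul_of_nonneg_right h8 hsu
          have h10 := mul_le_mul_of_nonneg_left h5 (half_pos hru).le
          rw [hμ]
          linarith
        have h11 : μ * sin (ω u) ≤ r u * curv lam (r u) (x u) (ω u) / cos (ω u) ^ 2 := by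
          rw [le_div_iff₀ (by positivity)]
          have : cos (ω u) ^ 2 ≤ 1 := cos_sq_le_one _
          have : 0 ≤ μ * sin (ω u) := by positivity
          nlinarith
        have := mul_le_mul_of_nonneg_left h11 (h.speed_pos u).le
        linarith
  rw [hrp, hrq] at hmono
  rw [hrq]
  have hm1 := min_le_left (1 / 2 : ℝ) ((lam - 1) / 16)
  have hm2 := min_le_right (1 / 2 : ℝ) ((lam - 1) / 16)
  have hm0 : 0 < min (1 / 2 : ℝ) ((lam - 1) / 16) := lt_min (by norm_num) (by linarith)
  set m := min (1 / 2 : ℝ) ((lam - 1) / 16)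
  suffices m * x p ≤ x q - 2 * ρ * tan (ω q) by nlinarith
  rcases le_or_gt (2 * ρ * tan (ω q)) (x p / 2) with hA | hB
  · nlinarith
  · have h5 : r 0 * tan (ω p) ≤ (lam - 1) / 16 * x p := by
      have h6 := mul_le_mul_of_nonneg_right ha' htp
      have h7 := mul_le_mul_of_nonneg_left h4 hμpos.le
      rw [hμ] at h7
      nlinarith
    have h8 : x p / 4 ≤ x q - x p := by linarith
    have h9 := mul_le_mul_of_nonneg_left h8 hμpos.le
    have h10 : m * x p ≤ (lam - 1) / 16 * x p := mul_le_mul_of_nonneg_right hm2 hxp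
    have : μ * (x p / 4) = 2 * ((lam - 1) / 16 * x p) := by rw [hμ]; ring
    linarith

end Graphical

end

section
open Set Filter Topology

variable {lam : ℝ} {r x ω : ℝ → ℝ} {T : ℝ}

theorem drift_anti (hlam : 1 < lam) {r r' : ℝ} (hr : 0 < r) (hrr : r ≤ r') :
    drift lam r' ≤ drift lam r := by
  unfold drift
  have := div_le_div_of_nonneg_left (a := lam - 1) (by linarith) hr hrr
  linarith

/-- The length density of the metric along the half-line `x = 0`. -/
noncomputable def weight (lam r : ℝ) : ℝ := r ^ (lam - 1) * exp (-r ^ 2 / 4)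

theorem weight_pos {r : ℝ} (hr : 0 < r) : 0 < weight lam r :=
  mul_pos (rpow_pos_of_pos hr _) (exp_pos _)

theorem hasDerivAt_weight {r : ℝ} (hr : 0 < r) :
    HasDerivAt (weight lam) (weight lam r * drift lam r) r := by
  have h1 := Real.hasDerivAt_rpow_const (x := r) (p := lam - 1) (Or.inl hr.ne')
  have h2 := (((hasDerivAt_id r).fun_pow 2).fun_neg.div_const 4).exp
  refine (h1.mul h2).congr_deriv ?_
  rw [rpow_sub_one hr.ne']
  simp only [weight, drift, id]
  norm_num
  ring

theorem weight_le (hlam : 1 < lam) {r R : ℝ} (hr : 0 < r) (hrR : r ≤ R) :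
    weight lam r ≤ R ^ (lam - 1) := by
  have h1 : exp (-r ^ 2 / 4) ≤ 1 := exp_le_one_iff.mpr (by nlinarith [sq_nonneg r])
  have h2 := rpow_le_rpow hr.le hrR (by linarith : (0 : ℝ) ≤ lam - 1)
  have h3 := rpow_pos_of_pos hr (lam - 1)
  unfold weight
  nlinarith [exp_pos (-r ^ 2 / 4)]

theorem le_weight (hlam : 1 < lam) {r r₀ R : ℝ} (hr₀ : 0 < r₀) (hr : r₀ ≤ r) (hrR : r ≤ R) :
    r₀ ^ (lam - 1) * exp (-R ^ 2 / 4) ≤ weight lam r := by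
  have h2 := rpow_le_rpow hr₀.le hr (by linarith : (0 : ℝ) ≤ lam - 1)
  refine mul_le_mul h2 (exp_le_exp.mpr ?_) (exp_pos _).le (rpow_nonneg (hr₀.le.trans hr) _)
  nlinarith

theorem Traj.hasDerivAt_sin_mul_weight (h : Traj lam r x ω) (t : ℝ) :
    HasDerivAt (fun t => sin (ω t) * weight lam (r t))
      (-(speed (r t) (x t) * weight lam (r t) * cos (ω t) ^ 2 * x t / 2)) t := by
  refine ((h.hasDerivAt_sin t).mul ((hasDerivAt_weight (h.pos t)).comp t (h.hr t))).congr_deriv ?_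
  simp only [curv_eq, Function.comp]
  ring

namespace Graphical

theorem exists_intercept_ge (h : Graphical lam r x ω T) {t ρ : ℝ} (hρ : 0 < ρ) (ht : t ∈ Icc 0 T)
    (hω : 0 ≤ ω t) (hr : 2 * ρ ≤ r t) (ha : r 0 ≤ ρ / 2)
    (ha' : r 0 ≤ ρ * (lam - 1) / 32) (ha'' : 2 * ρ * r 0 ≤ lam - 1) :
    ∃ q, 0 < q ∧ q ≤ t ∧ r q = 2 * ρ ∧
      min (1 / 2) ((lam - 1) / 16) / 3 * x q ≤ x q - r q * tan (ω q) := by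
  obtain ⟨p, hp, hrp⟩ := intermediate_value_Icc ht.1 h.continuous_r.continuousOn
    (show ρ ∈ Icc (r 0) (r t) from ⟨by linarith, by linarith⟩)
  have hp0 : 0 < p := lt_of_le_of_ne hp.1 fun he => by rw [← he] at hrp; linarith
  obtain ⟨q, hq, hrq⟩ := intermediate_value_Icc hp.2 h.continuous_r.continuousOn
    (show 2 * ρ ∈ Icc (r p) (r t) from ⟨by linarith, hr⟩)
  have hpq : p < q := lt_of_le_of_ne hq.1 fun he => by rw [← he] at hrq; linarith
  exact ⟨q, hp0.trans hpq, hq.2, hrq, h.intercept_lower hp0 hpq (hq.2.trans ht.2)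
    (hω.trans (h.ω_le (hp0.trans hpq).le hq.2 ht.2)) hrp hrq ha ha' ha''⟩

theorem intercept_pos (h : Graphical lam r x ω T) {t ρ : ℝ} (hρ : 0 < ρ) (ht : t ∈ Icc 0 T)
    (hω : 0 ≤ ω t) (hxt : 0 < x t) (hr : 2 * ρ ≤ r t) (ha : r 0 ≤ ρ / 2)
    (ha' : r 0 ≤ ρ * (lam - 1) / 32) (ha'' : 2 * ρ * r 0 ≤ lam - 1) :
    0 < x t - r t * tan (ω t) := by
  obtain ⟨q, hq0, hqt, -, hD⟩ := h.exists_intercept_ge hρ ht hω hr ha ha' ha''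
  have hxq : 0 < x q := by
    rcases hqt.eq_or_lt with rfl | hlt
    · exact hxt
    · exact h.x_pos q ⟨hq0, hlt.trans_le ht.2⟩
  have h1 : 0 < min (1 / 2 : ℝ) ((lam - 1) / 16) :=
    lt_min (by norm_num) (by linarith [h.lam_gt])
  exact ((by positivity : 0 < min (1 / 2 : ℝ) ((lam - 1) / 16) / 3 * x q).trans_le hD).trans_le
    (h.intercept_mono hq0 hqt ht.2 hω)

theorem r_le_of_ascending (h : Graphical lam r x ω T) {t ρ : ℝ} (hρ : 0 < ρ) (ht : t ∈ Icc 0 T)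
    (hω : 0 ≤ ω t) (ha : r 0 ≤ ρ / 2)
    (ha' : r 0 ≤ ρ * (lam - 1) / 32) (ha'' : 2 * ρ * r 0 ≤ lam - 1) :
    r t ≤ 2 / (ρ * (min (1 / 2) ((lam - 1) / 16) / 3)) + 2 * ρ := by
  have h1 : 0 < min (1 / 2 : ℝ) ((lam - 1) / 16) / 3 :=
    div_pos (lt_min (by norm_num) (by linarith [h.lam_gt])) (by norm_num)
  rcases le_or_gt (r t) (2 * ρ) with hle | hgt
  · have : 0 < 2 / (ρ * (min (1 / 2 : ℝ) ((lam - 1) / 16) / 3)) := by positivity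
    linarith
  obtain ⟨q, hq0, hqt, hrq, hD⟩ := h.exists_intercept_ge hρ ht hω hgt.le ha ha' ha''
  set δ := min (1 / 2 : ℝ) ((lam - 1) / 16) / 3
  have hqt' : q < t := lt_of_le_of_ne hqt fun he => by rw [he] at hrq; linarith
  have hxq : 0 < x q := h.x_pos q ⟨hq0, hqt'.trans_le ht.2⟩
  have hωq := hω.trans (h.ω_le hq0.le hqt ht.2)
  have hδx : 0 < δ * x q := mul_pos h1 hxq
  have hg := h.intercept_growth hq0 hqt ht.2 hω (hδx.le.trans hD)
  have hx := h.rise_le hq0 hqt ht.2 (by linarith [pi_pos])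
  have htan : 0 ≤ r t * tan (ω t) := mul_nonneg (h.pos t).le (by
    rw [tan_eq_sin_div_cos]
    exact div_nonneg (h.sin_nonneg ht.1 le_rfl ht.2 hω) (h.cos_pos' ⟨hq0.trans hqt', ht.2⟩ hω).le)
  rw [hrq] at hg hx hD
  have h2 : 2 * ρ * tan (ω q) ≤ x q := by linarith
  have h3 : 2 * ρ * x t ≤ x q * r t := by nlinarith
  have h4 : 0 ≤ 1 + (r t ^ 2 - (2 * ρ) ^ 2) / 4 := by nlinarith
  have h5 : δ * x q * (1 + (r t ^ 2 - (2 * ρ) ^ 2) / 4) ≤ x t := by nlinarith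
  have h6 : 2 * ρ * (δ * (1 + (r t ^ 2 - (2 * ρ) ^ 2) / 4)) ≤ r t := by
    have h7 : x q * (2 * ρ * (δ * (1 + (r t ^ 2 - (2 * ρ) ^ 2) / 4))) ≤ x q * r t := by nlinarith
    exact le_of_mul_le_mul_left h7 hxq
  by_contra hR
  push Not at hR
  have h8 : 2 < (r t - 2 * ρ) * (ρ * δ) := by
    rw [← div_lt_iff₀ (by positivity)]; linarith
  nlinarith [mul_pos hρ h1, h.pos t]

theorem exists_top (h : Graphical lam r x ω T) {t : ℝ} (ht : t ∈ Icc 0 T) (hω : ω t ≤ 0) :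
    ∃ p, 0 < p ∧ p ≤ t ∧ ω p = 0 := by
  obtain ⟨p, hp0, hpt, hp, -⟩ := exists_first_zero h.continuous_ω
    (by rw [h.ω_zero]; positivity) ht.1 hω
  exact ⟨p, hp0, hpt, hp⟩

theorem r_le_of_top (h : Graphical lam r x ω T) {R₁ t : ℝ} (ht : t ∈ Ioo 0 T)
    (hR₁ : cylRadius lam ≤ R₁) (hR : ∀ u ∈ Icc 0 T, 0 ≤ ω u → r u ≤ R₁) : r t ≤ R₁ + π := by
  by_contra hlt
  push Not at hlt
  have hω : ω t < 0 := by
    by_contra hge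
    push Not at hge
    linarith [hR t (Ioo_subset_Icc_self ht) hge, pi_pos]
  obtain ⟨p, hp0, hpt, hωp⟩ := h.exists_top (Ioo_subset_Icc_self ht) hω.le
  have hrp := hR p ⟨hp0.le, hpt.trans ht.2.le⟩ hωp.ge
  obtain ⟨t₁, ht₁, hr₁⟩ := intermediate_value_Icc hpt h.continuous_r.continuousOn
    (show R₁ ∈ Icc (r p) (r t) from ⟨hrp, by linarith [pi_pos]⟩)
  obtain ⟨t₂, ht₂, hr₂⟩ := intermediate_value_Icc ht₁.2 h.continuous_r.continuousOn
    (show R₁ + π ∈ Icc (r t₁) (r t) from ⟨by linarith [pi_pos], hlt.le⟩)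
  have h0 : ∀ u ∈ Icc t₁ t₂, u ∈ Ioo 0 T := fun u hu =>
    ⟨(hp0.trans_le ht₁.1).trans_le hu.1, (hu.2.trans ht₂.2).trans_lt ht.2⟩
  have htan0 : ∀ u ∈ Icc t₁ t₂, sin (ω u) ≤ 0 := fun u hu => by
    have h1 := h.ω_le hp0.le (ht₁.1.trans hu.1) (h0 u hu).2.le
    exact sin_nonpos_of_nonpos_of_neg_pi_le (by linarith) (by linarith [h.ω_gt u (h0 u hu), pi_pos])
  have hd : ∀ u ∈ Icc t₁ t₂, HasDerivAt (fun t => -(tan (ω t) * cos ((r t - R₁) / 2) +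
      x t / 2 * sin ((r t - R₁) / 2)))
      (speed (r u) (x u) * cos ((r u - R₁) / 2) * (curv lam (r u) (x u) (ω u) / cos (ω u) ^ 2 -
        x u / 4 * cos (ω u))) u := fun u hu => by
    have hc := (h.cos_pos (h0 u hu)).ne'
    have hθ := ((h.hr u).sub_const R₁).div_const 2
    refine (((h.hasDerivAt_tan hc).mul hθ.cos).add
      (((h.hx u).div_const 2).mul hθ.sin)).fun_neg.congr_deriv ?_
    rw [tan_eq_sin_div_cos]
    field_simp
    ring
  have hle := le_of_hasDerivAt_nonneg ht₂.1
    (fun u hu => (hd u hu).continuousAt.continuousWithinAt)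
    (fun u hu => hd u ⟨hu.1.le, hu.2.le⟩) fun u hu => by
      have hu' : u ∈ Icc t₁ t₂ := ⟨hu.1.le, hu.2.le⟩
      have hc := h.cos_pos (h0 u hu')
      have hs := htan0 u hu'
      have hx := h.x_pos u (h0 u hu')
      have hr1 : R₁ ≤ r u := hr₁ ▸ h.r_le (h0 t₁ ⟨le_rfl, ht₂.1⟩).1.le hu.1.le (h0 u hu').2.le
      have hr2 : r u ≤ R₁ + π := hr₂ ▸ h.r_le (h0 u hu').1.le hu.2.le (ht₂.2.trans ht.2.le)
      have hcθ : 0 ≤ cos ((r u - R₁) / 2) :=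
        Real.cos_nonneg_of_mem_Icc ⟨by linarith [pi_pos], by linarith⟩
      refine mul_nonneg (mul_nonneg (h.speed_pos u).le hcθ) ?_
      have h1 : x u / 2 * cos (ω u) ≤ curv lam (r u) (x u) (ω u) := by
        have := drift_nonpos h.lam_gt (h.pos u) (hR₁.trans hr1)
        rw [curv_eq]
        nlinarith
      have h2 : x u / 4 * cos (ω u) ≤ curv lam (r u) (x u) (ω u) / cos (ω u) ^ 2 := by
        rw [le_div_iff₀ (by positivity)]
        have : cos (ω u) ^ 2 ≤ 1 := cos_sq_le_one _
        have : 0 < x u * cos (ω u) := by positivity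
        nlinarith
      linarith
  rw [hr₁, hr₂, sub_self, show (R₁ + π - R₁) / 2 = π / 2 by ring] at hle
  simp only [zero_div, cos_zero, sin_zero, cos_pi_div_two, sin_pi_div_two, mul_one, mul_zero,
    add_zero, zero_add] at hle
  have h1 : tan (ω t₁) ≤ 0 := by
    have := h0 t₁ ⟨le_rfl, ht₂.1⟩
    rw [tan_eq_sin_div_cos]
    exact div_nonpos_of_nonpos_of_nonneg (htan0 t₁ ⟨le_rfl, ht₂.1⟩) (h.cos_pos this).le
  linarith [h.x_pos t₂ (h0 t₂ ⟨ht₂.1, le_rfl⟩)]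

theorem r_le_add_pi (h : Graphical lam r x ω T) {R₁ t : ℝ} (ht : t ∈ Icc 0 T)
    (hR₁ : cylRadius lam ≤ R₁) (hR : ∀ u ∈ Icc 0 T, 0 ≤ ω u → r u ≤ R₁) : r t ≤ R₁ + π := by
  have hcl : Icc 0 T ⊆ closure (Ioo 0 T) := by rw [closure_Ioo h.T_pos.ne]
  exact closure_minimal (t := {t | r t ≤ R₁ + π}) (fun u hu => h.r_le_of_top hu hR₁ hR)
    (isClosed_le h.continuous_r continuous_const) (hcl ht)

theorem sin_mul_weight_le (h : Graphical lam r x ω T) {t : ℝ} (ht : t ∈ Icc 0 T) :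
    sin (ω t) * weight lam (r t) ≤ weight lam (r 0) := by
  have := le_of_hasDerivAt_nonneg (f := fun t => -(sin (ω t) * weight lam (r t))) ht.1
    (fun u _ => (h.hasDerivAt_sin_mul_weight u).continuousAt.neg.continuousWithinAt)
    (fun u _ => (h.hasDerivAt_sin_mul_weight u).fun_neg) fun u hu => by
      have h1 := h.x_pos u ⟨hu.1, hu.2.trans_le ht.2⟩
      have h2 := h.speed_pos u
      have h3 := weight_pos (lam := lam) (h.pos u)
      rw [neg_neg]
      positivity
  rw [h.ω_zero, sin_pi_div_two, one_mul] at this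
  linarith

theorem x_le_of_near_axis (h : Graphical lam r x ω T) {t ρ : ℝ} (ht : t ∈ Icc 0 T) (hω : 0 ≤ ω t)
    (hr : r t ≤ ρ) (hd : 0 < drift lam ρ) : x t ≤ π / (2 * drift lam ρ) := by
  have := le_of_hasDerivAt_nonneg (f := fun t => -(ω t + drift lam ρ * x t)) ht.1
    (by have := h.continuous_ω; have := h.continuous_x; fun_prop)
    (fun u _ => ((h.hω u).add ((h.hx u).const_mul (drift lam ρ))).fun_neg) fun u hu => by
      have hu' : u ∈ Ioo 0 T := ⟨hu.1, hu.2.trans_le ht.2⟩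
      have h1 := h.x_pos u hu'
      have h2 := h.sin_nonneg hu.1.le hu.2.le ht.2 hω
      have h3 := h.cos_pos hu'
      have h4 := drift_anti h.lam_gt (h.pos u) ((h.r_le hu.1.le hu.2.le ht.2).trans hr)
      have h5 : 0 ≤ curv lam (r u) (x u) (ω u) - drift lam ρ * sin (ω u) := by
        rw [curv_eq]
        nlinarith [mul_pos h1 h3]
      nlinarith [h.speed_pos u]
  rw [h.ω_zero, h.x_zero] at this
  rw [le_div_iff₀ (by positivity)]
  linarith

theorem x_le (h : Graphical lam r x ω T) {ρ k R₁ t : ℝ} (ht : t ∈ Icc 0 T) (ha : r 0 < ρ)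
    (hd : 0 < drift lam ρ) (hk : k ≤ 1 / 2) (hw : weight lam (r 0) ≤ k * weight lam ρ)
    (hR : ∀ u ∈ Icc 0 T, 0 ≤ ω u → r u ≤ R₁) : x t ≤ π / (2 * drift lam ρ) + 2 * k * R₁ := by
  have hρ := (h.pos 0).trans ha
  have hk0 : 0 < k := pos_of_mul_pos_left ((weight_pos (h.pos 0)).trans_le hw)
    (weight_pos hρ).le
  have hR₁ : 0 < R₁ := (h.pos 0).trans_le (hR 0 ⟨le_rfl, h.T_pos.le⟩ (by
    rw [h.ω_zero]; positivity))
  suffices H : ∀ t ∈ Icc 0 T, 0 ≤ ω t → x t ≤ π / (2 * drift lam ρ) + 2 * k * R₁ by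
    rcases le_total 0 (ω t) with hω | hω
    · exact H t ht hω
    · obtain ⟨p, hp0, hpt, hωp⟩ := h.exists_top ht hω
      refine le_trans ?_ (H p ⟨hp0.le, hpt.trans ht.2⟩ hωp.ge)
      have := h.rise_le hp0 hpt ht.2 (by rw [hωp]; linarith [pi_pos])
      rwa [hωp, tan_zero, mul_zero, add_zero] at this
  intro t ht hω
  rcases le_total (r t) ρ with hle | hge
  · have := h.x_le_of_near_axis ht hω hle hd
    have : 0 ≤ 2 * k * R₁ := by positivity
    linarith
  · obtain ⟨p, hp, hrp⟩ := intermediate_value_Icc ht.1 h.continuous_r.continuousOn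
      (show ρ ∈ Icc (r 0) (r t) from ⟨ha.le, hge⟩)
    have hp0 : 0 < p := lt_of_le_of_ne hp.1 fun he => by rw [← he] at hrp; linarith
    have hpI : p ∈ Icc 0 T := ⟨hp.1, hp.2.trans ht.2⟩
    have hωp := hω.trans (h.ω_le hp.1 hp.2 ht.2)
    have h1 := h.x_le_of_near_axis hpI hωp hrp.le hd
    have h2 := h.rise_le hp0 hp.2 ht.2 (by linarith [pi_pos])
    have h3 := (h.sin_mul_weight_le hpI).trans hw
    rw [hrp] at h3
    have h4 : sin (ω p) ≤ k := le_of_mul_le_mul_right h3 (weight_pos hρ)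
    have h5 := h.sin_nonneg hp.1 le_rfl hpI.2 hωp
    have hc := h.cos_pos' ⟨hp0, hpI.2⟩ hωp
    have h6 : 1 / 2 ≤ cos (ω p) := by nlinarith [sin_sq_add_cos_sq (ω p), cos_le_one (ω p)]
    have h7 : tan (ω p) ≤ 2 * k := by
      rw [tan_eq_sin_div_cos, div_le_iff₀ hc]; nlinarith
    have h8 := hR t ht hω
    have h9 : (r t - r p) * tan (ω p) ≤ R₁ * (2 * k) :=
      mul_le_mul (by linarith) h7 (by
        rw [tan_eq_sin_div_cos]; exact div_nonneg h5 hc.le) hR₁.le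
    linarith

theorem le_sin_mul_weight (h : Graphical lam r x ω T) {t η R : ℝ} (ht : t ∈ Icc 0 T)
    (hx : ∀ u ∈ Icc 0 T, x u ≤ η) (hR : r t ≤ R) :
    -(η / 2 * R ^ (lam - 1) * R) ≤ sin (ω t) * weight lam (r t) := by
  have hη : 0 ≤ η := h.x_zero ▸ hx 0 ⟨le_rfl, h.T_pos.le⟩
  have hRp : 0 < R := (h.pos t).trans_le hR
  have hM := rpow_pos_of_pos hRp (lam - 1)
  have := le_of_hasDerivAt_nonneg (f := fun t => sin (ω t) * weight lam (r t) +
      η / 2 * R ^ (lam - 1) * r t) ht.1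
    (fun u _ => ((h.hasDerivAt_sin_mul_weight u).fun_add
      ((h.hr u).const_mul _)).continuousAt.continuousWithinAt)
    (fun u _ => (h.hasDerivAt_sin_mul_weight u).fun_add ((h.hr u).const_mul _)) fun u hu => by
      have hu' : u ∈ Ioo 0 T := ⟨hu.1, hu.2.trans_le ht.2⟩
      have hc := h.cos_pos hu'
      have hc1 := cos_le_one (ω u)
      have hxu := h.x_pos u hu'
      have hxu' := hx u ⟨hu.1.le, hu'.2.le⟩
      have hw := weight_pos (lam := lam) (h.pos u)
      have hw' := weight_le h.lam_gt (h.pos u) ((h.r_le hu.1.le hu.2.le ht.2).trans hR)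
      have h1 : weight lam (r u) * (cos (ω u) * x u) ≤ R ^ (lam - 1) * η :=
        mul_le_mul hw' (by nlinarith) (by positivity) hM.le
      have h2 := mul_le_mul_of_nonneg_left h1 (mul_pos (h.speed_pos u) hc).le
      linarith
  rw [h.ω_zero, sin_pi_div_two, one_mul] at this
  have h1 : η / 2 * R ^ (lam - 1) * r t ≤ η / 2 * R ^ (lam - 1) * R :=
    mul_le_mul_of_nonneg_left hR (by positivity)
  have h2 : 0 ≤ η / 2 * R ^ (lam - 1) * r 0 := mul_nonneg (by positivity) (h.pos 0).le
  linarith [weight_pos (lam := lam) (h.pos 0)]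

end Graphical

end

section
open Set Filter Topology

variable {lam : ℝ} {r x ω : ℝ → ℝ} {T : ℝ}

theorem Traj.graphical_dichotomy (h : Traj lam r x ω) (hlam : 1 < lam) (hx0 : x 0 = 0)
    (hω0 : ω 0 = π / 2) (hk0 : 0 < curv lam (r 0) (x 0) (ω 0)) :
    (∀ T, 0 < T → Graphical lam r x ω T) ∨ ∃ T, Graphical lam r x ω T ∧
      (x T = 0 ∨ curv lam (r T) (x T) (ω T) = 0 ∨ ω T = -(π / 2)) := by
  have hx := h.continuous_x
  have hω := h.continuous_ω
  have hk := h.continuous_curv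
  obtain ⟨ε, hε, hnear⟩ : ∃ ε > 0, ∀ t, 0 ≤ t → t ≤ ε → 0 < sin (ω t) ∧
      0 < curv lam (r t) (x t) (ω t) ∧ -(π / 2) < ω t := by
    have h1 : ∀ᶠ t in 𝓝 (0 : ℝ), 0 < sin (ω t) ∧ 0 < curv lam (r t) (x t) (ω t) ∧ -(π / 2) < ω t := by
      refine ((continuous_sin.comp hω).continuousAt.eventually (lt_mem_nhds ?_)).and
        ((hk.continuousAt.eventually (lt_mem_nhds hk0)).and
          (hω.continuousAt.eventually (lt_mem_nhds ?_)))
      · simp [hω0]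
      · rw [hω0]; linarith [pi_pos]
    obtain ⟨e, he, hb⟩ := Metric.eventually_nhds_iff.mp h1
    refine ⟨e / 2, by positivity, fun t ht hte => hb ?_⟩
    rw [Real.dist_eq, sub_zero, abs_of_nonneg ht]
    linarith
  have hxnear : ∀ t, 0 < t → t ≤ ε → 0 < x t := fun t ht0 hte => by
    have := lt_of_hasDerivAt_pos ht0 hx.continuousOn (fun u _ => h.hx u) fun u hu =>
      mul_pos (h.speed_pos u) (hnear u hu.1.le (hu.2.le.trans hte)).1
    rwa [hx0] at this
  set f : ℝ → ℝ := fun t => min (x t) (min (curv lam (r t) (x t) (ω t)) (ω t + π / 2)) with hf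
  have hfc : Continuous f := hx.min (hk.min (by fun_prop))
  have hfpos : ∀ t, 0 < f t → 0 < x t ∧ 0 < curv lam (r t) (x t) (ω t) ∧ -(π / 2) < ω t :=
    fun t ht => ⟨(lt_min_iff.mp ht).1, (lt_min_iff.mp (lt_min_iff.mp ht).2).1,
      by linarith [(lt_min_iff.mp (lt_min_iff.mp ht).2).2]⟩
  have hfnear : ∀ t, 0 < t → t ≤ ε → 0 < f t := fun t ht0 hte => by
    obtain ⟨-, h2, h3⟩ := hnear t ht0.le hte
    exact lt_min (hxnear t ht0 hte) (lt_min h2 (by linarith))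
  have key : ∀ T, 0 < T → (∀ t, 0 < t → t < T → 0 < f t) → Graphical lam r x ω T :=
    fun T hT hp => ⟨h, hlam, hT, hx0, hω0, fun t ht => (hfpos t (hp t ht.1 ht.2)).1,
      fun t ht => (hfpos t (hp t ht.1 ht.2)).2.1, fun t ht => (hfpos t (hp t ht.1 ht.2)).2.2⟩
  by_cases hall : ∀ t, ε ≤ t → 0 < f t
  · refine Or.inl fun T hT => key T hT fun t ht0 _ => ?_
    rcases le_total t ε with hle | hge
    · exact hfnear t ht0 hle
    · exact hall t hge
  · push Not at hall
    obtain ⟨q, hq, hfq⟩ := hall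
    obtain ⟨T, hεT, -, hT0, hT⟩ := exists_first_zero hfc (hfnear ε hε le_rfl) hq hfq
    refine Or.inr ⟨T, key T (hε.trans hεT) fun t ht0 htT => ?_, ?_⟩
    · rcases le_total t ε with hle | hge
      · exact hfnear t ht0 hle
      · exact hT t hge htT
    · rcases min_choice (x T) (min (curv lam (r T) (x T) (ω T)) (ω T + π / 2)) with h1 | h1
      · exact Or.inl (by rw [← h1]; exact hT0)
      · rcases min_choice (curv lam (r T) (x T) (ω T)) (ω T + π / 2) with h2 | h2
        · exact Or.inr (Or.inl (by rw [← h2, ← h1]; exact hT0))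
        · refine Or.inr (Or.inr ?_)
          have : ω T + π / 2 = 0 := by rw [← h2, ← h1]; exact hT0
          linarith

namespace Graphical

theorem ω_mem (h : Graphical lam r x ω T) {t : ℝ} (ht : t ∈ Icc 0 T) :
    ω t ∈ Icc (-(π / 2)) (π / 2) := by
  refine ⟨?_, by rw [← h.ω_zero]; exact h.ω_le le_rfl ht.1 ht.2⟩
  have hcl : Icc 0 T ⊆ closure (Ioo 0 T) := by rw [closure_Ioo h.T_pos.ne]
  exact closure_minimal (t := {t | -(π / 2) ≤ ω t}) (fun _ hu => (h.ω_gt _ hu).le)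
    (isClosed_le continuous_const h.continuous_ω) (hcl ht)

theorem curv_end_pos (h : Graphical lam r x ω T) {ρ : ℝ} (hρ : 0 < ρ)
    (hρc : 2 * ρ ≤ cylRadius lam) (ha : r 0 ≤ ρ / 2) (ha' : r 0 ≤ ρ * (lam - 1) / 32)
    (ha'' : 2 * ρ * r 0 ≤ lam - 1) (hxT : 0 < x T) : 0 < curv lam (r T) (x T) (ω T) := by
  have hT : T ∈ Icc 0 T := ⟨h.T_pos.le, le_rfl⟩
  rcases le_or_gt (ω T) 0 with hω | hω
  · obtain ⟨p, hp0, hpT, hp⟩ := h.exists_top hT hω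
    refine h.curv_pos_of_nonpos_angle h.lam_gt hpT hp.le
      (fun t ht => h.ω_mem ⟨hp0.le.trans ht.1, ht.2⟩) ?_
    have hxp : 0 < x p := by
      rcases hpT.eq_or_lt with rfl | hlt
      · exact hxT
      · exact h.x_pos p ⟨hp0, hlt⟩
    rw [curv_eq, hp, sin_zero, cos_zero]
    linarith
  · have hc := h.cos_pos' ⟨h.T_pos, le_rfl⟩ hω.le
    have hs : 0 < sin (ω T) := sin_pos_of_pos_of_lt_pi hω (by linarith [(h.ω_mem hT).2, pi_pos])
    rcases lt_or_ge (r T) (cylRadius lam) with hlt | hge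
    · rw [curv_eq]
      have := drift_pos h.lam_gt (h.pos T) hlt
      positivity
    · rw [curv_eq_intercept (h.pos T).ne' hc.ne']
      have h1 := h.intercept_pos hρ hT hω.le hxT (hρc.trans hge) ha ha' ha''
      have h2 := h.lam_gt
      have h3 := h.pos T
      have h4 : 0 < (lam - 1) * sin (ω T) / r T := div_pos (mul_pos (by linarith) hs) h3
      positivity

end Graphical

theorem exists_drift_ge (hlam : 1 < lam) (D : ℝ) : ∃ ρ > 0, D ≤ drift lam ρ := by
  have hD : 0 < max D 0 + 1 := by positivity
  have h1 : 0 < (lam - 1) / (max D 0 + 1) := div_pos (by linarith) hD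
  refine ⟨min 1 ((lam - 1) / (max D 0 + 1)), lt_min one_pos h1, ?_⟩
  set ρ := min 1 ((lam - 1) / (max D 0 + 1))
  have hρ : 0 < ρ := lt_min one_pos h1
  have h2 : max D 0 + 1 ≤ (lam - 1) / ρ := by
    have := min_le_right 1 ((lam - 1) / (max D 0 + 1))
    rw [le_div_iff₀ hD] at this
    rw [le_div_iff₀ hρ]
    linarith
  have h3 : ρ ≤ 1 := min_le_left _ _
  have h4 := le_max_left D 0
  unfold drift
  linarith

theorem eventually_weight_lt (hlam : 1 < lam) {c : ℝ} (hc : 0 < c) :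
    ∀ᶠ a in 𝓝[>] 0, weight lam a < c := by
  have h1 : Tendsto (fun a : ℝ => a ^ (lam - 1)) (𝓝[>] 0) (𝓝 0) := by
    have := (Real.continuousAt_rpow_const 0 (lam - 1) (Or.inr (by linarith))).tendsto
    rw [zero_rpow (by linarith)] at this
    exact this.mono_left nhdsWithin_le_nhds
  filter_upwards [h1.eventually (gt_mem_nhds hc), self_mem_nhdsWithin] with a ha ha0
  exact (weight_le hlam ha0 le_rfl).trans_lt ha

/-- Orbits starting close to the axis return to the half-line: they stay close to it, within a
bounded distance of the axis, and hit it at a small angle. -/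
theorem exists_lands_of_small (hlam : 1 < lam) : ∃ R > 0, ∀ ε > 0, ∃ a₂ > 0, ∀ a ∈ Ioo 0 a₂,
    ∃ S, Lands lam a S ∧ (∀ t ∈ Icc 0 S, hgt lam a t ≤ ε) ∧ rad lam a S ≤ R ∧
      1 - ε ≤ cos (ang lam a S) := by
  have hcyl := cylRadius_pos hlam
  set ρ := cylRadius lam / 4 with hρdef
  have hρ : 0 < ρ := by positivity
  set R₁ := max (2 / (ρ * (min (1 / 2) ((lam - 1) / 16) / 3)) + 2 * ρ) (cylRadius lam)
  have hR₁c : cylRadius lam ≤ R₁ := le_max_right _ _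
  have hR₁ : 0 < R₁ := hcyl.trans_le hR₁c
  set R := R₁ + π with hR
  have hRpos : 0 < R := by positivity
  set w := cylRadius lam ^ (lam - 1) * exp (-R ^ 2 / 4)
  have hw : 0 < w := mul_pos (rpow_pos_of_pos hcyl _) (exp_pos _)
  refine ⟨R, hRpos, fun ε hε => ?_⟩
  obtain ⟨ε', hε', hε'ε, hε'1⟩ : ∃ ε' > 0, ε' ≤ ε ∧ ε' < 1 :=
    ⟨min ε (1 / 2), by positivity, min_le_left _ _, (min_le_right _ _).trans_lt (by norm_num)⟩
  have hM : 0 < R ^ (lam - 1) * R := mul_pos (rpow_pos_of_pos hRpos _) hRpos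
  obtain ⟨η, hη, hηε, hηw⟩ : ∃ η > 0, η ≤ ε' ∧ η / 2 * R ^ (lam - 1) * R ≤ ε' * w := by
    refine ⟨min ε' (ε' * w / (R ^ (lam - 1) * R)), by positivity, min_le_left _ _, ?_⟩
    have := min_le_right ε' (ε' * w / (R ^ (lam - 1) * R))
    have h2 : 0 < min ε' (ε' * w / (R ^ (lam - 1) * R)) := by positivity
    rw [le_div_iff₀ hM] at this
    nlinarith
  obtain ⟨ρ', hρ', hd⟩ := exists_drift_ge hlam (π / η)
  have hd0 : 0 < drift lam ρ' := (by positivity : 0 < π / η).trans_le hd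
  have hd1 : π / (2 * drift lam ρ') ≤ η / 2 := by
    rw [div_le_iff₀ hη] at hd
    rw [div_le_iff₀ (by positivity)]
    linarith
  obtain ⟨k, hk, hk2, hkη⟩ : ∃ k > 0, k ≤ 1 / 2 ∧ 2 * k * R₁ ≤ η / 2 := by
    refine ⟨min (1 / 2) (η / (4 * R₁)), by positivity, min_le_left _ _, ?_⟩
    have := min_le_right (1 / 2) (η / (4 * R₁))
    rw [le_div_iff₀ (by positivity)] at this
    linarith
  have hlam' : 0 < lam - 1 := by linarith
  have hev : ∀ᶠ a in 𝓝[>] (0 : ℝ), weight lam a < k * weight lam ρ' ∧ a < ρ' ∧ a < ρ / 2 ∧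
      a < ρ * (lam - 1) / 32 ∧ a < (lam - 1) / (2 * ρ) := by
    refine (eventually_weight_lt hlam (mul_pos hk (weight_pos hρ'))).and (.filter_mono nhdsWithin_le_nhds ?_)
    exact (gt_mem_nhds hρ').and ((gt_mem_nhds (by positivity)).and
      ((gt_mem_nhds (by positivity)).and (gt_mem_nhds (by positivity))))
  obtain ⟨a₂, ha₂, hsub⟩ := mem_nhdsGT_iff_exists_Ioo_subset.mp hev
  refine ⟨a₂, ha₂, fun a ha => ?_⟩
  obtain ⟨hwa, haρ', ha1, ha2, ha3⟩ := hsub ha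
  have ha3' : 2 * ρ * a ≤ lam - 1 := by
    rw [lt_div_iff₀ (by positivity)] at ha3
    linarith
  have hT := traj_rad (lam := lam) ha.1
  have hac : a < cylRadius lam := by linarith
  have hk0 : 0 < curv lam (rad lam a 0) (hgt lam a 0) (ang lam a 0) := by
    rw [curv_eq]
    simpa using drift_pos hlam ha.1 hac
  have hbd : ∀ T, Graphical lam (rad lam a) (hgt lam a) (ang lam a) T →
      (∀ t ∈ Icc 0 T, hgt lam a t ≤ η) ∧ ∀ t ∈ Icc 0 T, rad lam a t ≤ R := fun T hG => by
    have hr1 : ∀ u ∈ Icc 0 T, 0 ≤ ang lam a u → rad lam a u ≤ R₁ := fun u hu hωu =>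
      (hG.r_le_of_ascending hρ hu hωu (by simpa using ha1.le) (by simpa using ha2.le)
        (by simpa using ha3')).trans (le_max_left _ _)
    refine ⟨fun t ht => ?_, fun t ht => hG.r_le_add_pi ht hR₁c hr1⟩
    have := hG.x_le ht (by simpa using haρ') hd0 hk2 (by simpa using hwa.le) hr1
    linarith
  have hsin : ∀ T, Graphical lam (rad lam a) (hgt lam a) (ang lam a) T →
      cylRadius lam ≤ rad lam a T → -ε' ≤ sin (ang lam a T) := fun T hG hge => by
    have hTm : T ∈ Icc 0 T := ⟨hG.T_pos.le, le_rfl⟩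
    have h1 := hG.le_sin_mul_weight hTm (hbd T hG).1 ((hbd T hG).2 T hTm)
    have h2 : w ≤ weight lam (rad lam a T) := le_weight hlam hcyl hge ((hbd T hG).2 T hTm)
    by_contra hlt
    push Not at hlt
    nlinarith
  rcases hT.graphical_dichotomy hlam (hgt_zero _ _) (ang_zero _ _) hk0 with hall | ⟨S, hG, hS⟩
  · refine (hT.not_eternal hlam (hgt_zero _ _) (ang_zero _ _) hk0 (X := η) (fun t ht => ?_)
      (fun t ht => ?_) fun t ht => ?_).elim
    all_goals have hG := hall (t + 1) (by linarith)
    all_goals have htm : t ∈ Icc 0 (t + 1) := ⟨ht, by linarith⟩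
    · exact ⟨hG.x_nonneg htm, (hbd _ hG).1 t htm⟩
    · exact hG.ω_mem htm
    · exact hG.curv_nonneg htm
  · have hSm : S ∈ Icc 0 S := ⟨hG.T_pos.le, le_rfl⟩
    have hω : ang lam a S ≠ -(π / 2) := fun hω => by
      have h1 := hG.curv_nonneg hSm
      rw [curv_eq, hω, sin_neg, cos_neg, sin_pi_div_two, cos_pi_div_two] at h1
      have h2 : cylRadius lam ≤ rad lam a S := by
        by_contra hlt
        push Not at hlt
        linarith [drift_pos hlam (hT.pos S) hlt]
      have h3 := hsin S hG h2
      rw [hω, sin_neg, sin_pi_div_two] at h3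
      linarith
    have hx0 : hgt lam a S = 0 := by
      by_contra hne
      have hxS : 0 < hgt lam a S := lt_of_le_of_ne (hG.x_nonneg hSm) (Ne.symm hne)
      have hkS := hG.curv_end_pos hρ (by linarith) (by simpa using ha1.le) (by simpa using ha2.le)
        (by simpa using ha3') hxS
      rcases hS with h1 | h1 | h1
      · exact hne h1
      · exact hkS.ne' h1
      · exact hω h1
    have hA : Arc lam (rad lam a) (hgt lam a) (ang lam a) S :=
      ⟨hT, hlam, hG.T_pos, hgt_zero _ _, ang_zero _ _, hx0, hG.x_pos, fun t ht => hG.ω_mem ht⟩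
    have hωm := (hA.ω_mem S hSm)
    have hωlt : -(π / 2) < ang lam a S := lt_of_le_of_ne hωm.1 (Ne.symm hω)
    refine ⟨S, ⟨ha.1, hA, hωlt⟩, fun t ht => ((hbd S hG).1 t ht).trans (hηε.trans hε'ε),
      (hbd S hG).2 S hSm, ?_⟩
    have hsneg : sin (ang lam a S) < 0 :=
      sin_neg_of_neg_of_neg_pi_lt hA.ω_S_neg (by linarith [pi_pos])
    have hge : cylRadius lam ≤ rad lam a S := by
      by_contra hlt
      push Not at hlt
      have h1 := hA.curv_pos hSm
      rw [curv_eq, hx0] at h1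
      nlinarith [drift_pos hlam (hT.pos S) hlt]
    have h3 := hsin S hG hge
    have hc0 : 0 ≤ cos (ang lam a S) := cos_nonneg_of_mem_Icc hωm
    nlinarith [sin_sq_add_cos_sq (ang lam a S), cos_le_one (ang lam a S)]

end

section
open Set Filter Topology

theorem hasStrictFDerivAt_of_partials {E : Type*} [NormedAddCommGroup E] [NormedSpace ℝ E]
    {f f₁ f₂ : ℝ → ℝ → E} {a t : ℝ}
    (h₁ : ∀ᶠ p : ℝ × ℝ in 𝓝 (a, t), HasDerivAt (fun b => f b p.2) (f₁ p.1 p.2) p.1)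
    (h₂ : ∀ᶠ p : ℝ × ℝ in 𝓝 (a, t), HasDerivAt (f p.1) (f₂ p.1 p.2) p.2)
    (c₁ : ContinuousAt (fun p : ℝ × ℝ => f₁ p.1 p.2) (a, t))
    (c₂ : ContinuousAt (fun p : ℝ × ℝ => f₂ p.1 p.2) (a, t)) :
    HasStrictFDerivAt (fun p : ℝ × ℝ => f p.1 p.2)
      ((ContinuousLinearMap.toSpanSingleton ℝ (f₁ a t)).coprod
        (ContinuousLinearMap.toSpanSingleton ℝ (f₂ a t))) (a, t) := by
  have hc : Continuous fun v : E => ContinuousLinearMap.toSpanSingleton ℝ v :=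
    (ContinuousLinearMap.toSpanSingletonCLE (𝕜 := ℝ) (E := E)).continuous
  exact hasStrictFDerivAt_uncurry_coprod (f := f)
    (f₁ := fun b s => ContinuousLinearMap.toSpanSingleton ℝ (f₁ b s))
    (f₂ := fun b s => ContinuousLinearMap.toSpanSingleton ℝ (f₂ b s))
    (h₁.mono fun _ h => h.hasFDerivAt) (h₂.mono fun _ h => h.hasFDerivAt)
    (hc.continuousAt.comp c₁) (hc.continuousAt.comp c₂)

theorem hasDerivAt_along {E : Type*} [NormedAddCommGroup E] [NormedSpace ℝ E]
    {f f₁ f₂ : ℝ → ℝ → E} {a : ℝ} {τ : ℝ → ℝ} {τ' : ℝ}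
    (h₁ : ∀ᶠ p : ℝ × ℝ in 𝓝 (a, τ a), HasDerivAt (fun b => f b p.2) (f₁ p.1 p.2) p.1)
    (h₂ : ∀ᶠ p : ℝ × ℝ in 𝓝 (a, τ a), HasDerivAt (f p.1) (f₂ p.1 p.2) p.2)
    (c₁ : ContinuousAt (fun p : ℝ × ℝ => f₁ p.1 p.2) (a, τ a))
    (c₂ : ContinuousAt (fun p : ℝ × ℝ => f₂ p.1 p.2) (a, τ a)) (hτ : HasDerivAt τ τ' a) :
    HasDerivAt (fun b => f b (τ b)) (f₁ a (τ a) + τ' • f₂ a (τ a)) a := by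
  have h := (hasStrictFDerivAt_of_partials h₁ h₂ c₁ c₂).hasFDerivAt
  have := HasFDerivAt.comp_hasDerivAt (l := fun p : ℝ × ℝ => f p.1 p.2) a h
    ((hasDerivAt_id a).prodMk hτ)
  refine this.congr_deriv ?_
  simp

theorem hasDerivAt_implicit {f f₁ f₂ : ℝ → ℝ → ℝ} {a : ℝ} {τ : ℝ → ℝ}
    (h₁ : ∀ᶠ p : ℝ × ℝ in 𝓝 (a, τ a), HasDerivAt (fun b => f b p.2) (f₁ p.1 p.2) p.1)
    (h₂ : ∀ᶠ p : ℝ × ℝ in 𝓝 (a, τ a), HasDerivAt (f p.1) (f₂ p.1 p.2) p.2)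
    (c₁ : ContinuousAt (fun p : ℝ × ℝ => f₁ p.1 p.2) (a, τ a))
    (c₂ : ContinuousAt (fun p : ℝ × ℝ => f₂ p.1 p.2) (a, τ a)) (hτ : ContinuousAt τ a)
    (hz : ∀ᶠ b in 𝓝 a, f b (τ b) = f a (τ a)) (hne : f₂ a (τ a) ≠ 0) :
    HasDerivAt τ (-(f₁ a (τ a) / f₂ a (τ a))) a := by
  have h := hasStrictFDerivAt_of_partials h₁ h₂ c₁ c₂
  set L := (ContinuousLinearMap.toSpanSingleton ℝ (f₁ a (τ a))).coprod
        (ContinuousLinearMap.toSpanSingleton ℝ (f₂ a (τ a))) with hL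
  have hinv : (L ∘L .inr ℝ ℝ ℝ).IsInvertible := by
    refine ⟨ContinuousLinearEquiv.unitsEquivAut ℝ (Units.mk0 _ hne), ?_⟩
    ext
    simp [hL]
  have hd := (h.hasStrictFDerivAt_implicitFunctionOfProdDomain hinv).hasFDerivAt.hasDerivAt
  have hev := h.eventually_apply_eq_iff_implicitFunctionOfProdDomain hinv
  have ht : Tendsto (fun b => (b, τ b)) (𝓝 a) (𝓝 (a, τ a)) := tendsto_id.prodMk_nhds hτ
  have heq : τ =ᶠ[𝓝 a] h.implicitFunctionOfProdDomain hinv := by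
    filter_upwards [ht.eventually hev, hz] with b hb hzb
    exact (hb.mp hzb).symm
  have hτ' := hd.congr_of_eventuallyEq heq
  have hcomp := hasDerivAt_along h₁ h₂ c₁ c₂ hτ'
  have h0 := hcomp.unique ((hasDerivAt_const a (f a (τ a))).congr_of_eventuallyEq hz)
  rw [smul_eq_mul] at h0
  refine hτ'.congr_deriv ?_
  rw [eq_neg_iff_add_eq_zero, ← mul_left_inj' hne, add_mul, div_mul_cancel₀ _ hne]
  linarith

theorem exists_variation_orbit (lam : ℝ) : ∃ V : ℝ → ℝ → ℝ × ℝ × ℝ,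
    (∀ a t, 0 ≤ t → HasDerivAt (fun b => orbit lam b t) (V a t) a) ∧
    ContinuousOn (fun p : ℝ × ℝ => V p.1 p.2) (univ ×ˢ Ici 0) ∧ (∀ a, V a 0 = (1, 0, 0)) ∧
    ∀ a t, 0 < t → HasDerivAt (V a) (fderiv ℝ (field lam) (orbit lam a t) (V a t)) t := by
  obtain ⟨K, hK, hL⟩ := exists_field_bounds lam
  exact exists_variation_field (y₀ := (0, 0, π / 2)) (contDiff_field lam) hK hL (hasDerivAt_orbit lam)
    (fun a => by simp [orbit_zero])

/-- The derivative of `orbit` with respect to its starting point. -/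
noncomputable def variation (lam : ℝ) : ℝ → ℝ → ℝ × ℝ × ℝ := (exists_variation_orbit lam).choose

variable {lam : ℝ}

theorem hasDerivAt_orbit_param (a : ℝ) {t : ℝ} (ht : 0 ≤ t) :
    HasDerivAt (fun b => orbit lam b t) (variation lam a t) a :=
  (exists_variation_orbit lam).choose_spec.1 a t ht

theorem continuousOn_variation (lam : ℝ) :
    ContinuousOn (fun p : ℝ × ℝ => variation lam p.1 p.2) (univ ×ˢ Ici 0) :=
  (exists_variation_orbit lam).choose_spec.2.1

theorem variation_zero (a : ℝ) : variation lam a 0 = (1, 0, 0) :=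
  (exists_variation_orbit lam).choose_spec.2.2.1 a

theorem hasDerivAt_variation (a : ℝ) {t : ℝ} (ht : 0 < t) : HasDerivAt (variation lam a)
    (fderiv ℝ (field lam) (orbit lam a t) (variation lam a t)) t :=
  (exists_variation_orbit lam).choose_spec.2.2.2 a t ht

theorem continuousAt_variation (a : ℝ) {t : ℝ} (ht : 0 < t) :
    ContinuousAt (fun p : ℝ × ℝ => variation lam p.1 p.2) (a, t) :=
  (continuousOn_variation lam).continuousAt (prod_mem_nhds univ_mem (Ici_mem_nhds ht))

/-- The velocity of an orbit at the time it hits the half-line does not vanish to first order. -/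
theorem variation_add_ne_zero (a : ℝ) {t : ℝ} (ht : 0 < t) (c : ℝ) :
    variation lam a t + c • field lam (orbit lam a t) ≠ 0 := by
  intro h0
  obtain ⟨K, hK, -⟩ := exists_field_bounds lam
  have hfd : ∀ s, HasDerivAt (fun s => field lam (orbit lam a s))
      (fderiv ℝ (field lam) (orbit lam a s) (field lam (orbit lam a s))) s := fun s =>
    (((contDiff_field (n := 1) lam).differentiable one_ne_zero).differentiableAt.hasFDerivAt).comp_hasDerivAt
      s (hasDerivAt_orbit lam a s)
  have hcv : ContinuousOn (variation lam a) (Icc 0 t) :=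
    (continuousOn_variation lam).comp (f := fun s : ℝ => (a, s)) (by fun_prop)
      fun s hs => ⟨trivial, hs.1⟩
  have hcf : Continuous fun s => field lam (orbit lam a s) :=
    continuous_iff_continuousAt.mpr fun s => (hfd s).continuousAt
  have := ODE_solution_unique_of_mem_Icc_left (a := 0) (b := t) (K := K) (s := fun _ => univ)
    (v := fun s u => fderiv ℝ (field lam) (orbit lam a s) u)
    (f := fun s => variation lam a s + c • field lam (orbit lam a s)) (g := fun _ => 0)
    (fun s _ => (((fderiv ℝ (field lam) (orbit lam a s)).lipschitz).weaken
      (norm_fderiv_le_of_lipschitz ℝ hK)).lipschitzOnWith)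
    (hcv.add (hcf.const_smul c).continuousOn)
    (fun s hs => by
      refine (((hasDerivAt_variation a hs.1).add ((hfd s).const_smul c)).congr_deriv ?_).hasDerivWithinAt
      simp only [map_add, map_smul])
    (fun _ _ => trivial) continuousOn_const
    (fun s _ => by simpa using hasDerivWithinAt_const s (Iic s) (0 : ℝ × ℝ × ℝ))
    (fun _ _ => trivial) h0
  have h1 := this ⟨le_rfl, ht.le⟩
  simp only [variation_zero, orbit_zero, field] at h1
  have := congrArg Prod.fst h1
  simp at this

end

section
open Set Filter Topology

variable {lam : ℝ}

/-- The conformal factor of the metric. -/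
noncomputable def dens (lam r x : ℝ) : ℝ := r ^ (lam - 1) * exp (-(r ^ 2 + x ^ 2) / 4)

theorem dens_zero (r : ℝ) : dens lam r 0 = weight lam r := by simp [dens, weight]

theorem dens_le_weight {r x : ℝ} (hr : 0 < r) : dens lam r x ≤ weight lam r := by
  unfold dens weight
  gcongr
  nlinarith [sq_nonneg x]

theorem hasDerivAt_dens {r x : ℝ → ℝ} {r' x' t : ℝ} (hr : HasDerivAt r r' t)
    (hx : HasDerivAt x x' t) (hpos : 0 < r t) : HasDerivAt (fun t => dens lam (r t) (x t))
      (dens lam (r t) (x t) * (drift lam (r t) * r' - x t / 2 * x')) t := by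
  have h1 := hr.rpow_const (p := lam - 1) (Or.inl hpos.ne')
  have h2 := (((hr.fun_pow 2).fun_add (hx.fun_pow 2)).fun_neg.div_const 4).exp
  refine (h1.mul h2).congr_deriv ?_
  have h3 : r t ^ (lam - 1 - 1) = r t ^ (lam - 1) / r t := by
    rw [rpow_sub_one hpos.ne']
  rw [h3]
  unfold dens drift
  norm_num
  field_simp
  ring

/-- The derivative of `speed` at `(r, x)` in the direction `(v, w)`. -/
noncomputable def speedDeriv (r x v w : ℝ) : ℝ :=
  (v * (1 + r ^ 2 + x ^ 2) - r * (2 * r * v + 2 * x * w)) / (1 + r ^ 2 + x ^ 2) ^ 2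

theorem hasDerivAt_speed {r x : ℝ → ℝ} {r' x' t : ℝ} (hr : HasDerivAt r r' t)
    (hx : HasDerivAt x x' t) :
    HasDerivAt (fun t => speed (r t) (x t)) (speedDeriv (r t) (x t) r' x') t := by
  have h1 : HasDerivAt (fun t => 1 + r t ^ 2 + x t ^ 2) (2 * r t * r' + 2 * x t * x') t :=
    (((hr.fun_pow 2).const_add 1).fun_add (hx.fun_pow 2)).congr_deriv (by norm_num)
  exact hr.fun_div h1 (by positivity)

theorem hasDerivAt_rad_param (a : ℝ) {t : ℝ} (ht : 0 ≤ t) :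
    HasDerivAt (fun b => rad lam b t) (variation lam a t).1 a :=
  hasDerivAt_fst_comp (hasDerivAt_orbit_param a ht)

theorem hasDerivAt_hgt_param (a : ℝ) {t : ℝ} (ht : 0 ≤ t) :
    HasDerivAt (fun b => hgt lam b t) (variation lam a t).2.1 a :=
  hasDerivAt_fst_comp (hasDerivAt_snd_comp (hasDerivAt_orbit_param a ht))

theorem fderiv_field_apply (y v : ℝ × ℝ × ℝ) : (fderiv ℝ (field lam) y v).1 =
      speedDeriv y.1 y.2.1 v.1 v.2.1 * cos y.2.2 - speed y.1 y.2.1 * sin y.2.2 * v.2.2 ∧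
    (fderiv ℝ (field lam) y v).2.1 =
      speedDeriv y.1 y.2.1 v.1 v.2.1 * sin y.2.2 + speed y.1 y.2.1 * cos y.2.2 * v.2.2 := by
  have hline : HasDerivAt (fun s : ℝ => y + s • v) v 0 := by
    simpa using ((hasDerivAt_id (0 : ℝ)).smul_const v).const_add y
  have hf : HasFDerivAt (field lam) (fderiv ℝ (field lam) y) (y + (0 : ℝ) • v) := by
    rw [zero_smul, add_zero]
    exact ((contDiff_field (n := 1) lam).differentiable one_ne_zero).differentiableAt.hasFDerivAt
  have h := hf.comp_hasDerivAt (0 : ℝ) hline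
  have h1 := hasDerivAt_fst_comp hline
  have h2 := hasDerivAt_fst_comp (hasDerivAt_snd_comp hline)
  have h3 := hasDerivAt_snd_comp (hasDerivAt_snd_comp hline)
  have hs := hasDerivAt_speed h1 h2
  constructor
  · refine (hasDerivAt_fst_comp h).unique ((hs.fun_mul h3.cos).congr_deriv ?_)
    simp only [zero_smul, add_zero]
    ring
  · refine (hasDerivAt_fst_comp (hasDerivAt_snd_comp h)).unique
      ((hs.fun_mul h3.sin).congr_deriv ?_)
    simp only [zero_smul, add_zero]
    ring

/-- The density of `g`-length along `orbit lam a`. -/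
noncomputable def lengthDens (lam a t : ℝ) : ℝ :=
  dens lam (rad lam a t) (hgt lam a t) * speed (rad lam a t) (hgt lam a t)

theorem continuous_lengthDens (hlam : 1 < lam) :
    Continuous fun p : ℝ × ℝ => lengthDens lam p.1 p.2 := by
  have h1 := continuous_rad lam
  have h2 := continuous_hgt lam
  have h3 : Continuous fun p : ℝ × ℝ => rad lam p.1 p.2 ^ (lam - 1) :=
    h1.rpow_const fun _ => Or.inr (by linarith)
  unfold lengthDens dens speed
  exact (h3.mul (by fun_prop)).mul (h1.div (by fun_prop) fun p => by positivity)

/-- The derivative of `lengthDens` with respect to the starting point. -/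
noncomputable def lengthDensDeriv (lam a t : ℝ) : ℝ :=
  dens lam (rad lam a t) (hgt lam a t) * (drift lam (rad lam a t) * (variation lam a t).1 -
      hgt lam a t / 2 * (variation lam a t).2.1) * speed (rad lam a t) (hgt lam a t) +
    dens lam (rad lam a t) (hgt lam a t) *
      speedDeriv (rad lam a t) (hgt lam a t) (variation lam a t).1 (variation lam a t).2.1

theorem hasDerivAt_lengthDens_param {a : ℝ} (ha : 0 < a) {t : ℝ} (ht : 0 ≤ t) :
    HasDerivAt (fun b => lengthDens lam b t) (lengthDensDeriv lam a t) a :=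
  (hasDerivAt_dens (hasDerivAt_rad_param a ht) (hasDerivAt_hgt_param a ht)
    ((traj_rad (lam := lam) ha).pos t)).fun_mul
      (hasDerivAt_speed (hasDerivAt_rad_param a ht) (hasDerivAt_hgt_param a ht))

theorem continuousOn_lengthDensDeriv (hlam : 1 < lam) :
    ContinuousOn (fun p : ℝ × ℝ => lengthDensDeriv lam p.1 p.2) (Ioi 0 ×ˢ Ici 0) := by
  have h1 := (continuous_rad lam).continuousOn (s := Ioi 0 ×ˢ Ici 0)
  have h2 := (continuous_hgt lam).continuousOn (s := Ioi 0 ×ˢ Ici 0)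
  have hV : ContinuousOn (fun p : ℝ × ℝ => variation lam p.1 p.2) (Ioi 0 ×ˢ Ici 0) :=
    (continuousOn_variation lam).mono (prod_mono (subset_univ _) subset_rfl)
  have h3 : ContinuousOn (fun p : ℝ × ℝ => (variation lam p.1 p.2).1) (Ioi 0 ×ˢ Ici 0) := hV.fst
  have h4 : ContinuousOn (fun p : ℝ × ℝ => (variation lam p.1 p.2).2.1) (Ioi 0 ×ˢ Ici 0) :=
    hV.snd.fst
  have h5 : ContinuousOn (fun p : ℝ × ℝ => rad lam p.1 p.2 ^ (lam - 1)) (Ioi 0 ×ˢ Ici 0) :=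
    h1.rpow_const fun _ _ => Or.inr (by linarith)
  have h6 : ContinuousOn (fun p : ℝ × ℝ => (lam - 1) / rad lam p.1 p.2) (Ioi 0 ×ˢ Ici 0) :=
    continuousOn_const.div h1 fun p hp => ((traj_rad (lam := lam) hp.1).pos p.2).ne'
  have h7 : ContinuousOn (fun p : ℝ × ℝ => speed (rad lam p.1 p.2) (hgt lam p.1 p.2))
      (Ioi 0 ×ˢ Ici 0) := by
    unfold speed
    exact h1.div (by fun_prop) fun p _ => by positivity
  have h8 : ContinuousOn (fun p : ℝ × ℝ => speedDeriv (rad lam p.1 p.2) (hgt lam p.1 p.2)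
      (variation lam p.1 p.2).1 (variation lam p.1 p.2).2.1) (Ioi 0 ×ˢ Ici 0) := by
    unfold speedDeriv
    exact ContinuousOn.div (by fun_prop) (by fun_prop) fun p _ => by positivity
  unfold lengthDensDeriv dens drift
  fun_prop

/-- The boundary term in the first variation of `g`-length. -/
noncomputable def boundaryTerm (lam a t : ℝ) : ℝ :=
  dens lam (rad lam a t) (hgt lam a t) *
    (cos (ang lam a t) * (variation lam a t).1 + sin (ang lam a t) * (variation lam a t).2.1)

theorem continuousOn_boundaryTerm (hlam : 1 < lam) :
    ContinuousOn (fun p : ℝ × ℝ => boundaryTerm lam p.1 p.2) (univ ×ˢ Ici 0) := by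
  have h1 := (continuous_rad lam).continuousOn (s := univ ×ˢ Ici 0)
  have h2 := (continuous_hgt lam).continuousOn (s := univ ×ˢ Ici 0)
  have h3 := (continuous_ang lam).continuousOn (s := univ ×ˢ Ici 0)
  have hV := continuousOn_variation lam
  have h4 : ContinuousOn (fun p : ℝ × ℝ => (variation lam p.1 p.2).1) (univ ×ˢ Ici 0) := hV.fst
  have h5 : ContinuousOn (fun p : ℝ × ℝ => (variation lam p.1 p.2).2.1) (univ ×ˢ Ici 0) :=
    hV.snd.fst
  have h6 : ContinuousOn (fun p : ℝ × ℝ => rad lam p.1 p.2 ^ (lam - 1)) (univ ×ˢ Ici 0) :=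
    h1.rpow_const fun _ _ => Or.inr (by linarith)
  unfold boundaryTerm dens
  fun_prop

theorem hasDerivAt_boundaryTerm {a : ℝ} (ha : 0 < a) {t : ℝ} (ht : 0 < t) :
    HasDerivAt (boundaryTerm lam a) (lengthDensDeriv lam a t) t := by
  have hT := traj_rad (lam := lam) ha
  have hV := hasDerivAt_variation (lam := lam) a ht
  have hV1 := hasDerivAt_fst_comp hV
  have hV2 := hasDerivAt_fst_comp (hasDerivAt_snd_comp hV)
  obtain ⟨e1, e2⟩ : _ = speedDeriv (rad lam a t) (hgt lam a t) (variation lam a t).1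
          (variation lam a t).2.1 * cos (ang lam a t) -
        speed (rad lam a t) (hgt lam a t) * sin (ang lam a t) * (variation lam a t).2.2 ∧
      _ = speedDeriv (rad lam a t) (hgt lam a t) (variation lam a t).1
          (variation lam a t).2.1 * sin (ang lam a t) +
        speed (rad lam a t) (hgt lam a t) * cos (ang lam a t) * (variation lam a t).2.2 :=
    fderiv_field_apply (lam := lam) (orbit lam a t) (variation lam a t)
  rw [e1] at hV1
  rw [e2] at hV2
  refine ((hasDerivAt_dens (hT.hr t) (hT.hx t) (hT.pos t)).fun_mul
    (((hT.hasDerivAt_cos t).fun_mul hV1).fun_add ((hT.hasDerivAt_sin t).fun_mul hV2))).congr_deriv ?_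
  rw [lengthDensDeriv, curv_eq]
  linear_combination dens lam (rad lam a t) (hgt lam a t) * (speed (rad lam a t) (hgt lam a t) *
    drift lam (rad lam a t) * (variation lam a t).1 - speed (rad lam a t) (hgt lam a t) *
    (hgt lam a t / 2) * (variation lam a t).2.1 + speedDeriv (rad lam a t) (hgt lam a t)
    (variation lam a t).1 (variation lam a t).2.1) * sin_sq_add_cos_sq (ang lam a t)

/-- The `g`-length of `orbit lam a` between times `0` and `t`. -/
noncomputable def arcLength (lam a t : ℝ) : ℝ := ∫ s in (0 : ℝ)..t, lengthDens lam a s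

theorem hasDerivAt_arcLength (hlam : 1 < lam) (a t : ℝ) :
    HasDerivAt (arcLength lam a) (lengthDens lam a t) t := by
  have hc : Continuous (lengthDens lam a) :=
    (continuous_lengthDens hlam).comp (by fun_prop : Continuous fun t : ℝ => (a, t))
  exact intervalIntegral.integral_hasDerivAt_right (hc.intervalIntegrable _ _)
    (hc.stronglyMeasurableAtFilter _ _) hc.continuousAt

/-- First variation of `g`-length. -/
theorem hasDerivAt_arcLength_param (hlam : 1 < lam) {a : ℝ} (ha : 0 < a) {t : ℝ} (ht : 0 ≤ t) :
    HasDerivAt (fun b => arcLength lam b t) (boundaryTerm lam a t) a := by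
  have hcL : ∀ b, Continuous (lengthDens lam b) := fun b =>
    (continuous_lengthDens hlam).comp (by fun_prop : Continuous fun t : ℝ => (b, t))
  have hcD : ContinuousOn (lengthDensDeriv lam a) (Icc 0 t) :=
    (continuousOn_lengthDensDeriv hlam).comp (f := fun s : ℝ => (a, s)) (by fun_prop)
      fun s hs => ⟨ha, hs.1⟩
  obtain ⟨M, hM⟩ := (isCompact_Icc (a := a / 2) (b := 3 * a / 2)).prod (isCompact_Icc (a := 0) (b := t))
    |>.exists_bound_of_continuousOn ((continuousOn_lengthDensDeriv hlam).mono fun p hp =>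
      ⟨lt_of_lt_of_le (by positivity : 0 < a / 2) hp.1.1, hp.2.1⟩)
  have hu : uIoc 0 t ⊆ Icc 0 t := by
    rw [uIoc_of_le ht]
    exact Ioc_subset_Icc_self
  have hmain := intervalIntegral.hasDerivAt_integral_of_dominated_loc_of_deriv_le (μ := volume)
    (a := 0) (b := t) (F := lengthDens lam) (F' := lengthDensDeriv lam) (bound := fun _ => M)
    (Icc_mem_nhds (by linarith : a / 2 < a) (by linarith : a < 3 * a / 2))
    (Eventually.of_forall fun b => (hcL b).aestronglyMeasurable)
    ((hcL a).intervalIntegrable _ _)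
    ((hcD.mono hu).aestronglyMeasurable measurableSet_uIoc)
    (Eventually.of_forall fun s hs b hb => hM (b, s) ⟨hb, hu hs⟩)
    intervalIntegrable_const
    (Eventually.of_forall fun s hs b hb => hasDerivAt_lengthDens_param
      (lt_of_lt_of_le (by positivity : 0 < a / 2) hb.1) (hu hs).1)
  refine hmain.2.congr_deriv ?_
  rw [intervalIntegral.integral_eq_sub_of_hasDerivAt_of_le ht
    ((continuousOn_boundaryTerm hlam).comp (f := fun s : ℝ => (a, s)) (by fun_prop)
      fun s hs => ⟨trivial, hs.1⟩) (fun s hs => hasDerivAt_boundaryTerm ha hs.1) hmain.1]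
  simp [boundaryTerm, variation_zero]

end

section
open Set Filter Topology

variable {lam : ℝ}

/-- The orbit starting at distance `a` from the axis first returns to the half-line at time `S`,
transversally. -/
structure Hits (lam a S : ℝ) : Prop where
  pos : 0 < a
  time_pos : 0 < S
  hgt_pos : ∀ t ∈ Ioo 0 S, 0 < hgt lam a t
  hgt_eq : hgt lam a S = 0
  sin_neg : sin (ang lam a S) < 0

theorem Arc.hits {a S : ℝ} (h : Arc lam (rad lam a) (hgt lam a) (ang lam a) S) : Hits lam a S := by
  have ha := h.pos 0
  rw [rad_zero] at ha
  have hm := h.ω_mem S ⟨h.S_pos.le, le_rfl⟩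
  exact ⟨ha, h.S_pos, h.x_pos, h.x_S,
    sin_neg_of_neg_of_neg_pi_lt h.ω_S_neg (by linarith [hm.1, pi_pos])⟩

theorem Hits.unique {a S S' : ℝ} (h : Hits lam a S) (h' : Hits lam a S') : S = S' := by
  rcases lt_trichotomy S S' with hlt | heq | hlt
  · exact absurd h.hgt_eq (h'.hgt_pos S ⟨h.time_pos, hlt⟩).ne'
  · exact heq
  · exact absurd h'.hgt_eq (h.hgt_pos S' ⟨h'.time_pos, hlt⟩).ne'

open Classical in
/-- The time at which the orbit starting at distance `a` from the axis returns to the half-line. -/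
noncomputable def hitTime (lam a : ℝ) : ℝ := if h : ∃ S, Hits lam a S then h.choose else 0

theorem Hits.hitTime_eq {a S : ℝ} (h : Hits lam a S) : hitTime lam a = S := by
  have hex : ∃ S, Hits lam a S := ⟨S, h⟩
  rw [hitTime, dif_pos hex]
  exact hex.choose_spec.unique h

theorem Hits.hitTime {a S : ℝ} (h : Hits lam a S) : Hits lam a (hitTime lam a) := by
  rwa [h.hitTime_eq]

theorem Hits.eventually {a S : ℝ} (h : Hits lam a S) {η : ℝ} (hη : 0 < η) :
    ∀ᶠ b in 𝓝 a, ∃ T, |T - S| < η ∧ Hits lam b T := by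
  have hcs : Continuous fun p : ℝ × ℝ => sin (ang lam p.1 p.2) :=
    continuous_sin.comp (continuous_ang lam)
  obtain ⟨ε, hε, h1⟩ := exists_eventually_forall_pos hcs.neg (a₀ := a) (t₀ := S)
    (by simpa using h.sin_neg)
  filter_upwards [h1, eventually_landing h.pos h.time_pos h.hgt_pos h.hgt_eq h.sin_neg
    (lt_min hη hε), lt_mem_nhds h.pos] with b h1 ⟨T, hT, hTS, hx, hx0⟩ hb
  refine ⟨T, hTS.trans_le (min_le_left _ _), hb, hT, hx, hx0, ?_⟩
  have h2 := abs_lt.mp (hTS.trans_le (min_le_right _ _))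
  exact neg_pos.mp (h1 T ⟨by linarith, by linarith⟩)

theorem Hits.continuousAt_hitTime {a S : ℝ} (h : Hits lam a S) :
    ContinuousAt (Angenent.hitTime lam) a := by
  rw [Metric.continuousAt_iff']
  intro η hη
  filter_upwards [h.eventually hη] with b ⟨T, hT, hb⟩
  rwa [hb.hitTime_eq, h.hitTime_eq]

/-- The derivative of `hitTime`. -/
noncomputable def hitTimeDeriv (lam a : ℝ) : ℝ :=
  -((variation lam a (hitTime lam a)).2.1 / (field lam (orbit lam a (hitTime lam a))).2.1)

/-- The point and tangent angle with which the orbit returns to the half-line. -/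
noncomputable def landing (lam a : ℝ) : ℝ × ℝ × ℝ := orbit lam a (hitTime lam a)

/-- The derivative of `landing`. -/
noncomputable def landingDeriv (lam a : ℝ) : ℝ × ℝ × ℝ :=
  variation lam a (hitTime lam a) + hitTimeDeriv lam a • field lam (landing lam a)

theorem continuous_field_orbit (lam : ℝ) :
    Continuous fun p : ℝ × ℝ => field lam (orbit lam p.1 p.2) :=
  (contDiff_field (n := 1) lam).continuous.comp (continuous_orbit lam)

theorem Hits.field_ne_zero {a S : ℝ} (h : Hits lam a S) : (field lam (orbit lam a S)).2.1 ≠ 0 := by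
  have hT := traj_rad (lam := lam) h.pos
  have : (field lam (orbit lam a S)).2.1 = speed (rad lam a S) (hgt lam a S) * sin (ang lam a S) :=
    congrArg (fun y => y.2.1) (field_eq (hT.pos S).ne')
  rw [this]
  exact mul_ne_zero (hT.speed_pos S).ne' h.sin_neg.ne

theorem eventually_snd_pos {a t : ℝ} (ht : 0 < t) : ∀ᶠ p : ℝ × ℝ in 𝓝 (a, t), 0 < p.2 :=
  continuous_snd.continuousAt.eventually (lt_mem_nhds ht)

theorem Hits.hasDerivAt_hitTime {a S : ℝ} (h : Hits lam a S) :
    HasDerivAt (Angenent.hitTime lam) (hitTimeDeriv lam a) a := by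
  have h' := h.hitTime
  have hpos := eventually_snd_pos (a := a) h'.time_pos
  refine hasDerivAt_implicit (f := hgt lam) (f₁ := fun a t => (variation lam a t).2.1)
    (f₂ := fun a t => (field lam (orbit lam a t)).2.1) ?_ ?_ ?_ ?_ h.continuousAt_hitTime ?_
    h'.field_ne_zero
  · filter_upwards [hpos] with p hp
    exact hasDerivAt_hgt_param p.1 hp.le
  · exact Eventually.of_forall fun p =>
      hasDerivAt_fst_comp (hasDerivAt_snd_comp (hasDerivAt_orbit lam p.1 p.2))
  · exact (continuousAt_variation a h'.time_pos).snd.fst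
  · exact (continuous_field_orbit lam).snd.fst.continuousAt
  · filter_upwards [h.eventually one_pos] with b ⟨T, _, hb⟩
    rw [hb.hitTime.hgt_eq, h'.hgt_eq]

theorem Hits.hasDerivAt_landing {a S : ℝ} (h : Hits lam a S) :
    HasDerivAt (landing lam) (landingDeriv lam a) a := by
  have h' := h.hitTime
  refine hasDerivAt_along (f := orbit lam) (f₁ := variation lam)
    (f₂ := fun a t => field lam (orbit lam a t)) ?_ ?_
    (continuousAt_variation a h'.time_pos) (continuous_field_orbit lam).continuousAt
    h.hasDerivAt_hitTime
  · filter_upwards [eventually_snd_pos (a := a) h'.time_pos] with p hp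
    exact hasDerivAt_orbit_param p.1 hp.le
  · exact Eventually.of_forall fun p => hasDerivAt_orbit lam p.1 p.2

theorem Hits.continuousAt_landingDeriv {a S : ℝ} (h : Hits lam a S) :
    ContinuousAt (landingDeriv lam) a := by
  have h' := h.hitTime
  have h1 : ContinuousAt (fun b => (b, Angenent.hitTime lam b)) a :=
    continuousAt_id.prodMk h.continuousAt_hitTime
  have h2 : ContinuousAt (fun b => variation lam b (Angenent.hitTime lam b)) a :=
    ContinuousAt.comp (f := fun b => (b, Angenent.hitTime lam b))
      (g := fun p : ℝ × ℝ => variation lam p.1 p.2) (continuousAt_variation a h'.time_pos) h1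
  have h3 : ContinuousAt (fun b => field lam (landing lam b)) a :=
    ContinuousAt.comp (f := fun b => (b, Angenent.hitTime lam b))
      (g := fun p : ℝ × ℝ => field lam (orbit lam p.1 p.2))
      (continuous_field_orbit lam).continuousAt h1
  have h4 : ContinuousAt (hitTimeDeriv lam) a := (h2.snd.fst.div h3.snd.fst h'.field_ne_zero).neg
  exact h2.add (h4.smul h3)

theorem Hits.landingDeriv_snd {a S : ℝ} (h : Hits lam a S) : (landingDeriv lam a).2.1 = 0 := by
  have := h.hitTime.field_ne_zero
  simp only [landingDeriv, hitTimeDeriv, landing, Prod.snd_add, Prod.fst_add, Prod.smul_snd,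
    Prod.smul_fst, smul_eq_mul]
  field_simp
  ring

theorem Hits.landingDeriv_ne_zero {a S : ℝ} (h : Hits lam a S)
    (hB : (landingDeriv lam a).1 = 0) : (landingDeriv lam a).2.2 ≠ 0 := fun h0 =>
  variation_add_ne_zero (lam := lam) a h.hitTime.time_pos (hitTimeDeriv lam a)
    (Prod.ext hB (Prod.ext h.landingDeriv_snd h0))

/-- The `g`-length of the orbit up to its return to the half-line. -/
noncomputable def hitLength (lam a : ℝ) : ℝ := arcLength lam a (hitTime lam a)

theorem Hits.hasDerivAt_hitLength (hlam : 1 < lam) {a S : ℝ} (h : Hits lam a S) :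
    HasDerivAt (hitLength lam)
      (weight lam (landing lam a).1 * cos (landing lam a).2.2 * (landingDeriv lam a).1) a := by
  have h' := h.hitTime
  have hT := traj_rad (lam := lam) h.pos
  have hpos := eventually_snd_pos (a := a) h'.time_pos
  have hpos₁ : ∀ᶠ p : ℝ × ℝ in 𝓝 (a, Angenent.hitTime lam a), 0 < p.1 :=
    continuous_fst.continuousAt.eventually (lt_mem_nhds h.pos)
  have hd := hasDerivAt_along (f := arcLength lam) (f₁ := boundaryTerm lam) (f₂ := lengthDens lam)
    (by filter_upwards [hpos, hpos₁] with p hp hp₁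
        exact hasDerivAt_arcLength_param hlam hp₁ hp.le)
    (Eventually.of_forall fun p => hasDerivAt_arcLength hlam p.1 p.2)
    ((continuousOn_boundaryTerm hlam).continuousAt
      (prod_mem_nhds univ_mem (Ici_mem_nhds h'.time_pos)))
    (continuous_lengthDens hlam).continuousAt h.hasDerivAt_hitTime
  refine hd.congr_deriv ?_
  set S := Angenent.hitTime lam a with hS
  have hf : field lam (landing lam a) = _ := field_eq (lam := lam) (r := rad lam a S)
    (x := hgt lam a S) (ω := ang lam a S) (hT.pos S).ne'
  have e2 := h.landingDeriv_snd
  have e1 : (landingDeriv lam a).1 = (variation lam a S).1 +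
      hitTimeDeriv lam a * (speed (rad lam a S) (hgt lam a S) * cos (ang lam a S)) := by
    simp only [landingDeriv, hf, Prod.fst_add, Prod.smul_fst, smul_eq_mul, hS]
  simp only [landingDeriv, hf, Prod.snd_add, Prod.fst_add, Prod.smul_snd,
    Prod.smul_fst, smul_eq_mul] at e2
  have hr : (landing lam a).1 = rad lam a S := rfl
  have hω : (landing lam a).2.2 = ang lam a S := rfl
  rw [e1, hr, hω, boundaryTerm, lengthDens, h'.hgt_eq, dens_zero, smul_eq_mul]
  rw [h'.hgt_eq] at e2
  have e3 : (variation lam a S).2.1 =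
      -(hitTimeDeriv lam a * (speed (rad lam a S) 0 * sin (ang lam a S))) := by linarith
  rw [e3]
  linear_combination -(weight lam (rad lam a S) * hitTimeDeriv lam a * speed (rad lam a S) 0) *
    (sin_sq_add_cos_sq (ang lam a S))

end

section
open Set Filter Topology

variable {lam : ℝ}

theorem continuous_weight (hlam : 1 < lam) : Continuous (weight lam) := by
  have h : Continuous fun r : ℝ => r ^ (lam - 1) :=
    continuous_id.rpow_const fun _ => Or.inr (by linarith)
  unfold weight
  fun_prop

theorem integrableOn_weight (hlam : 1 < lam) : IntegrableOn (weight lam) (Ioi 0) := by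
  refine (integrableOn_rpow_mul_exp_neg_mul_sq (b := 1 / 4) (by norm_num)
    (s := lam - 1) (by linarith)).congr_fun (fun v _ => ?_) measurableSet_Ioi
  simp only [weight]
  ring_nf

/-- The `g`-length of the part of the half-line `x = 0` beyond distance `u`. -/
noncomputable def tail (lam u : ℝ) : ℝ := ∫ v in Ioi u, weight lam v

theorem tail_eq (hlam : 1 < lam) {u : ℝ} (hu : 0 ≤ u) :
    tail lam u = tail lam 0 - ∫ v in (0 : ℝ)..u, weight lam v := by
  have h := intervalIntegral.integral_Ioi_sub_Ioi (integrableOn_weight hlam) hu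
  unfold tail
  linarith

theorem hasDerivAt_tail (hlam : 1 < lam) {u : ℝ} (hu : 0 < u) :
    HasDerivAt (tail lam) (-weight lam u) u := by
  have hc := continuous_weight hlam
  have h : HasDerivAt (fun u => tail lam 0 - ∫ v in (0 : ℝ)..u, weight lam v) (-weight lam u) u :=
    (intervalIntegral.integral_hasDerivAt_right (hc.intervalIntegrable _ _)
      (hc.stronglyMeasurableAtFilter _ _) hc.continuousAt).const_sub _
  refine h.congr_of_eventuallyEq ?_
  filter_upwards [lt_mem_nhds hu] with v hv using tail_eq hlam hv.le

theorem tail_lt (hlam : 1 < lam) {u v : ℝ} (hu : 0 < u) (huv : u < v) :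
    tail lam v < tail lam u := by
  have := lt_of_hasDerivAt_pos (f := fun w => -tail lam w) (f' := weight lam) huv
    (fun w hw => ((hasDerivAt_tail hlam (hu.trans_le hw.1)).continuousAt.neg).continuousWithinAt)
    (fun w hw => (hasDerivAt_tail hlam (hu.trans hw.1)).fun_neg.congr_deriv (neg_neg _))
    fun w hw => weight_pos (hu.trans hw.1)
  linarith

theorem tail_nonneg {u : ℝ} (hu : 0 ≤ u) : 0 ≤ tail lam u :=
  setIntegral_nonneg measurableSet_Ioi fun _ hv => (weight_pos (hu.trans_lt hv)).le

theorem tail_pos (hlam : 1 < lam) {u : ℝ} (hu : 0 < u) : 0 < tail lam u :=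
  (tail_nonneg (by linarith)).trans_lt (tail_lt hlam hu (lt_add_one u))

theorem tail_le (hlam : 1 < lam) {u : ℝ} (hu : 0 ≤ u) : tail lam u ≤ tail lam 0 := by
  rw [tail_eq hlam hu]
  have : 0 ≤ ∫ v in (0 : ℝ)..u, weight lam v := by
    rw [intervalIntegral.integral_of_le hu]
    exact setIntegral_nonneg measurableSet_Ioc fun _ hv => (weight_pos hv.1).le
  linarith

theorem eq_of_tail_eq (hlam : 1 < lam) {u v : ℝ} (hu : 0 < u) (hv : 0 < v)
    (h : tail lam u = tail lam v) : u = v := by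
  rcases lt_trichotomy u v with hlt | heq | hlt
  · exact absurd h (tail_lt hlam hu hlt).ne'
  · exact heq
  · exact absurd h (tail_lt hlam hv hlt).ne

/-- A shallow arc is not much longer than its projection to the half-line. -/
theorem arcLength_add_tail_le {a S : ℝ} (hA : Arc lam (rad lam a) (hgt lam a) (ang lam a) S)
    {h R : ℝ} (hh : ∀ t ∈ Icc 0 S, hgt lam a t ≤ h) (hR : rad lam a S ≤ R) :
    arcLength lam a S + tail lam (rad lam a S) ≤ tail lam 0 + 2 * h * R ^ (lam - 1) := by
  have hlam := hA.lam_gt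
  have ha := hA.pos 0
  rw [rad_zero] at ha
  obtain ⟨p, hp, hωp, -⟩ := hA.exists_top
  set M := R ^ (lam - 1) with hM
  set φ : ℝ → ℝ := fun t => arcLength lam a t + tail lam (rad lam a t) with hφ
  have hφ' : ∀ t, HasDerivAt φ (lengthDens lam a t + -weight lam (rad lam a t) *
      (speed (rad lam a t) (hgt lam a t) * cos (ang lam a t))) t := fun t =>
    (hasDerivAt_arcLength hlam a t).fun_add ((hasDerivAt_tail hlam (hA.pos t)).comp t (hA.hr t))
  have hφc : Continuous φ := continuous_iff_continuousAt.mpr fun t => (hφ' t).continuousAt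
  have hM0 : 0 ≤ M := rpow_nonneg ((hA.pos S).le.trans hR) _
  have hbound : ∀ t ∈ Ioo 0 S, lengthDens lam a t + -weight lam (rad lam a t) *
      (speed (rad lam a t) (hgt lam a t) * cos (ang lam a t)) ≤
      M * (speed (rad lam a t) (hgt lam a t) * |sin (ang lam a t)|) := by
    intro t ht
    have h1 := dens_le_weight (lam := lam) (x := hgt lam a t) (hA.pos t)
    have h2 := weight_le hlam (hA.pos t) ((hA.r_le ht.1.le ht.2.le le_rfl).trans hR)
    have hW := hA.speed_pos t
    have hw := weight_pos (lam := lam) (hA.pos t)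
    have hc := hA.cos_pos ht
    have hcs := sin_sq_add_cos_sq (ang lam a t)
    have hs1 := abs_sin_le_one (ang lam a t)
    have h3 : 1 - cos (ang lam a t) ≤ |sin (ang lam a t)| := by
      nlinarith [sq_abs (sin (ang lam a t)), abs_nonneg (sin (ang lam a t)),
        cos_le_one (ang lam a t)]
    unfold lengthDens
    calc _ ≤ weight lam (rad lam a t) * speed (rad lam a t) (hgt lam a t) + -weight lam (rad lam a t) *
            (speed (rad lam a t) (hgt lam a t) * cos (ang lam a t)) := by gcongr
      _ = weight lam (rad lam a t) * (speed (rad lam a t) (hgt lam a t) *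
            (1 - cos (ang lam a t))) := by ring
      _ ≤ M * (speed (rad lam a t) (hgt lam a t) * |sin (ang lam a t)|) := by
          have := cos_le_one (ang lam a t)
          gcongr
  have hx := hA.continuous_x
  have hup := le_of_hasDerivAt_nonneg (f := fun t => M * hgt lam a t - φ t) hp.1.le
    (by fun_prop) (fun t _ => ((hA.hx t).const_mul M).fun_sub (hφ' t)) fun t ht => by
      have h1 := hbound t ⟨ht.1, ht.2.trans hp.2⟩
      rw [abs_of_pos (hA.sin_pos ht.1.le hωp ht.2 hp.2.le)] at h1
      linarith
  have hdown := le_of_hasDerivAt_nonneg (f := fun t => -(M * hgt lam a t) - φ t) hp.2.le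
    (by fun_prop) (fun t _ => ((hA.hx t).const_mul M).fun_neg.fun_sub (hφ' t)) fun t ht => by
      have h1 := hbound t ⟨hp.1.trans ht.1, ht.2⟩
      rw [abs_of_neg (hA.sin_neg hp.1.le hωp ht.1 ht.2.le)] at h1
      linarith
  have h0 : φ 0 = tail lam a := by simp [hφ, arcLength]
  simp only [hgt_zero, h0, hA.x_S] at hup hdown
  have h1 := tail_le hlam ha.le
  have h2 := mul_le_mul_of_nonneg_left (hh p ⟨hp.1.le, hp.2.le⟩) hM0
  change φ S ≤ _
  linarith

theorem Hits.eq_of_landing_eq {a b S T : ℝ} (ha : Hits lam a S) (hb : Hits lam b T)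
    (h : orbit lam a S = orbit lam b T) : a = b := by
  have h1 : rad lam a S = rad lam b T := congrArg Prod.fst h
  have h2 : hgt lam a S = hgt lam b T := congrArg (fun y => y.2.1) h
  have h3 : ang lam a S = ang lam b T := congrArg (fun y => y.2.2) h
  have key := ((traj_rad (lam := lam) ha.pos).shift S).eq_of_eq_at
    ((traj_rad (lam := lam) hb.pos).shift T) (t₀ := 0)
    (by simpa using h1) (by simpa using h2) (by simpa using h3)
  rcases lt_trichotomy S T with hlt | heq | hlt
  · have h1 := (key (-S)).2.1
    have h2 := hb.hgt_pos (-S + T) ⟨by linarith, by linarith [ha.time_pos]⟩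
    simp only [neg_add_cancel, hgt_zero] at h1
    exact absurd h1 h2.ne
  · have h1 := (key (-S)).1
    simpa [heq] using h1
  · have h1 := (key (-T)).2.1
    have h2 := ha.hgt_pos (-T + S) ⟨by linarith, by linarith [hb.time_pos]⟩
    simp only [neg_add_cancel, hgt_zero] at h1
    exact absurd h1 h2.ne'

theorem exists_last_max {f : ℝ → ℝ} {p q : ℝ} (hpq : p ≤ q) (hf : ContinuousOn f (Icc p q)) :
    ∃ c ∈ Icc p q, (∀ t ∈ Icc p q, f t ≤ f c) ∧ ∀ t ∈ Ioc c q, f t < f c := by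
  obtain ⟨m, hm, hmax⟩ := isCompact_Icc.exists_isMaxOn (nonempty_Icc.mpr hpq) hf
  have hK : IsCompact (Icc p q ∩ f ⁻¹' {f m}) :=
    isCompact_Icc.of_isClosed_subset (hf.preimage_isClosed_of_isClosed isClosed_Icc
      isClosed_singleton) inter_subset_left
  obtain ⟨c, ⟨hc, hcm⟩, hgr⟩ := hK.exists_isGreatest ⟨m, hm, rfl⟩
  have hcm' : f c = f m := hcm
  refine ⟨c, hc, fun t ht => hcm' ▸ hmax ht, fun t ht => ?_⟩
  have htm : t ∈ Icc p q := ⟨hc.1.trans ht.1.le, ht.2⟩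
  refine lt_of_le_of_ne (hcm' ▸ hmax htm) fun heq => ?_
  exact absurd (hgr ⟨htm, heq.trans hcm'⟩) (not_le.mpr ht.1)

/-- The `g`-length of an arc, completed by a multiple of the length of the half-line beyond its
endpoint. -/
noncomputable def completedLength (lam a : ℝ) : ℝ :=
  hitLength lam a + cos (landing lam a).2.2 * tail lam (landing lam a).1

theorem Hits.landing_pos {a S : ℝ} (h : Hits lam a S) : 0 < (landing lam a).1 :=
  (traj_rad h.pos).pos _

theorem Hits.hasDerivAt_cos_landing {a S : ℝ} (h : Hits lam a S) :
    HasDerivAt (fun a => cos (landing lam a).2.2)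
      (-sin (landing lam a).2.2 * (landingDeriv lam a).2.2) a :=
  (hasDerivAt_snd_comp (hasDerivAt_snd_comp h.hasDerivAt_landing)).cos

theorem Hits.hasDerivAt_tail_landing (hlam : 1 < lam) {a S : ℝ} (h : Hits lam a S) :
    HasDerivAt (fun a => tail lam (landing lam a).1)
      (-weight lam (landing lam a).1 * (landingDeriv lam a).1) a :=
  HasDerivAt.comp (h := fun a => (landing lam a).1) (h₂ := tail lam) a
    (hasDerivAt_tail hlam h.landing_pos) (hasDerivAt_fst_comp h.hasDerivAt_landing)

theorem Hits.hasDerivAt_completedLength (hlam : 1 < lam) {a S : ℝ} (h : Hits lam a S) :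
    HasDerivAt (completedLength lam) (-(tail lam (landing lam a).1 *
      (sin (landing lam a).2.2 * (landingDeriv lam a).2.2))) a := by
  refine ((h.hasDerivAt_hitLength hlam).fun_add
    (h.hasDerivAt_cos_landing.fun_mul (h.hasDerivAt_tail_landing hlam))).congr_deriv ?_
  ring

end

section
open Set Filter Topology

variable {lam : ℝ}

/-- The loss in completed length between a last maximum of the cosine of the landing angle and an
orthogonal landing. -/
theorem completedLength_add_le (hlam : 1 < lam) {p q R : ℝ} (hpq : p < q)
    (hH : ∀ b ∈ Icc p q, Hits lam b (hitTime lam b))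
    (hB : ∀ b ∈ Icc p q, (landing lam b).1 ≤ R)
    (hlow : ∀ b ∈ Ico p q, -(π / 2) < (landing lam b).2.2)
    (hneg : ∀ b ∈ Icc p q, (landing lam b).2.2 < 0) (hq : (landing lam q).2.2 = -(π / 2))
    (hlast : ∀ b ∈ Ioc p q, cos (landing lam b).2.2 < cos (landing lam p).2.2) :
    completedLength lam q + tail lam R * cos (landing lam p).2.2 ≤ completedLength lam p := by
  have hp : p ∈ Icc p q := left_mem_Icc.mpr hpq.le
  have hqm : q ∈ Icc p q := right_mem_Icc.mpr hpq.le
  have hlow' : ∀ b ∈ Icc p q, -(π / 2) ≤ (landing lam b).2.2 := fun b hb => by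
    rcases hb.2.eq_or_lt with rfl | hlt
    · exact hq.ge
    · exact (hlow b ⟨hb.1, hlt⟩).le
  have hsin : ∀ b ∈ Icc p q, sin (landing lam b).2.2 < 0 := fun b hb =>
    sin_neg_of_neg_of_neg_pi_lt (hneg b hb) (by linarith [hlow' b hb, pi_pos])
  have hcos0 : cos (landing lam q).2.2 = 0 := by rw [hq, cos_neg, cos_pi_div_two]
  have hcL : ContinuousOn (landing lam) (Icc p q) := fun b hb =>
    (hH b hb).hasDerivAt_landing.continuousAt.continuousWithinAt
  have hcD : ContinuousOn (landingDeriv lam) (Icc p q) := fun b hb =>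
    (hH b hb).continuousAt_landingDeriv.continuousWithinAt
  have hcB : ContinuousOn (fun b => (landing lam b).1) (Icc p q) := hcL.fst
  have hcΘ : ContinuousOn (fun b => (landing lam b).2.2) (Icc p q) := hcL.snd.snd
  have hcB' : ContinuousOn (fun b => (landingDeriv lam b).1) (Icc p q) := hcD.fst
  have hcΘ' : ContinuousOn (fun b => (landingDeriv lam b).2.2) (Icc p q) := hcD.snd.snd
  have hcw : ContinuousOn (fun b => weight lam (landing lam b).1) (Icc p q) :=
    (continuous_weight hlam).comp_continuousOn hcB
  set g' : ℝ → ℝ := fun b => sin (landing lam b).2.2 * (landingDeriv lam b).2.2 with hg'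
  have hcg' : ContinuousOn g' (Icc p q) := (continuous_sin.comp_continuousOn hcΘ).mul hcΘ'
  have hgd : ∀ b ∈ Icc p q, HasDerivAt (fun b => -cos (landing lam b).2.2) (g' b) b := fun b hb =>
    (hH b hb).hasDerivAt_cos_landing.fun_neg.congr_deriv (by simp only [hg']; ring)
  have hS := integral_mul_deriv_nonneg_of_embedded
    (f := fun b => tail lam (landing lam b).1 - tail lam R)
    (g := fun b => -cos (landing lam b).2.2)
    (f' := fun b => -weight lam (landing lam b).1 * (landingDeriv lam b).1) (g' := g') hpq
    (fun b hb => ((hH b hb).hasDerivAt_tail_landing hlam).sub_const _)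
    hgd
    (hcw.neg.mul hcB') hcg' ?_ ?_ (fun b hb => neg_lt_neg (hlast b hb)) ?_ ?_
  · have htail : ContinuousOn (fun b => tail lam (landing lam b).1) (Icc p q) := fun b hb =>
      ((hH b hb).hasDerivAt_tail_landing hlam).continuousAt.continuousWithinAt
    have hKd : ∀ b ∈ uIcc p q, HasDerivAt (completedLength lam)
        (-(tail lam (landing lam b).1 * g' b)) b := fun b hb => by
      rw [uIcc_of_le hpq.le] at hb
      exact (hH b hb).hasDerivAt_completedLength hlam
    have i1 : IntervalIntegrable (fun b => tail lam (landing lam b).1 * g' b) volume p q :=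
      (htail.mul hcg').intervalIntegrable_of_Icc hpq.le
    have i2 : IntervalIntegrable g' volume p q := hcg'.intervalIntegrable_of_Icc hpq.le
    have e1 := intervalIntegral.integral_eq_sub_of_hasDerivAt hKd i1.neg
    have e2 := intervalIntegral.integral_eq_sub_of_hasDerivAt
      (fun b hb => hgd b (by rwa [uIcc_of_le hpq.le] at hb)) i2
    simp only [sub_mul] at hS
    rw [intervalIntegral.integral_sub i1 (i2.const_mul _), intervalIntegral.integral_const_mul,
      e2, hcos0] at hS
    rw [intervalIntegral.integral_neg] at e1
    linarith
  · intro s hs t ht hf hg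
    have hB' := eq_of_tail_eq hlam (hH s hs).landing_pos (hH t ht).landing_pos (sub_left_inj.mp hf)
    have hΘ := injOn_cos (x₁ := -(landing lam s).2.2) (x₂ := -(landing lam t).2.2)
      ⟨by linarith [hneg s hs], by linarith [hlow' s hs, pi_pos]⟩
      ⟨by linarith [hneg t ht], by linarith [hlow' t ht, pi_pos]⟩
      (by rw [cos_neg, cos_neg]; exact neg_inj.mp hg)
    refine (hH s hs).eq_of_landing_eq (hH t ht) (Prod.ext hB' (Prod.ext ?_ (neg_inj.mp hΘ)))
    exact (hH s hs).hgt_eq.trans (hH t ht).hgt_eq.symm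
  · intro t ht hf
    have hw := weight_pos (lam := lam) (hH t ht).landing_pos
    have hB' : (landingDeriv lam t).1 = 0 := (mul_eq_zero.mp hf).resolve_left (neg_ne_zero.mpr hw.ne')
    exact mul_ne_zero (hsin t ht).ne ((hH t ht).landingDeriv_ne_zero hB')
  · intro t ht
    have : 0 < cos (landing lam t).2.2 :=
      cos_pos_of_mem_Ioo ⟨hlow t ht, by linarith [hneg t ⟨ht.1, ht.2.le⟩, pi_pos]⟩
    simp only [hcos0]
    linarith
  · intro t ht
    rcases (hB t ht).eq_or_lt with heq | hlt
    · rw [heq, sub_self]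
    · linarith [tail_lt hlam (hH t ht).landing_pos hlt]

/-- There is an arc orthogonal to the half-line at both endpoints and shorter than the half-line. -/
theorem exists_short_orthogonal_arc (hlam : 1 < lam) :
    ∃ a S, Arc lam (rad lam a) (hgt lam a) (ang lam a) S ∧ ang lam a S = -(π / 2) ∧
      arcLength lam a S < ∫ v in Ioi 0, weight lam v := by
  obtain ⟨R₀, hR₀, hsmall⟩ := exists_lands_of_small hlam
  obtain ⟨a₁, ha₁, hs₁⟩ := hsmall 1 one_pos
  obtain ⟨q, haq, hgood, hbad⟩ := exists_critical hlam ha₁ fun v hv =>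
    (hs₁ v hv).imp fun S hS => hS.1
  have hq : 0 < q := ha₁.trans_le haq
  obtain ⟨S, hAq, hang⟩ := exists_orthogonal_arc hlam hq hgood hbad
  have hA : ∀ b ∈ Ioc 0 q, Arc lam (rad lam b) (hgt lam b) (ang lam b) (hitTime lam b) := by
    intro b hb
    rcases hb.2.eq_or_lt with rfl | hlt
    · rwa [hAq.hits.hitTime_eq]
    · obtain ⟨T, hT⟩ := hgood b ⟨hb.1, hlt⟩
      rw [hT.2.1.hits.hitTime_eq]
      exact hT.2.1
  have hlow : ∀ b ∈ Ioo 0 q, -(π / 2) < (landing lam b).2.2 := by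
    intro b hb
    obtain ⟨T, hT⟩ := hgood b hb
    rw [landing, hT.2.1.hits.hitTime_eq]
    exact hT.2.2
  have hneg : ∀ b ∈ Ioc 0 q, (landing lam b).2.2 < 0 := fun b hb => (hA b hb).ω_S_neg
  have hqang : (landing lam q).2.2 = -(π / 2) := by rw [landing, hAq.hits.hitTime_eq]; exact hang
  have hcL : ContinuousOn (landing lam) (Ioc 0 q) := fun b hb =>
    (hA b hb).hits.hasDerivAt_landing.continuousAt.continuousWithinAt
  have hcB : ContinuousOn (fun b => (landing lam b).1) (Ioc 0 q) := hcL.fst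
  have hccos : ContinuousOn (fun b => cos (landing lam b).2.2) (Ioc 0 q) :=
    continuous_cos.comp_continuousOn hcL.snd.snd
  obtain ⟨R, hR₀R, hR⟩ : ∃ R, R₀ ≤ R ∧ ∀ b ∈ Ioc 0 q, (landing lam b).1 ≤ R := by
    obtain ⟨m, -, hm⟩ := isCompact_Icc.exists_isMaxOn (nonempty_Icc.mpr (by linarith))
      (hcB.mono fun b (hb : b ∈ Icc (a₁ / 2) q) => ⟨by linarith [hb.1], hb.2⟩)
    refine ⟨max R₀ (landing lam m).1, le_max_left _ _, fun b hb => ?_⟩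
    rcases lt_or_ge b (a₁ / 2) with hlt | hge
    · obtain ⟨T, hT, -, hTR, -⟩ := hs₁ b ⟨hb.1, by linarith⟩
      rw [landing, hT.2.1.hits.hitTime_eq]
      exact le_max_of_le_left hTR
    · exact le_max_of_le_right (hm ⟨hge, hb.2⟩)
  have hRpos : 0 < R := hR₀.trans_le hR₀R
  set c₀ := tail lam R with hc₀
  have hc₀pos : 0 < c₀ := tail_pos hlam hRpos
  set M := R ^ (lam - 1) with hM
  have hMpos : 0 < M := rpow_pos_of_pos hRpos _
  obtain ⟨ε, hε, hε2, hεM⟩ : ∃ ε > 0, ε ≤ 1 / 2 ∧ 2 * ε * M < c₀ / 2 := by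
    refine ⟨min (1 / 2) (c₀ / (8 * M)), by positivity, min_le_left _ _, ?_⟩
    have h1 : min (1 / 2) (c₀ / (8 * M)) * M ≤ c₀ / (8 * M) * M := by gcongr; exact min_le_right _ _
    have h2 : c₀ / (8 * M) * M = c₀ / 8 := by field_simp
    linarith
  obtain ⟨a₂, ha₂, hs₂⟩ := hsmall ε hε
  obtain ⟨u, hu, hua, huq⟩ : ∃ u > 0, u < a₂ ∧ u < q :=
    ⟨min a₂ q / 2, by positivity, by linarith [min_le_left a₂ q, lt_min ha₂ hq],
      by linarith [min_le_right a₂ q, lt_min ha₂ hq]⟩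
  obtain ⟨m, hm, hmax⟩ := isCompact_Icc.exists_isMaxOn (nonempty_Icc.mpr huq.le)
    (hccos.mono fun b (hb : b ∈ Icc u q) => ⟨hu.trans_le hb.1, hb.2⟩)
  have hm' : m ∈ Ioc 0 q := ⟨hu.trans_le hm.1, hm.2⟩
  have hm1 : cos (landing lam m).2.2 < 1 := by
    have := (hA m hm').hits.sin_neg
    change sin (landing lam m).2.2 < 0 at this
    nlinarith [sin_sq_add_cos_sq (landing lam m).2.2, cos_le_one (landing lam m).2.2]
  obtain ⟨ε', hε', hεε, hεm⟩ : ∃ ε' > 0, ε' ≤ ε ∧ ε' < 1 - cos (landing lam m).2.2 :=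
    ⟨min ε ((1 - cos (landing lam m).2.2) / 2), lt_min hε (by linarith), min_le_left _ _,
      (min_le_right _ _).trans_lt (by linarith)⟩
  obtain ⟨a₃, ha₃, hs₃⟩ := hsmall ε' hε'
  obtain ⟨v, hv, hva, hvu⟩ : ∃ v > 0, v < a₃ ∧ v < u :=
    ⟨min a₃ u / 2, by positivity, by linarith [min_le_left a₃ u, lt_min ha₃ hu],
      by linarith [min_le_right a₃ u, lt_min ha₃ hu]⟩
  have hvcos : 1 - ε' ≤ cos (landing lam v).2.2 := by
    obtain ⟨T, hT, -, -, hc⟩ := hs₃ v ⟨hv, hva⟩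
    rw [landing, hT.2.1.hits.hitTime_eq]
    exact hc
  obtain ⟨p, hp, hpmax, hplast⟩ := exists_last_max (hvu.trans huq).le
    (hccos.mono fun b (hb : b ∈ Icc v q) => ⟨hv.trans_le hb.1, hb.2⟩)
  have hpcos := hpmax v ⟨le_rfl, (hvu.trans huq).le⟩
  have hpu : p < u := by
    by_contra! hge
    have : cos (landing lam p).2.2 ≤ cos (landing lam m).2.2 := hmax ⟨hge, hp.2⟩
    linarith
  have hp0 : 0 < p := hv.trans_le hp.1
  have hsub : ∀ b ∈ Icc p q, b ∈ Ioc 0 q := fun b hb => ⟨hp0.trans_le hb.1, hb.2⟩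
  have hmain := completedLength_add_le hlam (hpu.trans huq) (R := R)
    (fun b hb => (hA b (hsub b hb)).hits) (fun b hb => hR b (hsub b hb))
    (fun b hb => hlow b ⟨hp0.trans_le hb.1, hb.2⟩) (fun b hb => hneg b (hsub b hb)) hqang hplast
  have hpm : p ∈ Ioc 0 q := ⟨hp0, hp.2⟩
  have hshallow : arcLength lam p (hitTime lam p) + tail lam (landing lam p).1 ≤
      tail lam 0 + 2 * ε * M := by
    obtain ⟨T, hT, hh, -, -⟩ := hs₂ p ⟨hp0, hpu.trans hua⟩
    refine arcLength_add_tail_le (hA p hpm) (fun t ht => hh t ?_) (hR p hpm)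
    rwa [hT.2.1.hits.hitTime_eq] at ht
  have hK : completedLength lam p ≤
      arcLength lam p (hitTime lam p) + tail lam (landing lam p).1 := by
    have h1 := tail_nonneg (lam := lam) (hA p hpm).hits.landing_pos.le
    have h2 := cos_le_one (landing lam p).2.2
    unfold completedLength hitLength
    nlinarith
  refine ⟨q, S, hAq, hang, ?_⟩
  have hKq : completedLength lam q = arcLength lam q S := by
    rw [completedLength, hqang, cos_neg, cos_pi_div_two, hitLength, hAq.hits.hitTime_eq]
    ring
  change _ < tail lam 0
  rw [hKq] at hmain
  have h3 : c₀ * (1 / 2) ≤ c₀ * cos (landing lam p).2.2 := by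
    gcongr
    linarith
  linarith

end

section
open Set Filter Topology

variable {lam : ℝ} {r x ω : ℝ → ℝ}

theorem Traj.contDiff (h : Traj lam r x ω) : ContDiff ℝ (⊤ : ℕ∞) fun t => (r t, x t, ω t) := by
  refine contDiff_infty.mpr fun n => ?_
  induction n with
  | zero => exact contDiff_zero.mpr (continuous_iff_continuousAt.mpr fun t =>
      (h.hasDerivAt_field t).continuousAt)
  | succ n ih =>
    rw [Nat.cast_succ]
    refine contDiff_succ_iff_deriv.mpr ⟨fun t => (h.hasDerivAt_field t).differentiableAt,
      fun hn => absurd hn (by simp), ?_⟩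
    rw [funext fun t => (h.hasDerivAt_field t).deriv]
    exact (contDiff_field lam).comp ih

section rescale

variable (h : Traj lam r x ω) (k : ℝ)
include h

theorem Traj.hasDerivAt_r_rescale (u : ℝ) : HasDerivAt (fun u => r (k * u))
    (k * (speed (r (k * u)) (x (k * u)) * cos (ω (k * u)))) u :=
  ((h.hr (k * u)).comp u ((hasDerivAt_id u).const_mul k)).congr_deriv (by ring)

theorem Traj.hasDerivAt_x_rescale (u : ℝ) : HasDerivAt (fun u => x (k * u))
    (k * (speed (r (k * u)) (x (k * u)) * sin (ω (k * u)))) u :=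
  ((h.hx (k * u)).comp u ((hasDerivAt_id u).const_mul k)).congr_deriv (by ring)

theorem Traj.hasDerivAt_ω_rescale (u : ℝ) : HasDerivAt (fun u => ω (k * u))
    (k * -(speed (r (k * u)) (x (k * u)) * curv lam (r (k * u)) (x (k * u)) (ω (k * u)))) u :=
  ((h.hω (k * u)).comp u ((hasDerivAt_id u).const_mul k)).congr_deriv (by ring)

theorem Traj.deriv_r_rescale : deriv (fun u => r (k * u)) = fun u =>
    k * (speed (r (k * u)) (x (k * u)) * cos (ω (k * u))) :=
  funext fun u => (h.hasDerivAt_r_rescale k u).deriv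

theorem Traj.deriv_x_rescale : deriv (fun u => x (k * u)) = fun u =>
    k * (speed (r (k * u)) (x (k * u)) * sin (ω (k * u))) :=
  funext fun u => (h.hasDerivAt_x_rescale k u).deriv

theorem Traj.deriv_sq_add_deriv_sq (u : ℝ) :
    deriv (fun u => r (k * u)) u ^ 2 + deriv (fun u => x (k * u)) u ^ 2 =
      (k * speed (r (k * u)) (x (k * u))) ^ 2 := by
  rw [h.deriv_r_rescale, h.deriv_x_rescale]
  linear_combination (k * speed (r (k * u)) (x (k * u))) ^ 2 * sin_sq_add_cos_sq (ω (k * u))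

theorem Traj.geodesic_equation (hk : k ≠ 0) (u : ℝ) :
    (deriv (fun u => x (k * u)) u * deriv (deriv fun u => r (k * u)) u -
        deriv (deriv fun u => x (k * u)) u * deriv (fun u => r (k * u)) u) /
      (deriv (fun u => x (k * u)) u ^ 2 + deriv (fun u => r (k * u)) u ^ 2) =
    ((lam - 1) / r (k * u) - r (k * u) / 2) * deriv (fun u => x (k * u)) u +
      (1 / 2) * x (k * u) * deriv (fun u => r (k * u)) u := by
  have hW := hasDerivAt_speed (h.hasDerivAt_r_rescale k u) (h.hasDerivAt_x_rescale k u)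
  have hω := h.hasDerivAt_ω_rescale k u
  have hr2 := ((hW.fun_mul hω.cos).const_mul k).deriv
  have hx2 := ((hW.fun_mul hω.sin).const_mul k).deriv
  have hpos := (h.speed_pos (k * u)).ne'
  rw [add_comm (deriv (fun u => x (k * u)) u ^ 2), h.deriv_sq_add_deriv_sq, div_eq_iff (by positivity),
    h.deriv_r_rescale, h.deriv_x_rescale, hr2, hx2]
  simp only [curv]
  linear_combination (k ^ 3 * speed (r (k * u)) (x (k * u)) ^ 3 *
    (((lam - 1) / r (k * u) - r (k * u) / 2) * sin (ω (k * u)) + x (k * u) / 2 * cos (ω (k * u)))) *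
      sin_sq_add_cos_sq (ω (k * u))

end rescale

variable {S : ℝ}

theorem Arc.r_neg (h : Arc lam r x ω S) (t : ℝ) : r (-t) = r t ∧ x (-t) = -x t := by
  have := (h.reflect 0 (d := π) cos_pi_sub sin_pi_sub).eq_of_eq_at h.toTraj (t₀ := 0) (by simp)
    (by simp [h.x_zero]) (by simp [h.ω_zero]; ring) t
  simp only [zero_sub] at this
  exact ⟨this.1, by linarith [this.2.1]⟩

theorem Arc.r_reflect (h : Arc lam r x ω S) (hS : ω S = -(π / 2)) (t : ℝ) :
    r (2 * S - t) = r t ∧ x (2 * S - t) = -x t := by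
  have e : 2 * S - S = S := by ring
  have := (h.reflect (2 * S) (d := -π) (fun θ => by rw [← cos_neg, neg_sub, sub_neg_eq_add, cos_add_pi])
    (fun θ => by rw [← neg_inj, ← Real.sin_neg, neg_sub, sub_neg_eq_add, sin_add_pi])).eq_of_eq_at
    h.toTraj (t₀ := S) (by rw [e]) (by rw [e, h.x_S, neg_zero]) (by rw [e, hS]; ring) t
  exact ⟨this.1, by linarith [this.2.1]⟩

theorem Arc.periodic (h : Arc lam r x ω S) (hS : ω S = -(π / 2)) (t : ℝ) :
    r (t + 2 * S) = r t ∧ x (t + 2 * S) = x t := by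
  have h1 := h.r_reflect hS (-t)
  have h2 := h.r_neg t
  rw [show 2 * S - -t = t + 2 * S by ring] at h1
  exact ⟨h1.1.trans h2.1, by rw [h1.2, h2.2, neg_neg]⟩

theorem Arc.x_nonneg (h : Arc lam r x ω S) {t : ℝ} (ht : t ∈ Icc 0 S) : 0 ≤ x t := by
  rcases ht.1.eq_or_lt with rfl | h0
  · exact h.x_zero.ge
  rcases ht.2.eq_or_lt with rfl | h1
  · exact h.x_S.ge
  · exact (h.x_pos t ⟨h0, h1⟩).le

theorem Arc.x_neg (h : Arc lam r x ω S) (hS : ω S = -(π / 2)) {t : ℝ} (ht : t ∈ Ioo S (2 * S)) :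
    x t < 0 := by
  have h1 := h.x_pos (2 * S - t) ⟨by linarith [ht.2], by linarith [ht.1]⟩
  linarith [(h.r_reflect hS t).2]

theorem Arc.r_injOn (h : Arc lam r x ω S) : InjOn r (Icc 0 S) :=
  StrictMonoOn.injOn fun _ hs _ ht hst => h.r_lt hs.1 hst ht.2

theorem Arc.injective (h : Arc lam r x ω S) (hS : ω S = -(π / 2)) {s t : ℝ}
    (hs : s ∈ Ico 0 (2 * S)) (ht : t ∈ Ico 0 (2 * S)) (hr : r s = r t) (hx : x s = x t) :
    s = t := by
  rcases le_or_gt s S with h1 | h1 <;> rcases le_or_gt t S with h2 | h2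
  · exact h.r_injOn ⟨hs.1, h1⟩ ⟨ht.1, h2⟩ hr
  · linarith [h.x_nonneg ⟨hs.1, h1⟩, h.x_neg hS ⟨h2, ht.2⟩]
  · linarith [h.x_nonneg ⟨ht.1, h2⟩, h.x_neg hS ⟨h1, hs.2⟩]
  · have := h.r_injOn (x₁ := 2 * S - s) (x₂ := 2 * S - t) ⟨by linarith [hs.2], by linarith⟩
      ⟨by linarith [ht.2], by linarith⟩
      (by rw [(h.r_reflect hS s).1, (h.r_reflect hS t).1, hr])
    linarith

theorem arcLength_double (hlam : 1 < lam) {a : ℝ}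
    (h : Arc lam (rad lam a) (hgt lam a) (ang lam a) S) (hS : ang lam a S = -(π / 2)) :
    ∫ t in (0 : ℝ)..2 * S, lengthDens lam a t = 2 * arcLength lam a S := by
  have hc : Continuous (lengthDens lam a) :=
    (continuous_lengthDens hlam).comp (by fun_prop : Continuous fun t : ℝ => (a, t))
  have hsym : ∀ t, lengthDens lam a (2 * S - t) = lengthDens lam a t := fun t => by
    simp only [lengthDens, dens, speed, (h.r_reflect hS t).1, (h.r_reflect hS t).2, neg_sq]
  have h1 := intervalIntegral.integral_comp_sub_left (a := S) (b := 2 * S) (lengthDens lam a) (2 * S)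
  simp only [hsym, sub_self, show 2 * S - S = S by ring] at h1
  rw [← intervalIntegral.integral_add_adjacent_intervals (hc.intervalIntegrable 0 S)
    (hc.intervalIntegrable S (2 * S)), h1, arcLength]
  ring

end

end Angenent

/-- Existence of a smooth simple closed geodesic (a "λ-Angenent curve") in the
half-plane `{(r,x) : r > 0}` with the metric `g = r^{2(λ-1)} e^{-(r²+x²)/2} (dr²+dx²)`,
whose `g`-length is strictly less than the length of the double cover of the
half-line `x = 0`. -/
theorem lambda_angenent_curve_exists (lam : ℝ) (hlam : 1 < lam) :
    ∃ r x : ℝ → ℝ,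
      ContDiff ℝ (⊤ : ℕ∞) r ∧ ContDiff ℝ (⊤ : ℕ∞) x ∧
      (∀ u : ℝ, r (u + 1) = r u ∧ x (u + 1) = x u) ∧
      (∀ u ∈ Set.Ico (0:ℝ) 1, ∀ v ∈ Set.Ico (0:ℝ) 1,
        r u = r v → x u = x v → u = v) ∧
      (∀ u : ℝ, 0 < r u) ∧
      (∀ u : ℝ, 0 < (deriv r u) ^ 2 + (deriv x u) ^ 2) ∧
      (∀ u : ℝ,
        (deriv x u * deriv (deriv r) u - deriv (deriv x) u * deriv r u) /
            ((deriv x u) ^ 2 + (deriv r u) ^ 2)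
          = ((lam - 1) / r u - r u / 2) * deriv x u + (1 / 2) * x u * deriv r u) ∧
      (∫ u in (0:ℝ)..1,
          r u ^ (lam - 1) * exp (-(r u ^ 2 + x u ^ 2) / 4) *
            Real.sqrt ((deriv r u) ^ 2 + (deriv x u) ^ 2))
        < 2 * ∫ u in Set.Ioi (0:ℝ), u ^ (lam - 1) * exp (-u ^ 2 / 4) := by
  obtain ⟨a, S, h, hS, hlt⟩ := Angenent.exists_short_orthogonal_arc hlam
  have hk : 0 < 2 * S := by linarith [h.S_pos]
  have hsmooth := h.contDiff
  have hscale : ContDiff ℝ (⊤ : ℕ∞) fun u : ℝ => 2 * S * u := by fun_prop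
  refine ⟨fun u => Angenent.rad lam a (2 * S * u), fun u => Angenent.hgt lam a (2 * S * u),
    hsmooth.fst.comp hscale, hsmooth.snd.fst.comp hscale, fun u => ?_, fun u hu v hv hr hx => ?_,
    fun u => h.pos _, fun u => ?_, fun u => h.geodesic_equation _ hk.ne' u, ?_⟩
  · simpa only [mul_add, mul_one] using h.periodic hS (2 * S * u)
  · have hmem : ∀ w ∈ Set.Ico (0 : ℝ) 1, 2 * S * w ∈ Set.Ico 0 (2 * S) := fun w hw =>
      ⟨mul_nonneg hk.le hw.1, by nlinarith [hw.2]⟩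
    exact mul_left_cancel₀ hk.ne' (h.injective hS (hmem u hu) (hmem v hv) hr hx)
  · rw [h.deriv_sq_add_deriv_sq]
    have := h.speed_pos (2 * S * u)
    positivity
  · have hlen : ∀ u, Angenent.rad lam a (2 * S * u) ^ (lam - 1) *
        exp (-(Angenent.rad lam a (2 * S * u) ^ 2 + Angenent.hgt lam a (2 * S * u) ^ 2) / 4) *
        √(deriv (fun u => Angenent.rad lam a (2 * S * u)) u ^ 2 +
          deriv (fun u => Angenent.hgt lam a (2 * S * u)) u ^ 2) =
        2 * S * Angenent.lengthDens lam a (2 * S * u) := fun u => by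
      rw [h.deriv_sq_add_deriv_sq, sqrt_sq (mul_pos hk (h.speed_pos _)).le, Angenent.lengthDens,
        Angenent.dens]
      ring
    simp only [hlen]
    rw [intervalIntegral.integral_const_mul, intervalIntegral.mul_integral_comp_mul_left, mul_zero,
      mul_one, Angenent.arcLength_double hlam h hS]
    exact mul_lt_mul_of_pos_left hlt two_pos
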